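/- arXiv:2409.00307 — 3 statements merged into one kernel-verified Lean document; each statement's English description precedes it below -/
import Mathlib

section
/- Let β > 1/2 and let s and N be sufficiently large integers. Fix T > 0. Then there is a constant C, independent of ν, such that for every sufficiently small ν > 0 and every smooth solution u^ν of the Navier–Stokes equations with viscosity ν and force f^ν on the periodic strip Ω_𝕋 (or the infinite strip ℝ × [−1,1]) with no-slip boundary conditions u^ν(t,x,±1) = (±1,0), if ‖u^ν(0,·,·) − U_s‖_{H^s} ≤ ν^β and ‖f^ν‖_{C¹([0,T],H^s)} ≤ ν^N, then ‖u^ν − U_s‖_{L^∞([0,T],L²)} ≤ C ν^β, ‖u^ν − U_s‖_{L^∞([0,T],L^∞)} ≤ C ν^β, and ‖∇(u^ν − U_s)‖_{L^∞([0,T],L^∞)} ≤ C ν^{β−1/2}. In particular limsup_{ν→0} ν^{1/2−β}‖∇×(u^ν − U_s)‖_{L^∞([0,T],L^∞)} < ∞. -/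
noncomputable section

open Set Filter Topology MeasureTheory intervalIntegral

/-- Partial derivative in the horizontal variable. -/
def pdx (f : ℝ → ℝ → ℝ) : ℝ → ℝ → ℝ := fun x y => deriv (fun x' => f x' y) x

/-- Partial derivative in the vertical variable. -/
def pdy (f : ℝ → ℝ → ℝ) : ℝ → ℝ → ℝ := fun x y => deriv (fun y' => f x y') y

/-- First component of a planar vector field. -/
def c1 (u : ℝ → ℝ → ℝ × ℝ) : ℝ → ℝ → ℝ := fun x y => (u x y).1

/-- Second component of a planar vector field. -/
def c2 (u : ℝ → ℝ → ℝ × ℝ) : ℝ → ℝ → ℝ := fun x y => (u x y).2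

/-- Square of the `L²` norm over the fundamental domain of the periodic strip
`Ω_𝕋 = 𝕋 × [−1,1]`. -/
def sqL2 (f : ℝ → ℝ → ℝ) : ℝ :=
  ∫ x in (0 : ℝ)..(2 * Real.pi), ∫ y in (-1 : ℝ)..1, (f x y) ^ 2

/-- Square of the `Hˢ` norm of a scalar function on the periodic strip:
`Σ_{a+b ≤ s} ‖∂_x^a ∂_y^b f‖_{L²}²`. -/
def sobSq (s : ℕ) (f : ℝ → ℝ → ℝ) : ℝ :=
  ∑ a ∈ Finset.range (s + 1), ∑ b ∈ Finset.range (s + 1 - a),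
    sqL2 (pdx^[a] (pdy^[b] f))

/-- `Hˢ` norm of a planar vector field on the periodic strip. -/
def HsNorm (s : ℕ) (u : ℝ → ℝ → ℝ × ℝ) : ℝ :=
  Real.sqrt (sobSq s (c1 u) + sobSq s (c2 u))

/-- `L^∞` norm over the strip of a scalar function. -/
def LinfS (f : ℝ → ℝ → ℝ) : ℝ :=
  ⨆ (x : ℝ) (y : Icc (-1 : ℝ) 1), |f x y|

/-- `L^∞` norm over the strip of a planar vector field (pointwise euclidean norm). -/
def LinfV (u : ℝ → ℝ → ℝ × ℝ) : ℝ :=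
  ⨆ (x : ℝ) (y : Icc (-1 : ℝ) 1), Real.sqrt ((c1 u x y) ^ 2 + (c2 u x y) ^ 2)

/-- The Couette flow `U_s(y) = (y, 0)`. -/
def Couette : ℝ → ℝ → ℝ × ℝ := fun _ y => (y, 0)

/-- The scalar vorticity `∇×u = ∂_x u₂ − ∂_y u₁`. -/
def vort (u : ℝ → ℝ → ℝ × ℝ) : ℝ → ℝ → ℝ :=
  fun x y => pdx (c2 u) x y - pdy (c1 u) x y

/-- Pointwise euclidean norm of the velocity gradient. -/
def gradPtNorm (u : ℝ → ℝ → ℝ × ℝ) : ℝ → ℝ → ℝ := fun x y =>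
  Real.sqrt ((pdx (c1 u) x y) ^ 2 + (pdx (c2 u) x y) ^ 2
    + (pdy (c1 u) x y) ^ 2 + (pdy (c2 u) x y) ^ 2)

/-- `H¹` norm of the full velocity gradient `∇u`. -/
def gradH1 (u : ℝ → ℝ → ℝ × ℝ) : ℝ :=
  Real.sqrt (sobSq 1 (pdx (c1 u)) + sobSq 1 (pdx (c2 u))
    + sobSq 1 (pdy (c1 u)) + sobSq 1 (pdy (c2 u)))

/-- A time-dependent vector field on the strip is smooth. -/
def SmoothVF (u : ℝ → ℝ → ℝ → ℝ × ℝ) : Prop :=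
  ContDiff ℝ (⊤ : ℕ∞) (fun q : ℝ × ℝ × ℝ => u q.1 q.2.1 q.2.2)

/-- A time-dependent scalar field on the strip is smooth. -/
def SmoothFn (p : ℝ → ℝ → ℝ → ℝ) : Prop :=
  ContDiff ℝ (⊤ : ℕ∞) (fun q : ℝ × ℝ × ℝ => p q.1 q.2.1 q.2.2)

/-- Periodicity in the horizontal variable. -/
def PeriodicVF (u : ℝ → ℝ → ℝ → ℝ × ℝ) : Prop :=
  ∀ t x y : ℝ, u t (x + 2 * Real.pi) y = u t x y

/-- Periodicity in the horizontal variable, scalar case. -/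
def PeriodicFn (p : ℝ → ℝ → ℝ → ℝ) : Prop :=
  ∀ t x y : ℝ, p t (x + 2 * Real.pi) y = p t x y

/-- `u, p` solve the Navier–Stokes equations
`∂_t u + (u·∇)u − νΔu + ∇p = f`, `∇·u = 0`
with viscosity `ν` and force `f` on the time interval `[0,T]` on the strip. -/
def IsNSSol (ν T : ℝ) (u : ℝ → ℝ → ℝ → ℝ × ℝ) (p : ℝ → ℝ → ℝ → ℝ)
    (f : ℝ → ℝ → ℝ → ℝ × ℝ) : Prop :=
  ∀ t ∈ Icc (0 : ℝ) T, ∀ x : ℝ, ∀ y ∈ Icc (-1 : ℝ) 1,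
    (deriv (fun t' => (u t' x y).1) t
      + c1 (u t) x y * pdx (c1 (u t)) x y + c2 (u t) x y * pdy (c1 (u t)) x y
      - ν * (pdx (pdx (c1 (u t))) x y + pdy (pdy (c1 (u t))) x y)
      + pdx (p t) x y = (f t x y).1) ∧
    (deriv (fun t' => (u t' x y).2) t
      + c1 (u t) x y * pdx (c2 (u t)) x y + c2 (u t) x y * pdy (c2 (u t)) x y
      - ν * (pdx (pdx (c2 (u t))) x y + pdy (pdy (c2 (u t))) x y)
      + pdy (p t) x y = (f t x y).2) ∧
    (pdx (c1 (u t)) x y + pdy (c2 (u t)) x y = 0)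

/-- The no-slip boundary conditions `u(t,x,−1) = (−1,0)`, `u(t,x,1) = (1,0)`. -/
def CouetteBC (T : ℝ) (u : ℝ → ℝ → ℝ → ℝ × ℝ) : Prop :=
  ∀ t ∈ Icc (0 : ℝ) T, ∀ x : ℝ, u t x (-1) = (-1, 0) ∧ u t x 1 = (1, 0)

namespace CouetteStability

/-! ### The differential algebra of smooth, horizontally periodic fields -/

/-- Smooth functions of `(t, x, y)` which are `2π`-periodic in `x`. -/
def smoothPeriodic : Subalgebra ℝ (ℝ → ℝ → ℝ → ℝ) where
  carrier := {F | SmoothFn F ∧ PeriodicFn F}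
  mul_mem' := fun hF hG => ⟨ContDiff.mul hF.1 hG.1, fun t x y => by
    simp only [Pi.mul_apply, hF.2 t x y, hG.2 t x y]⟩
  add_mem' := fun hF hG => ⟨ContDiff.add hF.1 hG.1, fun t x y => by
    simp only [Pi.add_apply, hF.2 t x y, hG.2 t x y]⟩
  algebraMap_mem' := fun _ => ⟨contDiff_const, fun _ _ _ => rfl⟩

/-- The type of smooth periodic fields. -/
abbrev Fld : Type := smoothPeriodic

/-- A field as a function on `ℝ × ℝ × ℝ`. -/
def unc (F : Fld) : ℝ × ℝ × ℝ → ℝ := fun q => F.1 q.1 q.2.1 q.2.2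

theorem unc_contDiff (F : Fld) : ContDiff ℝ (⊤ : ℕ∞) (unc F) := F.2.1

theorem unc_differentiable (F : Fld) : Differentiable ℝ (unc F) :=
  (unc_contDiff F).differentiable (by simp)

theorem periodic (F : Fld) (t x y : ℝ) : F.1 t (x + 2 * Real.pi) y = F.1 t x y := F.2.2 t x y

/-- Directional derivative of a field. -/
def dirD (e : ℝ × ℝ × ℝ) (F : Fld) : Fld :=
  ⟨fun t x y => fderiv ℝ (unc F) (t, x, y) e, by
    refine ⟨?_, ?_⟩
    · have h : ContDiff ℝ (⊤ : ℕ∞) (fderiv ℝ (unc F)) :=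
        (unc_contDiff F).fderiv_right (m := (⊤ : ℕ∞)) (by simp)
      exact h.clm_apply contDiff_const
    · intro t x y
      have h : (fun q => unc F (q + (0, 2 * Real.pi, 0))) = unc F := by
        funext q
        simp [unc, periodic F]
      have h2 := fderiv_comp_add_right (𝕜 := ℝ) (f := unc F) (x := (t, x, y)) (0, 2 * Real.pi, 0)
      rw [h] at h2
      simp only [Prod.mk_add_mk, add_zero] at h2
      beta_reduce
      rw [h2]⟩

theorem dirD_add (e : ℝ × ℝ × ℝ) (F G : Fld) : dirD e (F + G) = dirD e F + dirD e G := by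
  ext t x y
  change fderiv ℝ (fun q => unc F q + unc G q) (t, x, y) e = _
  rw [fderiv_fun_add (unc_differentiable F _) (unc_differentiable G _)]
  rfl

theorem dirD_sub (e : ℝ × ℝ × ℝ) (F G : Fld) : dirD e (F - G) = dirD e F - dirD e G := by
  ext t x y
  change fderiv ℝ (fun q => unc F q - unc G q) (t, x, y) e = _
  rw [fderiv_fun_sub (unc_differentiable F _) (unc_differentiable G _)]
  rfl

theorem dirD_neg (e : ℝ × ℝ × ℝ) (F : Fld) : dirD e (-F) = -dirD e F := by
  ext t x y
  change fderiv ℝ (fun q => -unc F q) (t, x, y) e = _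
  rw [fderiv_fun_neg]
  rfl

theorem dirD_mul (e : ℝ × ℝ × ℝ) (F G : Fld) : dirD e (F * G) = dirD e F * G + F * dirD e G := by
  ext t x y
  change fderiv ℝ (fun q => unc F q * unc G q) (t, x, y) e = _
  rw [fderiv_fun_mul (unc_differentiable F _) (unc_differentiable G _)]
  change F.1 t x y * (dirD e G).1 t x y + G.1 t x y * (dirD e F).1 t x y
    = (dirD e F).1 t x y * G.1 t x y + F.1 t x y * (dirD e G).1 t x y
  ring

theorem dirD_smul (e : ℝ × ℝ × ℝ) (c : ℝ) (F : Fld) : dirD e (c • F) = c • dirD e F := by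
  ext t x y
  change fderiv ℝ (fun q => c • unc F q) (t, x, y) e = _
  rw [fderiv_fun_const_smul (unc_differentiable F _)]
  rfl

theorem dirD_const (e : ℝ × ℝ × ℝ) (c : ℝ) : dirD e (algebraMap ℝ Fld c) = 0 := by
  ext t x y
  change fderiv ℝ (fun _ => c) (t, x, y) e = _
  simp

theorem dirD_one (e : ℝ × ℝ × ℝ) : dirD e (1 : Fld) = 0 := by
  simpa using dirD_const e 1

theorem dirD_zero (e : ℝ × ℝ × ℝ) : dirD e (0 : Fld) = 0 := by
  simpa using dirD_const e 0

theorem dirD_comm (e e' : ℝ × ℝ × ℝ) (F : Fld) : dirD e (dirD e' F) = dirD e' (dirD e F) := by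
  ext t x y
  have h : ContDiff ℝ (⊤ : ℕ∞) (fderiv ℝ (unc F)) :=
    (unc_contDiff F).fderiv_right (m := (⊤ : ℕ∞)) (by simp)
  have hd : DifferentiableAt ℝ (fderiv ℝ (unc F)) (t, x, y) := (h.differentiable (by simp)) _
  have hs : IsSymmSndFDerivAt ℝ (unc F) (t, x, y) :=
    (unc_contDiff F).contDiffAt.isSymmSndFDerivAt (by
      simp only [minSmoothness_of_isRCLikeNormedField]
      exact WithTop.coe_le_coe.2 (le_top : (2 : ℕ∞) ≤ ⊤))
  have key : ∀ a b : ℝ × ℝ × ℝ, (dirD a (dirD b F)).1 t x y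
      = fderiv ℝ (fderiv ℝ (unc F)) (t, x, y) a b := by
    intro a b
    change fderiv ℝ (fun q => fderiv ℝ (unc F) q b) (t, x, y) a = _
    rw [fderiv_clm_apply hd (differentiableAt_const b)]
    simp
  rw [key, key]
  exact hs.eq e e'

/-- Time derivative. -/
def dT : Fld → Fld := dirD (1, 0, 0)

/-- Horizontal derivative. -/
def dX : Fld → Fld := dirD (0, 1, 0)

/-- Vertical derivative. -/
def dY : Fld → Fld := dirD (0, 0, 1)

@[simp] theorem dT_add (F G : Fld) : dT (F + G) = dT F + dT G := dirD_add _ F G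
@[simp] theorem dX_add (F G : Fld) : dX (F + G) = dX F + dX G := dirD_add _ F G
@[simp] theorem dY_add (F G : Fld) : dY (F + G) = dY F + dY G := dirD_add _ F G
@[simp] theorem dT_sub (F G : Fld) : dT (F - G) = dT F - dT G := dirD_sub _ F G
@[simp] theorem dX_sub (F G : Fld) : dX (F - G) = dX F - dX G := dirD_sub _ F G
@[simp] theorem dY_sub (F G : Fld) : dY (F - G) = dY F - dY G := dirD_sub _ F G
@[simp] theorem dT_neg (F : Fld) : dT (-F) = -dT F := dirD_neg _ F
@[simp] theorem dX_neg (F : Fld) : dX (-F) = -dX F := dirD_neg _ F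
@[simp] theorem dY_neg (F : Fld) : dY (-F) = -dY F := dirD_neg _ F
@[simp] theorem dT_mul (F G : Fld) : dT (F * G) = dT F * G + F * dT G := dirD_mul _ F G
@[simp] theorem dX_mul (F G : Fld) : dX (F * G) = dX F * G + F * dX G := dirD_mul _ F G
@[simp] theorem dY_mul (F G : Fld) : dY (F * G) = dY F * G + F * dY G := dirD_mul _ F G
@[simp] theorem dT_smul (c : ℝ) (F : Fld) : dT (c • F) = c • dT F := dirD_smul _ c F
@[simp] theorem dX_smul (c : ℝ) (F : Fld) : dX (c • F) = c • dX F := dirD_smul _ c F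
@[simp] theorem dY_smul (c : ℝ) (F : Fld) : dY (c • F) = c • dY F := dirD_smul _ c F
@[simp] theorem dT_one : dT (1 : Fld) = 0 := dirD_one _
@[simp] theorem dX_one : dX (1 : Fld) = 0 := dirD_one _
@[simp] theorem dY_one : dY (1 : Fld) = 0 := dirD_one _
@[simp] theorem dT_zero : dT (0 : Fld) = 0 := dirD_zero _
@[simp] theorem dX_zero : dX (0 : Fld) = 0 := dirD_zero _
@[simp] theorem dY_zero : dY (0 : Fld) = 0 := dirD_zero _
@[simp] theorem dX_dT (F : Fld) : dX (dT F) = dT (dX F) := dirD_comm _ _ F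
@[simp] theorem dY_dT (F : Fld) : dY (dT F) = dT (dY F) := dirD_comm _ _ F
@[simp] theorem dY_dX (F : Fld) : dY (dX F) = dX (dY F) := dirD_comm _ _ F

theorem hasDerivAt_t (F : Fld) (t x y : ℝ) :
    HasDerivAt (fun t' => F.1 t' x y) ((dT F).1 t x y) t := by
  have h1 : HasDerivAt (fun t' : ℝ => ((t', x, y) : ℝ × ℝ × ℝ)) (1, 0, 0) t :=
    (hasDerivAt_id t).prodMk (hasDerivAt_const t _)
  exact ((unc_differentiable F (t, x, y)).hasFDerivAt).comp_hasDerivAt t h1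

theorem hasDerivAt_x (F : Fld) (t x y : ℝ) :
    HasDerivAt (fun x' => F.1 t x' y) ((dX F).1 t x y) x := by
  have h1 : HasDerivAt (fun x' : ℝ => ((t, x', y) : ℝ × ℝ × ℝ)) (0, 1, 0) x :=
    (hasDerivAt_const x _).prodMk ((hasDerivAt_id x).prodMk (hasDerivAt_const x _))
  exact ((unc_differentiable F (t, x, y)).hasFDerivAt).comp_hasDerivAt x h1

theorem hasDerivAt_y (F : Fld) (t x y : ℝ) :
    HasDerivAt (fun y' => F.1 t x y') ((dY F).1 t x y) y := by
  have h1 : HasDerivAt (fun y' : ℝ => ((t, x, y') : ℝ × ℝ × ℝ)) (0, 0, 1) y :=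
    (hasDerivAt_const y _).prodMk ((hasDerivAt_const y _).prodMk (hasDerivAt_id y))
  exact ((unc_differentiable F (t, x, y)).hasFDerivAt).comp_hasDerivAt y h1

theorem continuous_unc (F : Fld) : Continuous (unc F) := (unc_contDiff F).continuous

theorem Fld.cont {X : Type*} [TopologicalSpace X] (F : Fld) {a b c : X → ℝ}
    (ha : Continuous a) (hb : Continuous b) (hc : Continuous c) :
    Continuous fun z => F.1 (a z) (b z) (c z) :=
  (continuous_unc F).comp (ha.prodMk (hb.prodMk hc))

/-- The vertical coordinate as a field. -/
def yF : Fld := ⟨fun _ _ y => y, by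
  refine ⟨?_, fun _ _ _ => rfl⟩
  exact (contDiff_snd.comp contDiff_snd : ContDiff ℝ (⊤ : ℕ∞) fun q : ℝ × ℝ × ℝ => q.2.2)⟩

/-- The time coordinate as a field. -/
def tF : Fld := ⟨fun t _ _ => t, by
  refine ⟨?_, fun _ _ _ => rfl⟩
  exact (contDiff_fst : ContDiff ℝ (⊤ : ℕ∞) fun q : ℝ × ℝ × ℝ => q.1)⟩

@[simp] theorem dT_yF : dT yF = 0 := by
  ext t x y
  exact (hasDerivAt_t yF t x y).unique (hasDerivAt_const t y)

@[simp] theorem dX_yF : dX yF = 0 := by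
  ext t x y
  exact (hasDerivAt_x yF t x y).unique (hasDerivAt_const x y)

@[simp] theorem dY_yF : dY yF = 1 := by
  ext t x y
  exact (hasDerivAt_y yF t x y).unique (hasDerivAt_id y)

@[simp] theorem dT_tF : dT tF = 1 := by
  ext t x y
  exact (hasDerivAt_t tF t x y).unique (hasDerivAt_id t)

@[simp] theorem dX_tF : dX tF = 0 := by
  ext t x y
  exact (hasDerivAt_x tF t x y).unique (hasDerivAt_const x t)

@[simp] theorem dY_tF : dY tF = 0 := by
  ext t x y
  exact (hasDerivAt_y tF t x y).unique (hasDerivAt_const y t)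

@[simp] theorem add_app (F G : Fld) (t x y : ℝ) : (F + G).1 t x y = F.1 t x y + G.1 t x y := rfl
@[simp] theorem sub_app (F G : Fld) (t x y : ℝ) : (F - G).1 t x y = F.1 t x y - G.1 t x y := rfl
@[simp] theorem neg_app (F : Fld) (t x y : ℝ) : (-F).1 t x y = -F.1 t x y := rfl
@[simp] theorem mul_app (F G : Fld) (t x y : ℝ) : (F * G).1 t x y = F.1 t x y * G.1 t x y := rfl
@[simp] theorem smul_app (c : ℝ) (F : Fld) (t x y : ℝ) : (c • F).1 t x y = c * F.1 t x y := rfl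
@[simp] theorem one_app (t x y : ℝ) : (1 : Fld).1 t x y = 1 := rfl
@[simp] theorem zero_app (t x y : ℝ) : (0 : Fld).1 t x y = 0 := rfl
@[simp] theorem yF_app (t x y : ℝ) : yF.1 t x y = y := rfl
@[simp] theorem tF_app (t x y : ℝ) : tF.1 t x y = t := rfl

/-! ### Integration over the strip -/

theorem hasDerivAt_intervalIntegral_of_continuous {G G' : ℝ → ℝ → ℝ} {a b t : ℝ}
    (hG : Continuous (Function.uncurry G)) (hG' : Continuous (Function.uncurry G'))
    (hd : ∀ s z, HasDerivAt (fun s' => G s' z) (G' s z) s) :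
    HasDerivAt (fun s => ∫ z in a..b, G s z) (∫ z in a..b, G' t z) t := by
  obtain ⟨C, hC⟩ := ((isCompact_Icc (a := t - 1) (b := t + 1)).prod
    (isCompact_uIcc (a := a) (b := b))).exists_bound_of_continuousOn hG'.continuousOn
  refine (intervalIntegral.hasDerivAt_integral_of_dominated_loc_of_deriv_le
    (F := G) (F' := G') (bound := fun _ => C) (s := Icc (t - 1) (t + 1))
    (Icc_mem_nhds (by linarith) (by linarith)) ?_ ?_ ?_ ?_ ?_ ?_).2
  · exact Eventually.of_forall fun s =>
      (hG.comp (Continuous.prodMk_right s)).aestronglyMeasurable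
  · exact (hG.comp (Continuous.prodMk_right t)).intervalIntegrable _ _
  · exact (hG'.comp (Continuous.prodMk_right t)).aestronglyMeasurable
  · exact Eventually.of_forall fun z hz s hs => hC (s, z) ⟨hs, uIoc_subset_uIcc hz⟩
  · exact intervalIntegrable_const
  · exact Eventually.of_forall fun z _ s _ => hd s z

theorem intervalIntegral_swap_of_continuous {G : ℝ → ℝ → ℝ} (a b c d : ℝ)
    (hG : Continuous (Function.uncurry G)) :
    ∫ x in a..b, ∫ y in c..d, G x y = ∫ y in c..d, ∫ x in a..b, G x y := by
  apply intervalIntegral_intervalIntegral_swap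
  have : IntegrableOn (Function.uncurry G) (uIcc a b ×ˢ uIcc c d) :=
    hG.continuousOn.integrableOn_compact (isCompact_uIcc.prod isCompact_uIcc)
  exact this.mono_set (prod_mono uIoc_subset_uIcc uIoc_subset_uIcc)

/-- Integral of a field at time `t` over the fundamental domain of the strip. -/
def I (F : Fld) (t : ℝ) : ℝ := ∫ x in (0 : ℝ)..(2 * Real.pi), ∫ y in (-1 : ℝ)..1, F.1 t x y

theorem cont_y (F : Fld) (t x : ℝ) : Continuous fun y => F.1 t x y :=
  F.cont continuous_const continuous_const continuous_id

theorem cont_x (F : Fld) (t y : ℝ) : Continuous fun x => F.1 t x y :=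
  F.cont continuous_const continuous_id continuous_const

theorem cont_xy (F : Fld) (t : ℝ) : Continuous (Function.uncurry fun x y => F.1 t x y) :=
  F.cont continuous_const continuous_fst continuous_snd

theorem int_y (F : Fld) (t x a b : ℝ) : IntervalIntegrable (fun y => F.1 t x y) volume a b :=
  (cont_y F t x).intervalIntegrable _ _

theorem cont_inner (F : Fld) (t : ℝ) : Continuous fun x => ∫ y in (-1 : ℝ)..1, F.1 t x y :=
  continuous_parametric_intervalIntegral_of_continuous' (cont_xy F t) _ _

theorem int_inner (F : Fld) (t a b : ℝ) :
    IntervalIntegrable (fun x => ∫ y in (-1 : ℝ)..1, F.1 t x y) volume a b :=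
  (cont_inner F t).intervalIntegrable _ _

theorem I_add (F G : Fld) (t : ℝ) : I (F + G) t = I F t + I G t := by
  unfold I
  rw [← integral_add (int_inner F t _ _) (int_inner G t _ _)]
  congr 1; funext x
  rw [← integral_add (int_y F t x _ _) (int_y G t x _ _)]
  rfl

theorem I_smul (c : ℝ) (F : Fld) (t : ℝ) : I (c • F) t = c * I F t := by
  unfold I
  rw [← intervalIntegral.integral_const_mul]
  congr 1; funext x
  rw [← intervalIntegral.integral_const_mul]
  rfl

theorem I_neg (F : Fld) (t : ℝ) : I (-F) t = -I F t := by
  have := I_smul (-1) F t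
  simpa using this

theorem I_sub (F G : Fld) (t : ℝ) : I (F - G) t = I F t - I G t := by
  rw [sub_eq_add_neg, I_add, I_neg]; ring

theorem I_mono {F G : Fld} {t : ℝ}
    (h : ∀ x, ∀ y ∈ Icc (-1 : ℝ) 1, F.1 t x y ≤ G.1 t x y) : I F t ≤ I G t := by
  unfold I
  refine integral_mono_on (by positivity) (int_inner F t _ _) (int_inner G t _ _) fun x _ => ?_
  exact integral_mono_on (by norm_num) (int_y F t x _ _) (int_y G t x _ _) fun y hy => h x y hy

theorem I_congr {F G : Fld} {t : ℝ}
    (h : ∀ x, ∀ y ∈ Icc (-1 : ℝ) 1, F.1 t x y = G.1 t x y) : I F t = I G t :=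
  le_antisymm (I_mono fun x y hy => (h x y hy).le) (I_mono fun x y hy => (h x y hy).ge)

theorem I_zero (t : ℝ) : I 0 t = 0 := by simp [I]

theorem I_one (t : ℝ) : I 1 t = 4 * Real.pi := by
  simp [I]; ring

theorem I_nonneg {F : Fld} {t : ℝ} (h : ∀ x, ∀ y ∈ Icc (-1 : ℝ) 1, 0 ≤ F.1 t x y) :
    0 ≤ I F t := by
  rw [← I_zero t]
  exact I_mono h

theorem I_sq_nonneg (F : Fld) (t : ℝ) : 0 ≤ I (F * F) t :=
  I_nonneg fun x y _ => mul_self_nonneg (F.1 t x y)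

theorem I_swap (F : Fld) (t : ℝ) :
    I F t = ∫ y in (-1 : ℝ)..1, ∫ x in (0 : ℝ)..(2 * Real.pi), F.1 t x y :=
  intervalIntegral_swap_of_continuous _ _ _ _ (cont_xy F t)

theorem I_dX (F : Fld) (t : ℝ) : I (dX F) t = 0 := by
  rw [I_swap]
  have h : ∀ y, ∫ x in (0 : ℝ)..(2 * Real.pi), (dX F).1 t x y = 0 := by
    intro y
    rw [integral_eq_sub_of_hasDerivAt (fun x _ => hasDerivAt_x F t x y)
      ((cont_x (dX F) t y).intervalIntegrable _ _)]
    have := periodic F t 0 y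
    rw [zero_add] at this
    rw [this, sub_self]
  simp [h]

theorem integral_dY (F : Fld) (t x a b : ℝ) :
    ∫ y in a..b, (dY F).1 t x y = F.1 t x b - F.1 t x a :=
  integral_eq_sub_of_hasDerivAt (fun y _ => hasDerivAt_y F t x y) (int_y (dY F) t x _ _)

theorem I_dY {F : Fld} {t : ℝ} (h : ∀ x, F.1 t x (-1) = 0 ∧ F.1 t x 1 = 0) : I (dY F) t = 0 := by
  simp [I, integral_dY, h]

theorem hasDerivAt_I (F : Fld) (t : ℝ) : HasDerivAt (I F) (I (dT F) t) t := by
  have c3 : ∀ F : Fld, Continuous (Function.uncurry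
      fun (s x : ℝ) => ∫ y in (-1 : ℝ)..1, F.1 s x y) := by
    intro F
    refine continuous_parametric_intervalIntegral_of_continuous'
      (f := fun (q : ℝ × ℝ) y => F.1 q.1 q.2 y) ?_ _ _
    exact F.cont (continuous_fst.comp continuous_fst) (continuous_snd.comp continuous_fst)
      continuous_snd
  refine hasDerivAt_intervalIntegral_of_continuous (c3 F) (c3 (dT F)) fun s x => ?_
  exact hasDerivAt_intervalIntegral_of_continuous (G := fun s' y => F.1 s' x y)
    (G' := fun s' y => (dT F).1 s' x y)
    (F.cont continuous_fst continuous_const continuous_snd)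
    ((dT F).cont continuous_fst continuous_const continuous_snd)
    fun s' y => hasDerivAt_t F s' x y

/-! ### Functional inequalities on the strip -/

theorem abs_integral_le_add_of_sq {h : ℝ → ℝ} {a b : ℝ} (hab : a ≤ b) (hh : Continuous h) (δ : ℝ) :
    2 * δ * ∫ z in a..b, |h z| ≤ (∫ z in a..b, h z * h z) + δ ^ 2 * (b - a) := by
  have h1 : ∫ z in a..b, (2 * δ) * |h z| ≤ ∫ z in a..b, (h z * h z + δ ^ 2) := by
    refine integral_mono_on hab ?_ ?_ fun z _ => ?_
    · exact (continuous_const.mul hh.abs).intervalIntegrable _ _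
    · exact ((hh.mul hh).add continuous_const).intervalIntegrable _ _
    · nlinarith [sq_nonneg (|h z| - δ), abs_mul_abs_self (h z)]
  have hi : IntervalIntegrable (fun z => h z * h z) volume a b :=
    (hh.mul hh).intervalIntegrable _ _
  rw [intervalIntegral.integral_const_mul, integral_add hi intervalIntegrable_const, intervalIntegral.integral_const, smul_eq_mul] at h1
  linarith

/-- Cauchy–Schwarz on `[-1, 1]`. -/
theorem integral_abs_sq_le {h : ℝ → ℝ} (hh : Continuous h) :
    (∫ z in (-1 : ℝ)..1, |h z|) ^ 2 ≤ 2 * ∫ z in (-1 : ℝ)..1, h z * h z := by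
  set A := ∫ z in (-1 : ℝ)..1, |h z|
  have := abs_integral_le_add_of_sq (a := -1) (b := 1) (by norm_num) hh (A / 2)
  nlinarith

theorem abs_integral_sub_le {h : ℝ → ℝ} (hh : Continuous h) {a b c d : ℝ} (hc : c ∈ Icc a b)
    (hd : d ∈ Icc a b) : |∫ z in c..d, h z| ≤ ∫ z in a..b, |h z| := by
  have hInt : ∀ p q : ℝ, IntervalIntegrable (fun z => |h z|) volume p q :=
    fun p q => hh.abs.intervalIntegrable _ _
  have key : ∀ c d : ℝ, a ≤ c → c ≤ d → d ≤ b → |∫ z in c..d, h z| ≤ ∫ z in a..b, |h z| := by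
    intro c d h1 h2 h3
    refine (abs_integral_le_integral_abs h2).trans ?_
    exact integral_mono_interval h1 h2 h3 (Eventually.of_forall fun z => abs_nonneg _) (hInt _ _)
  rcases le_total c d with h | h
  · exact key c d hc.1 h hd.2
  · rw [integral_symm, abs_neg]
    exact key d c hd.1 h hc.2

/-- One-dimensional Sobolev inequality. -/
theorem sq_le_of_hasDerivAt {h h' : ℝ → ℝ} {a b c : ℝ} (hab : 2 ≤ b - a) (hc : c ∈ Icc a b)
    (hd : ∀ z, HasDerivAt h (h' z) z) (hh' : Continuous h') :
    h c ^ 2 ≤ 2 * ∫ z in a..b, (h z * h z + h' z * h' z) := by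
  have hh : Continuous h := continuous_iff_continuousAt.2 fun z => (hd z).continuousAt
  have hle : a ≤ b := by linarith
  have hi1 : Continuous fun z => h z * h z := hh.mul hh
  have hi2 : Continuous fun z => h' z * h' z := hh'.mul hh'
  set K := ∫ z in a..b, (h z * h z + h' z * h' z) with hK
  have hK' : K = (∫ z in a..b, h z * h z) + ∫ z in a..b, h' z * h' z :=
    integral_add (hi1.intervalIntegrable _ _) (hi2.intervalIntegrable _ _)
  have hn2 : 0 ≤ ∫ z in a..b, h' z * h' z :=
    integral_nonneg hle fun z _ => mul_self_nonneg _
  have hn1 : 0 ≤ ∫ z in a..b, h z * h z :=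
    integral_nonneg hle fun z _ => mul_self_nonneg _
  have hpt : ∀ z ∈ Icc a b, h c ^ 2 ≤ h z * h z + K := by
    intro z hz
    have e1 : ∫ r in z..c, 2 * (h r * h' r) = h c ^ 2 - h z ^ 2 := by
      refine integral_eq_sub_of_hasDerivAt (f := fun r => h r ^ 2) (fun r _ => ?_)
        ((continuous_const.mul (hh.mul hh')).intervalIntegrable _ _)
      have := (hd r).pow 2
      refine this.congr_deriv ?_
      simp; ring
    have e2 := abs_integral_sub_le (h := fun r => 2 * (h r * h' r)) (by fun_prop) hz hc
    have e3 : ∫ r in a..b, |2 * (h r * h' r)| ≤ K := by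
      refine integral_mono_on hle ?_ ?_ fun r _ => ?_
      · exact (Continuous.abs (by fun_prop)).intervalIntegrable _ _
      · exact (hi1.add hi2).intervalIntegrable _ _
      · rw [abs_le]
        constructor <;> nlinarith [sq_nonneg (h r + h' r), sq_nonneg (h r - h' r)]
    rw [e1] at e2
    have := (abs_le.1 (e2.trans e3)).2
    nlinarith
  have hm : ∫ _z in a..b, h c ^ 2 ≤ ∫ z in a..b, (h z * h z + K) := by
    refine integral_mono_on hle intervalIntegrable_const ?_ hpt
    exact (hi1.add continuous_const).intervalIntegrable _ _
  rw [integral_add (hi1.intervalIntegrable _ _) intervalIntegrable_const,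
    intervalIntegral.integral_const, intervalIntegral.integral_const, smul_eq_mul,
    smul_eq_mul] at hm
  nlinarith

theorem two_le_two_pi : (2 : ℝ) ≤ 2 * Real.pi - 0 := by
  linarith [Real.pi_gt_three]

/-- Pointwise bound in `x` by the horizontal `H¹` norm. -/
theorem sq_le_integral_x (F : Fld) (t x y : ℝ) :
    F.1 t x y ^ 2 ≤
      2 * ∫ z in (0 : ℝ)..(2 * Real.pi), (F * F + dX F * dX F).1 t z y := by
  have hper : Function.Periodic (fun z => F.1 t z y) (2 * Real.pi) := fun z => periodic F t z y
  obtain ⟨x', hx', he⟩ := hper.exists_mem_Ico₀ (by positivity) x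
  rw [show F.1 t x y = F.1 t x' y from he]
  exact sq_le_of_hasDerivAt two_le_two_pi ⟨hx'.1, hx'.2.le⟩ (fun z => hasDerivAt_x F t z y)
    (cont_x (dX F) t y)

theorem integral_sq_y_le (F : Fld) (t x : ℝ) :
    ∫ y in (-1 : ℝ)..1, (F * F).1 t x y ≤ 2 * (I (F * F) t + I (dX F * dX F) t) := by
  rw [← I_add, I_swap, ← intervalIntegral.integral_const_mul]
  refine integral_mono_on (by norm_num) (int_y _ t x _ _) ?_ fun y _ => ?_
  · refine Continuous.intervalIntegrable (continuous_const.mul ?_) _ _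
    exact continuous_parametric_intervalIntegral_of_continuous'
      (f := fun y x => (F * F + dX F * dX F).1 t x y)
      ((F * F + dX F * dX F).cont continuous_const continuous_snd continuous_fst) _ _
  · have := sq_le_integral_x F t x y
    rw [sq] at this
    exact this

theorem integral_abs_y_le {F : Fld} {t c : ℝ} (hc : 0 ≤ c) (h1 : I (F * F) t ≤ c ^ 2)
    (h2 : I (dX F * dX F) t ≤ c ^ 2) (x : ℝ) : ∫ y in (-1 : ℝ)..1, |F.1 t x y| ≤ 3 * c := by
  have h3 := integral_sq_y_le F t x
  have h4 := integral_abs_sq_le (cont_y F t x)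
  have h5 : (∫ y in (-1 : ℝ)..1, |F.1 t x y|) ^ 2 ≤ (3 * c) ^ 2 := by
    have : ∫ y in (-1 : ℝ)..1, (F * F).1 t x y = ∫ y in (-1 : ℝ)..1, F.1 t x y * F.1 t x y := rfl
    nlinarith
  exact abs_le_of_sq_le_sq' h5 (by positivity) |>.2

theorem sq_le_integral_dY {F : Fld} {t x y : ℝ} (h0 : F.1 t x (-1) = 0) (hy : y ∈ Icc (-1 : ℝ) 1) :
    F.1 t x y ^ 2 ≤ 2 * ∫ z in (-1 : ℝ)..1, (dY F * dY F).1 t x z := by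
  have h1 := integral_dY F t x (-1) y
  rw [h0, sub_zero] at h1
  have h2 := abs_integral_sub_le (cont_y (dY F) t x) (a := -1) (b := 1) (c := -1) (d := y)
    (by norm_num) hy
  rw [h1] at h2
  have h3 := integral_abs_sq_le (cont_y (dY F) t x)
  have h4 : |F.1 t x y| ^ 2 ≤ (∫ z in (-1 : ℝ)..1, |(dY F).1 t x z|) ^ 2 :=
    pow_le_pow_left₀ (abs_nonneg _) h2 2
  rw [sq_abs] at h4
  exact h4.trans h3

theorem abs_le_of_dY {F : Fld} {t c x y : ℝ} (hc : 0 ≤ c) (h0 : F.1 t x (-1) = 0)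
    (h1 : I (dY F * dY F) t ≤ c ^ 2) (h2 : I (dX (dY F) * dX (dY F)) t ≤ c ^ 2)
    (hy : y ∈ Icc (-1 : ℝ) 1) : |F.1 t x y| ≤ 3 * c := by
  have h3 := integral_dY F t x (-1) y
  rw [h0, sub_zero] at h3
  rw [← h3]
  exact (abs_integral_sub_le (cont_y (dY F) t x) (by norm_num) hy).trans
    (integral_abs_y_le hc h1 h2 x)

/-- Two-dimensional Sobolev inequality. -/
theorem abs_le_of_sobolev {F : Fld} {t c x y : ℝ} (hc : 0 ≤ c) (h1 : I (F * F) t ≤ c ^ 2)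
    (h2 : I (dX F * dX F) t ≤ c ^ 2) (h3 : I (dY F * dY F) t ≤ c ^ 2)
    (h4 : I (dX (dY F) * dX (dY F)) t ≤ c ^ 2) (hy : y ∈ Icc (-1 : ℝ) 1) :
    |F.1 t x y| ≤ 4 * c := by
  have h5 := sq_le_of_hasDerivAt (a := -1) (b := 1) (by norm_num) hy
    (fun z => hasDerivAt_y F t x z) (cont_y (dY F) t x)
  have h9 : ∫ z in (-1 : ℝ)..1, (F.1 t x z * F.1 t x z + (dY F).1 t x z * (dY F).1 t x z)
      = (∫ z in (-1 : ℝ)..1, (F * F).1 t x z) + ∫ z in (-1 : ℝ)..1, (dY F * dY F).1 t x z :=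
    integral_add (int_y (F * F) t x _ _) (int_y (dY F * dY F) t x _ _)
  rw [h9] at h5
  have h6 := integral_sq_y_le F t x
  have h7 := integral_sq_y_le (dY F) t x
  have h8 : F.1 t x y ^ 2 ≤ (4 * c) ^ 2 := by
    nlinarith
  exact abs_le_of_sq_le_sq h8 (by positivity)

/-- Anisotropic product estimate. -/
theorem I_mul_sq_le {A B : Fld} {t : ℝ} (hB : ∀ x, B.1 t x (-1) = 0) :
    I ((A * B) * (A * B)) t ≤ 4 * (I (A * A) t + I (dX A * dX A) t) * I (dY B * dY B) t := by
  set m : ℝ → ℝ := fun y => ∫ z in (0 : ℝ)..(2 * Real.pi), (A * A + dX A * dX A).1 t z y with hm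
  set k : ℝ → ℝ := fun x => ∫ z in (-1 : ℝ)..1, (dY B * dY B).1 t x z with hk
  have hmc : Continuous m := continuous_parametric_intervalIntegral_of_continuous'
      (f := fun y x => (A * A + dX A * dX A).1 t x y)
      ((A * A + dX A * dX A).cont continuous_const continuous_snd continuous_fst) _ _
  have hkc : Continuous k := cont_inner (dY B * dY B) t
  have hI : I (A * A) t + I (dX A * dX A) t = ∫ y in (-1 : ℝ)..1, m y := by
    rw [← I_add, I_swap]
  have hJ : I (dY B * dY B) t = ∫ x in (0 : ℝ)..(2 * Real.pi), k x := rfl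
  have h1 : I ((A * B) * (A * B)) t ≤
      ∫ x in (0 : ℝ)..(2 * Real.pi), ∫ y in (-1 : ℝ)..1, (4 * k x) * m y := by
    refine integral_mono_on (by positivity) (int_inner _ t _ _) ?_ fun x _ => ?_
    · simp_rw [intervalIntegral.integral_const_mul]
      exact ((continuous_const.mul hkc).mul continuous_const).intervalIntegrable _ _
    · refine integral_mono_on (by norm_num) (int_y _ t x _ _)
        ((continuous_const.mul hmc).intervalIntegrable _ _) fun y hy => ?_
      have a1 := sq_le_integral_x A t x y
      have a2 := sq_le_integral_dY (hB x) hy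
      have a3 := mul_le_mul a1 a2 (sq_nonneg _) ((sq_nonneg _).trans a1)
      simp only [mul_app]
      calc A.1 t x y * B.1 t x y * (A.1 t x y * B.1 t x y)
          = A.1 t x y ^ 2 * B.1 t x y ^ 2 := by ring
        _ ≤ 2 * m y * (2 * k x) := a3
        _ = 4 * k x * m y := by ring
  refine h1.trans (le_of_eq ?_)
  simp_rw [intervalIntegral.integral_const_mul, intervalIntegral.integral_mul_const,
    intervalIntegral.integral_const_mul]
  rw [hI, hJ]
  ring

/-! ### Identities on the space-time strip -/

/-- `F` vanishes on `[0,T] × ℝ × [-1,1]`. -/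
def ZeroOn (T : ℝ) (F : Fld) : Prop :=
  ∀ t ∈ Icc (0 : ℝ) T, ∀ x : ℝ, ∀ y ∈ Icc (-1 : ℝ) 1, F.1 t x y = 0

/-- `F` vanishes on the walls for times in `[0,T]`. -/
def BdryZero (T : ℝ) (F : Fld) : Prop :=
  ∀ t ∈ Icc (0 : ℝ) T, ∀ x : ℝ, F.1 t x (-1) = 0 ∧ F.1 t x 1 = 0

theorem deriv_eq_zero_on_Icc {h h' : ℝ → ℝ} {a b : ℝ} (hab : a < b)
    (hd : ∀ z, HasDerivAt h (h' z) z) (hc : Continuous h') (h0 : ∀ z ∈ Icc a b, h z = 0) :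
    ∀ z ∈ Icc a b, h' z = 0 := by
  have h1 : EqOn h' (fun _ => 0) (Ioo a b) := by
    intro z hz
    have h2 : h =ᶠ[𝓝 z] fun _ => 0 := by
      filter_upwards [Ioo_mem_nhds hz.1 hz.2] with r hr using h0 r ⟨hr.1.le, hr.2.le⟩
    exact ((hd z).congr_of_eventuallyEq h2.symm).unique (hasDerivAt_const z (0 : ℝ))
  have h3 := h1.closure hc continuous_const
  rw [closure_Ioo hab.ne] at h3
  exact h3

protected theorem ZeroOn.dX {T : ℝ} {F : Fld} (h : ZeroOn T F) : ZeroOn T (dX F) := by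
  intro t ht x y hy
  have h1 : (fun x' => F.1 t x' y) = fun _ => 0 := funext fun x' => h t ht x' y hy
  have h2 := hasDerivAt_x F t x y
  rw [h1] at h2
  exact h2.unique (hasDerivAt_const x (0 : ℝ))

protected theorem ZeroOn.dT {T : ℝ} (hT : 0 < T) {F : Fld} (h : ZeroOn T F) : ZeroOn T (dT F) := by
  intro t ht x y hy
  exact deriv_eq_zero_on_Icc hT (fun s => hasDerivAt_t F s x y)
    ((dT F).cont continuous_id continuous_const continuous_const)
    (fun s hs => h s hs x y hy) t ht

protected theorem ZeroOn.dY {T : ℝ} {F : Fld} (h : ZeroOn T F) : ZeroOn T (dY F) := by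
  intro t ht x y hy
  exact deriv_eq_zero_on_Icc (by norm_num) (fun s => hasDerivAt_y F t x s)
    (cont_y (dY F) t x) (fun s hs => h t ht x s hs) y hy

protected theorem BdryZero.dX {T : ℝ} {F : Fld} (h : BdryZero T F) : BdryZero T (dX F) := by
  intro t ht x
  have key : ∀ y, (∀ x', F.1 t x' y = 0) → (dX F).1 t x y = 0 := by
    intro y hy
    have h2 := hasDerivAt_x F t x y
    rw [show (fun x' => F.1 t x' y) = fun _ => 0 from funext hy] at h2
    exact h2.unique (hasDerivAt_const x (0 : ℝ))
  exact ⟨key _ fun x' => (h t ht x').1, key _ fun x' => (h t ht x').2⟩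

protected theorem BdryZero.dT {T : ℝ} (hT : 0 < T) {F : Fld} (h : BdryZero T F) : BdryZero T (dT F) := by
  intro t ht x
  have key : ∀ y, (∀ s ∈ Icc (0 : ℝ) T, F.1 s x y = 0) →
      (dT F).1 t x y = 0 := fun y hy =>
    deriv_eq_zero_on_Icc hT (fun s => hasDerivAt_t F s x y)
      ((dT F).cont continuous_id continuous_const continuous_const) hy t ht
  exact ⟨key _ fun s hs => (h s hs x).1, key _ fun s hs => (h s hs x).2⟩

/-! ### Vector fields -/

/-- Smooth periodic planar vector fields. -/
abbrev VF : Type := Fld × Fld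

/-- Horizontal derivative of a vector field. -/
def vX (V : VF) : VF := (dX V.1, dX V.2)

/-- Time derivative of a vector field. -/
def vT (V : VF) : VF := (dT V.1, dT V.2)

/-- The advection term `(a · ∇) b`. -/
def adv (a b : VF) : VF := (a.1 * dX b.1 + a.2 * dY b.1, a.1 * dX b.2 + a.2 * dY b.2)

/-- Pointwise scalar product. -/
def dot (a b : VF) : Fld := a.1 * b.1 + a.2 * b.2

/-- Pointwise squared norm of the gradient. -/
def dis (V : VF) : Fld := dX V.1 * dX V.1 + dY V.1 * dY V.1 + dX V.2 * dX V.2 + dY V.2 * dY V.2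

@[simp] theorem vX_fst (V : VF) : (vX V).1 = dX V.1 := rfl
@[simp] theorem vX_snd (V : VF) : (vX V).2 = dX V.2 := rfl
@[simp] theorem vT_fst (V : VF) : (vT V).1 = dT V.1 := rfl
@[simp] theorem vT_snd (V : VF) : (vT V).2 = dT V.2 := rfl

theorem vX_sub (V W : VF) : vX (V - W) = vX V - vX W := by
  ext : 1 <;> simp

theorem vT_sub (V W : VF) : vT (V - W) = vT V - vT W := by
  ext : 1 <;> simp

theorem vX_adv (a b : VF) : vX (adv a b) = adv (vX a) b + adv a (vX b) := by
  ext : 1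
  · simp [adv]; ring
  · simp [adv]; ring

theorem vT_adv (a b : VF) : vT (adv a b) = adv (vT a) b + adv a (vT b) := by
  ext : 1
  · simp [adv]; ring
  · simp [adv]; ring

theorem vX_vT (V : VF) : vX (vT V) = vT (vX V) := by
  ext : 1 <;> simp

theorem dot_sub (a b c : VF) : dot (a - b) c = dot a c - dot b c := by
  simp [dot]; ring

theorem dot_add (a b c : VF) : dot (a + b) c = dot a c + dot b c := by
  simp [dot]; ring

theorem I_dot_self_nonneg (V : VF) (t : ℝ) : 0 ≤ I (dot V V) t := by
  rw [dot, I_add]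
  exact add_nonneg (I_sq_nonneg _ _) (I_sq_nonneg _ _)

theorem I_dis_nonneg (V : VF) (t : ℝ) : 0 ≤ I (dis V) t := by
  rw [dis, I_add, I_add, I_add]
  linarith [I_sq_nonneg (dX V.1) t, I_sq_nonneg (dY V.1) t, I_sq_nonneg (dX V.2) t,
    I_sq_nonneg (dY V.2) t]

/-- `V` is a divergence-free solution, vanishing on the walls, of the Navier–Stokes system
linearised at the flow `(y, 0) + v`, in which only the transport velocity is perturbed. -/
structure Lin (ν T : ℝ) (v V : VF) (P : Fld) (G : VF) : Prop where
  mom1 : ZeroOn T (dT V.1 + (yF + v.1) * dX V.1 + v.2 * dY V.1 + V.2 + dX P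
    - ν • (dX (dX V.1) + dY (dY V.1)) - G.1)
  mom2 : ZeroOn T (dT V.2 + (yF + v.1) * dX V.2 + v.2 * dY V.2 + dY P
    - ν • (dX (dX V.2) + dY (dY V.2)) - G.2)
  div : ZeroOn T (dX V.1 + dY V.2)
  bdry1 : BdryZero T V.1
  bdry2 : BdryZero T V.2

protected theorem Lin.vX {ν T : ℝ} {v V : VF} {P : Fld} {G : VF} (h : Lin ν T v V P G) :
    Lin ν T v (vX V) (dX P) (vX G - adv (vX v) V) where
  mom1 := fun t ht x y hy => by
    have := h.mom1.dX t ht x y hy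
    simp [adv] at this ⊢
    linear_combination this
  mom2 := fun t ht x y hy => by
    have := h.mom2.dX t ht x y hy
    simp [adv] at this ⊢
    linear_combination this
  div := fun t ht x y hy => by
    have := h.div.dX t ht x y hy
    simp at this ⊢
    exact this
  bdry1 := h.bdry1.dX
  bdry2 := h.bdry2.dX

protected theorem Lin.vT {ν T : ℝ} (hT : 0 < T) {v V : VF} {P : Fld} {G : VF} (h : Lin ν T v V P G) :
    Lin ν T v (vT V) (dT P) (vT G - adv (vT v) V) where
  mom1 := fun t ht x y hy => by
    have := h.mom1.dT hT t ht x y hy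
    simp [adv] at this ⊢
    linear_combination this
  mom2 := fun t ht x y hy => by
    have := h.mom2.dT hT t ht x y hy
    simp [adv] at this ⊢
    linear_combination this
  div := fun t ht x y hy => by
    have := h.div.dT hT t ht x y hy
    simp at this ⊢
    exact this
  bdry1 := h.bdry1.dT hT
  bdry2 := h.bdry2.dT hT

/-! ### Energy identities -/

theorem Lin.energy {ν T : ℝ} {v V : VF} {P : Fld} {G : VF} (h : Lin ν T v V P G)
    (hdiv : ZeroOn T (dX v.1 + dY v.2)) {t : ℝ} (ht : t ∈ Icc (0 : ℝ) T) :
    I (dot V (vT V)) t + ν * I (dis V) t = I (dot G V) t - I (V.1 * V.2) t := by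
  set e : Fld := (1 / 2 : ℝ) • dot V V with he
  set A : Fld := ν • (V.1 * dX V.1 + V.2 * dX V.2) - (yF + v.1) * e - V.1 * P with hA
  set B : Fld := ν • (V.1 * dY V.1 + V.2 * dY V.2) - v.2 * e - V.2 * P with hB
  have h1 : I (dot V (vT V) + ν • dis V - dot G V + V.1 * V.2) t = I (dX A + dY B) t := by
    refine I_congr fun x y hy => ?_
    have m1 := h.mom1 t ht x y hy
    have m2 := h.mom2 t ht x y hy
    have d1 := h.div t ht x y hy
    have d2 := hdiv t ht x y hy
    simp [hA, hB, he, dot, dis] at m1 m2 d1 d2 ⊢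
    linear_combination V.1.1 t x y * m1 + V.2.1 t x y * m2 + P.1 t x y * d1
      + (1 / 2 * (V.1.1 t x y * V.1.1 t x y + V.2.1 t x y * V.2.1 t x y)) * d2
  have h2 : I (dY B) t = 0 := I_dY fun x => by
    have b1 := h.bdry1 t ht x
    have b2 := h.bdry2 t ht x
    constructor
    · simp [hB, he, dot, b1.1, b2.1]
    · simp [hB, he, dot, b1.2, b2.2]
  rw [I_add, I_sub, I_add, I_smul, I_add, I_dX, h2] at h1
  linarith

/-- The right-hand side of the momentum equation without the pressure. -/
def rhs (ν : ℝ) (v V G : VF) : VF :=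
  (G.1 - (yF + v.1) * dX V.1 - v.2 * dY V.1 - V.2 + ν • (dX (dX V.1) + dY (dY V.1)),
   G.2 - (yF + v.1) * dX V.2 - v.2 * dY V.2 + ν • (dX (dX V.2) + dY (dY V.2)))

theorem I_dot_le (a b : VF) (t : ℝ) :
    I (dot a b) t ≤ 1 / 2 * I (dot a a) t + 1 / 2 * I (dot b b) t := by
  rw [← I_smul, ← I_smul, ← I_add]
  refine I_mono fun x y _ => ?_
  simp [dot]
  nlinarith [sq_nonneg (a.1.1 t x y - b.1.1 t x y), sq_nonneg (a.2.1 t x y - b.2.1 t x y)]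

theorem Lin.vT_le {ν T : ℝ} (hT : 0 < T) {v V : VF} {P : Fld} {G : VF} (h : Lin ν T v V P G)
    {t : ℝ} (ht : t ∈ Icc (0 : ℝ) T) :
    I (dot (vT V) (vT V)) t
      ≤ I (dot (rhs ν v V G) (rhs ν v V G)) t := by
  have h1 : I (dot (vT V) (vT V)
      - dot (rhs ν v V G) (vT V)) t
      = I (dX (-(dT V.1 * P)) + dY (-(dT V.2 * P))) t := by
    refine I_congr fun x y hy => ?_
    have m1 := h.mom1 t ht x y hy
    have m2 := h.mom2 t ht x y hy
    have d1 := h.div.dT hT t ht x y hy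
    simp [rhs, dot] at m1 m2 d1 ⊢
    linear_combination (dT V.1).1 t x y * m1 + (dT V.2).1 t x y * m2 + P.1 t x y * d1
  have h2 : I (dY (-(dT V.2 * P))) t = 0 := I_dY fun x => by
    have b2 := h.bdry2.dT hT t ht x
    constructor
    · simp [b2.1]
    · simp [b2.2]
  rw [I_add, I_dX, h2, I_sub] at h1
  have h3 := I_dot_le (rhs ν v V G) (vT V) t
  linarith

/-! ### Trilinear estimates -/

theorem two_mul_abs_le {δ a c : ℝ} (hδ : 0 < δ) :
    |a * c| ≤ δ * (a * a) + 1 / (4 * δ) * (c * c) := by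
  have h : δ * (a * a) + 1 / (4 * δ) * (c * c) - |a * c| = (2 * δ * |a| - |c|) ^ 2 / (4 * δ) := by
    rw [abs_mul]
    field_simp
    rw [← sq_abs a, ← sq_abs c]
    ring
  have h2 : 0 ≤ (2 * δ * |a| - |c|) ^ 2 / (4 * δ) := by positivity
  linarith

theorem abs_I_le {F G : Fld} {t : ℝ} (h : ∀ x, ∀ y ∈ Icc (-1 : ℝ) 1, |F.1 t x y| ≤ G.1 t x y) :
    |I F t| ≤ I G t := by
  rw [abs_le, ← I_neg]
  exact ⟨I_mono fun x y hy => (abs_le.1 (h x y hy)).1, I_mono fun x y hy => (abs_le.1 (h x y hy)).2⟩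

theorem abs_I_tri_le {δ t : ℝ} (hδ : 0 < δ) {a b c : VF}
    (ha : ∀ x, a.2.1 t x (-1) = 0) (hdiv : ∀ x, ∀ y ∈ Icc (-1 : ℝ) 1,
      (dX a.1 + dY a.2).1 t x y = 0)
    (hb1 : ∀ x, (dX b.1).1 t x (-1) = 0) (hb2 : ∀ x, (dX b.2).1 t x (-1) = 0) :
    |I (dot (adv a b) c) t| ≤ 8 * δ * (I (dot a a) t + I (dot (vX a) (vX a)) t)
      * (I (dis b) t + I (dis (vX b)) t) + 1 / (2 * δ) * I (dot c c) t := by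
  set s1 := a.1 * dX b.1
  set s2 := dY b.1 * a.2
  set s3 := a.1 * dX b.2
  set s4 := dY b.2 * a.2
  have h1 : |I (dot (adv a b) c) t| ≤
      I (δ • (s1 * s1 + s2 * s2 + s3 * s3 + s4 * s4) + (1 / (2 * δ)) • dot c c) t := by
    refine abs_I_le fun x y _ => ?_
    have e1 := two_mul_abs_le (a := s1.1 t x y) (c := c.1.1 t x y) hδ
    have e2 := two_mul_abs_le (a := s2.1 t x y) (c := c.1.1 t x y) hδ
    have e3 := two_mul_abs_le (a := s3.1 t x y) (c := c.2.1 t x y) hδ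
    have e4 := two_mul_abs_le (a := s4.1 t x y) (c := c.2.1 t x y) hδ
    have e5 : (dot (adv a b) c).1 t x y = s1.1 t x y * c.1.1 t x y + s2.1 t x y * c.1.1 t x y
        + (s3.1 t x y * c.2.1 t x y + s4.1 t x y * c.2.1 t x y) := by
      simp [dot, adv, s1, s2, s3, s4]; ring
    rw [e5]
    have e6 : 1 / (2 * δ) = 2 * (1 / (4 * δ)) := by field_simp; norm_num
    rw [e6]
    simp only [add_app, smul_app, mul_app, dot] at e1 e2 e3 e4 ⊢
    refine (abs_add_le _ _).trans ?_
    refine (add_le_add (abs_add_le _ _) (abs_add_le _ _)).trans ?_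
    linarith
  have hdy : I (dY a.2 * dY a.2) t = I (dX a.1 * dX a.1) t := by
    refine I_congr fun x y hy => ?_
    have := hdiv x y hy
    simp at this ⊢
    have e : (dY a.2).1 t x y = -(dX a.1).1 t x y := by linarith
    rw [e]; ring
  have q1 := I_mul_sq_le (A := a.1) hb1
  have q2 := I_mul_sq_le (A := dY b.1) ha
  have q3 := I_mul_sq_le (A := a.1) hb2
  have q4 := I_mul_sq_le (A := dY b.2) ha
  rw [hdy] at q2 q4
  refine h1.trans ?_
  rw [I_add, I_smul, I_smul, I_add, I_add, I_add]
  simp only [dot, dis, I_add, vX_fst, vX_snd, dY_dX] at q1 q2 q3 q4 ⊢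
  have n := fun F => I_sq_nonneg F t
  set A1 := I (a.1 * a.1) t
  set A2 := I (a.2 * a.2) t
  set X1 := I (dX a.1 * dX a.1) t
  set X2 := I (dX a.2 * dX a.2) t
  set B1 := I (dX (dY b.1) * dX (dY b.1)) t
  set B2 := I (dX (dY b.2) * dX (dY b.2)) t
  set Y1 := I (dY b.1 * dY b.1) t
  set Y2 := I (dY b.2 * dY b.2) t
  set Z1 := I (dX b.1 * dX b.1) t
  set Z2 := I (dX b.2 * dX b.2) t
  set U1 := I (dX (dX b.1) * dX (dX b.1)) t
  set U2 := I (dX (dX b.2) * dX (dX b.2)) t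
  have hA1 : 0 ≤ A1 := n _
  have hA2 : 0 ≤ A2 := n _
  have hX1 : 0 ≤ X1 := n _
  have hX2 : 0 ≤ X2 := n _
  have hB1 : 0 ≤ B1 := n _
  have hB2 : 0 ≤ B2 := n _
  have hY1 : 0 ≤ Y1 := n _
  have hY2 : 0 ≤ Y2 := n _
  have hZ1 : 0 ≤ Z1 := n _
  have hZ2 : 0 ≤ Z2 := n _
  have hU1 : 0 ≤ U1 := n _
  have hU2 : 0 ≤ U2 := n _
  have hs : I (s1 * s1) t + I (s2 * s2) t + I (s3 * s3) t + I (s4 * s4) t ≤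
      8 * ((A1 + A2 + (X1 + X2)) * (Z1 + Y1 + Z2 + Y2 + (U1 + B1 + U2 + B2))) := by
    have k1 : (Y1 + B1) * X1 + (Y2 + B2) * X1 + (A1 + X1) * B1 + (A1 + X1) * B2 ≤
        2 * ((A1 + A2 + (X1 + X2)) * (Z1 + Y1 + Z2 + Y2 + (U1 + B1 + U2 + B2))) := by
      have : (A1 + X1) * (Y1 + Y2 + B1 + B2) ≤
          (A1 + A2 + (X1 + X2)) * (Z1 + Y1 + Z2 + Y2 + (U1 + B1 + U2 + B2)) :=
        mul_le_mul (by linarith) (by linarith) (by positivity) (by positivity)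
      nlinarith [mul_nonneg hA1 hY1, mul_nonneg hA1 hY2, mul_nonneg hX1 hY1, mul_nonneg hX1 hY2,
        mul_nonneg hA1 hB1, mul_nonneg hA1 hB2]
    linarith
  have := mul_le_mul_of_nonneg_left hs hδ.le
  linarith

theorem abs_I_tri_grad_le {t : ℝ} {a b : VF}
    (h1 : ∀ x, ∀ y ∈ Icc (-1 : ℝ) 1, |(dX b.1).1 t x y| ≤ 1 ∧ |(dY b.1).1 t x y| ≤ 1 ∧
      |(dX b.2).1 t x y| ≤ 1 ∧ |(dY b.2).1 t x y| ≤ 1) :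
    |I (dot (adv a b) a) t| ≤ 2 * I (dot a a) t := by
  rw [← I_smul]
  refine abs_I_le fun x y hy => ?_
  obtain ⟨e1, e2, e3, e4⟩ := h1 x y hy
  simp only [dot, adv, add_app, mul_app, smul_app]
  set p := a.1.1 t x y
  set q := a.2.1 t x y
  have hpq : |p * q| ≤ 1 / 2 * (p * p + q * q) := by
    rw [abs_le]; constructor <;> nlinarith [sq_nonneg (p + q), sq_nonneg (p - q)]
  have key : ∀ r z : ℝ, |r| ≤ 1 → |r * z| ≤ |z| := fun r z hr => by
    rw [abs_mul]; nlinarith [abs_nonneg z]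
  have k1 := key _ (p * p) e1
  have k2 := key _ (p * q) e2
  have k3 := key _ (p * q) e3
  have k4 := key _ (q * q) e4
  rw [abs_mul_self] at k1 k4
  have e5 : (p * (dX b.1).1 t x y + q * (dY b.1).1 t x y) * p
      + (p * (dX b.2).1 t x y + q * (dY b.2).1 t x y) * q
      = ((dX b.1).1 t x y * (p * p) + (dY b.1).1 t x y * (p * q))
        + ((dX b.2).1 t x y * (p * q) + (dY b.2).1 t x y * (q * q)) := by ring
  rw [e5]
  refine (abs_add_le _ _).trans ?_
  refine (add_le_add (abs_add_le _ _) (abs_add_le _ _)).trans ?_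
  linarith

/-! ### The tangential energy estimate -/

theorem vX_add (V W : VF) : vX (V + W) = vX V + vX W := by
  ext : 1 <;> simp

theorem vT_add (V W : VF) : vT (V + W) = vT V + vT W := by
  ext : 1 <;> simp

/-- Energy of the tangential derivatives `1, ∂ₓ, ∂ₓ², ∂ₓ³, ∂ₜ, ∂ₜ∂ₓ, ∂ₜ∂ₓ²`. -/
def En (V : VF) (t : ℝ) : ℝ :=
  I (dot V V) t + I (dot (vX V) (vX V)) t + I (dot (vX (vX V)) (vX (vX V))) t
    + I (dot (vX (vX (vX V))) (vX (vX (vX V)))) t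
    + I (dot (vT V) (vT V)) t + I (dot (vT (vX V)) (vT (vX V))) t
    + I (dot (vT (vX (vX V))) (vT (vX (vX V)))) t

/-- Smallness of the perturbation at time `t`. -/
structure Small (ν : ℝ) (v : VF) (t : ℝ) : Prop where
  energy : En v t ≤ ν
  grad : ∀ x, ∀ y ∈ Icc (-1 : ℝ) 1, |(dX v.1).1 t x y| ≤ 1 ∧ |(dY v.1).1 t x y| ≤ 1 ∧
      |(dX v.2).1 t x y| ≤ 1 ∧ |(dY v.2).1 t x y| ≤ 1

theorem hasDerivAt_I_dot (V : VF) (t : ℝ) :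
    HasDerivAt (I (dot V V)) (2 * I (dot V (vT V)) t) t := by
  have h := hasDerivAt_I (dot V V) t
  have e : dT (dot V V) = (2 : ℝ) • dot V (vT V) := by
    ext t x y
    simp [dot]
    ring
  rwa [e, I_smul] at h

theorem hasDerivAt_En (v : VF) (t : ℝ) :
    HasDerivAt (En v) (2 * (I (dot v (vT v)) t + I (dot (vX v) (vT (vX v))) t
      + I (dot (vX (vX v)) (vT (vX (vX v)))) t
      + I (dot (vX (vX (vX v))) (vT (vX (vX (vX v))))) t
      + I (dot (vT v) (vT (vT v))) t + I (dot (vT (vX v)) (vT (vT (vX v)))) t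
      + I (dot (vT (vX (vX v))) (vT (vT (vX (vX v))))) t)) t := by
  have h := ((((((hasDerivAt_I_dot v t).add (hasDerivAt_I_dot (vX v) t)).add
    (hasDerivAt_I_dot (vX (vX v)) t)).add (hasDerivAt_I_dot (vX (vX (vX v))) t)).add
    (hasDerivAt_I_dot (vT v) t)).add (hasDerivAt_I_dot (vT (vX v)) t)).add
    (hasDerivAt_I_dot (vT (vX (vX v))) t)
  exact h.congr_deriv (by ring)

theorem continuous_En (v : VF) : Continuous (En v) :=
  continuous_iff_continuousAt.2 fun t => (hasDerivAt_En v t).continuousAt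

theorem abs_I_cross_le (V : VF) (t : ℝ) : |I (V.1 * V.2) t| ≤ 1 / 2 * I (dot V V) t := by
  rw [← I_smul]
  refine abs_I_le fun x y _ => ?_
  simp only [mul_app, smul_app, dot, add_app]
  rw [abs_le]
  constructor <;> nlinarith [sq_nonneg (V.1.1 t x y + V.2.1 t x y),
    sq_nonneg (V.1.1 t x y - V.2.1 t x y)]

theorem Lin.tri_le {ν T t : ℝ} {v a b Ga Gb : VF} {Pa Pb : Fld} (La : Lin ν T v a Pa Ga)
    (Lb : Lin ν T v b Pb Gb) (ht : t ∈ Icc (0 : ℝ) T)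
    (hs : I (dot a a) t + I (dot (vX a) (vX a)) t ≤ ν) (c : VF) :
    |I (dot (adv a b) c) t| ≤
      1 / 32 * (ν * (I (dis b) t + I (dis (vX b)) t)) + 128 * I (dot c c) t := by
  have h := abs_I_tri_le (t := t) (δ := 1 / 256) (by norm_num) (a := a) (b := b) (c := c)
    (fun x => (La.bdry2 t ht x).1) (fun x y hy => La.div t ht x y hy)
    (fun x => (Lb.bdry1.dX t ht x).1) (fun x => (Lb.bdry2.dX t ht x).1)
  have h2 := mul_le_mul_of_nonneg_right hs
    (add_nonneg (I_dis_nonneg b t) (I_dis_nonneg (vX b) t))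
  norm_num at h ⊢
  linarith

section Tangential

variable {ν T t : ℝ} {v f : VF} {p : Fld}

theorem Small.x1 (h : Small ν v t) : I (dot (vX v) (vX v)) t
    + I (dot (vX (vX v)) (vX (vX v))) t ≤ ν := by
  have := h.energy
  have n := fun V => I_dot_self_nonneg V t
  unfold En at this
  linarith [n v, n (vX v), n (vX (vX v)), n (vX (vX (vX v))), n (vT v), n (vT (vX v)),
    n (vT (vX (vX v)))]

theorem Small.x2 (h : Small ν v t) : I (dot (vX (vX v)) (vX (vX v))) t
    + I (dot (vX (vX (vX v))) (vX (vX (vX v)))) t ≤ ν := by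
  have := h.energy
  have n := fun V => I_dot_self_nonneg V t
  unfold En at this
  linarith [n v, n (vX v), n (vX (vX v)), n (vX (vX (vX v))), n (vT v), n (vT (vX v)),
    n (vT (vX (vX v)))]

theorem Small.t0 (h : Small ν v t) : I (dot (vT v) (vT v)) t
    + I (dot (vX (vT v)) (vX (vT v))) t ≤ ν := by
  rw [vX_vT]
  have := h.energy
  have n := fun V => I_dot_self_nonneg V t
  unfold En at this
  linarith [n v, n (vX v), n (vX (vX v)), n (vX (vX (vX v))), n (vT v), n (vT (vX v)),
    n (vT (vX (vX v)))]

theorem Small.t1 (h : Small ν v t) : I (dot (vT (vX v)) (vT (vX v))) t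
    + I (dot (vX (vT (vX v))) (vX (vT (vX v)))) t ≤ ν := by
  rw [vX_vT]
  have := h.energy
  have n := fun V => I_dot_self_nonneg V t
  unfold En at this
  linarith [n v, n (vX v), n (vX (vX v)), n (vX (vX (vX v))), n (vT v), n (vT (vX v)),
    n (vT (vX (vX v)))]

theorem Lin.energy_le₀ (h : Lin ν T v v p f) (ht : t ∈ Icc (0 : ℝ) T) :
    I (dot v (vT v)) t + ν * I (dis v) t
      ≤ 1 / 2 * I (dot f f) t + I (dot v v) t := by
  have e := h.energy h.div ht
  have := I_dot_le f v t
  have := abs_le.1 (abs_I_cross_le v t)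
  linarith

theorem Lin.energy_le₁ (h : Lin ν T v v p f) (hs : Small ν v t) (ht : t ∈ Icc (0 : ℝ) T) :
    I (dot (vX v) (vT (vX v))) t + ν * I (dis (vX v)) t
      ≤ 1 / 2 * I (dot (vX f) (vX f)) t + 3 * I (dot (vX v) (vX v)) t := by
  have L1 := h.vX
  have e := L1.energy h.div ht
  have := I_dot_le (vX f) (vX v) t
  have := abs_le.1 (abs_I_cross_le (vX v) t)
  have := abs_le.1 (abs_I_tri_grad_le (a := vX v) hs.grad)
  simp only [dot_sub, I_sub] at e
  linarith

theorem Lin.energy_le₂ (h : Lin ν T v v p f) (hs : Small ν v t) (ht : t ∈ Icc (0 : ℝ) T) :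
    I (dot (vX (vX v)) (vT (vX (vX v)))) t + ν * I (dis (vX (vX v))) t
      ≤ 1 / 2 * I (dot (vX (vX f)) (vX (vX f))) t + 300 * I (dot (vX (vX v)) (vX (vX v))) t
        + 1 / 16 * (ν * (I (dis (vX v)) t + I (dis (vX (vX v))) t)) := by
  have L1 := h.vX
  have L2 := L1.vX
  have e := L2.energy h.div ht
  have := I_dot_le (vX (vX f)) (vX (vX v)) t
  have := abs_le.1 (abs_I_cross_le (vX (vX v)) t)
  have := abs_le.1 (abs_I_tri_grad_le (a := vX (vX v)) hs.grad)
  have := abs_le.1 (L1.tri_le L1 ht hs.x1 (vX (vX v)))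
  have := I_dot_self_nonneg (vX (vX v)) t
  simp only [dot_sub, dot_add, I_sub, I_add, vX_sub, vX_adv] at e
  linarith

theorem Lin.energy_le₃ (h : Lin ν T v v p f) (hs : Small ν v t) (ht : t ∈ Icc (0 : ℝ) T) :
    I (dot (vX (vX (vX v))) (vT (vX (vX (vX v))))) t + ν * I (dis (vX (vX (vX v)))) t
      ≤ 1 / 2 * I (dot (vX (vX (vX f))) (vX (vX (vX f)))) t
        + 800 * I (dot (vX (vX (vX v))) (vX (vX (vX v)))) t
        + 3 / 32 * (ν * (I (dis (vX v)) t + I (dis (vX (vX v))) t))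
        + 3 / 32 * (ν * (I (dis (vX (vX v))) t + I (dis (vX (vX (vX v)))) t)) := by
  have L1 := h.vX
  have L2 := L1.vX
  have e := L2.vX.energy h.div ht
  have := I_dot_le (vX (vX (vX f))) (vX (vX (vX v))) t
  have := abs_le.1 (abs_I_cross_le (vX (vX (vX v))) t)
  have := abs_le.1 (abs_I_tri_grad_le (a := vX (vX (vX v))) hs.grad)
  have := abs_le.1 (L2.tri_le L1 ht hs.x2 (vX (vX (vX v))))
  have := abs_le.1 (L1.tri_le L2 ht hs.x1 (vX (vX (vX v))))
  have := I_dot_self_nonneg (vX (vX (vX v))) t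
  simp only [dot_sub, dot_add, I_sub, I_add, vX_sub, vX_add, vX_adv] at e
  linarith

theorem Lin.energy_le_t₀ (hT : 0 < T) (h : Lin ν T v v p f) (hs : Small ν v t)
    (ht : t ∈ Icc (0 : ℝ) T) :
    I (dot (vT v) (vT (vT v))) t + ν * I (dis (vT v)) t
      ≤ 1 / 2 * I (dot (vT f) (vT f)) t + 3 * I (dot (vT v) (vT v)) t := by
  have e := (h.vT hT).energy h.div ht
  have := I_dot_le (vT f) (vT v) t
  have := abs_le.1 (abs_I_cross_le (vT v) t)
  have := abs_le.1 (abs_I_tri_grad_le (a := vT v) hs.grad)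
  simp only [dot_sub, I_sub] at e
  linarith

theorem Lin.energy_le_t₁ (hT : 0 < T) (h : Lin ν T v v p f) (hs : Small ν v t)
    (ht : t ∈ Icc (0 : ℝ) T) :
    I (dot (vT (vX v)) (vT (vT (vX v)))) t + ν * I (dis (vT (vX v))) t
      ≤ 1 / 2 * I (dot (vT (vX f)) (vT (vX f))) t
        + 300 * I (dot (vT (vX v)) (vT (vX v))) t
        + 1 / 32 * (ν * (I (dis (vX v)) t + I (dis (vX (vX v))) t))
        + 1 / 32 * (ν * (I (dis (vT v)) t + I (dis (vT (vX v))) t)) := by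
  have L1 := h.vX
  have Lt := h.vT hT
  have e := (L1.vT hT).energy h.div ht
  have := I_dot_le (vT (vX f)) (vT (vX v)) t
  have := abs_le.1 (abs_I_cross_le (vT (vX v)) t)
  have := abs_le.1 (abs_I_tri_grad_le (a := vT (vX v)) hs.grad)
  have := abs_le.1 (Lt.tri_le L1 ht hs.t0 (vT (vX v)))
  have q := abs_le.1 (L1.tri_le Lt ht hs.x1 (vT (vX v)))
  have := I_dot_self_nonneg (vT (vX v)) t
  simp only [dot_sub, dot_add, I_sub, I_add, vT_sub, vT_adv] at e
  rw [vX_vT] at q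
  linarith

theorem Lin.energy_le_t₂ (hT : 0 < T) (h : Lin ν T v v p f) (hs : Small ν v t)
    (ht : t ∈ Icc (0 : ℝ) T) :
    I (dot (vT (vX (vX v))) (vT (vT (vX (vX v))))) t + ν * I (dis (vT (vX (vX v)))) t
      ≤ 1 / 2 * I (dot (vT (vX (vX f))) (vT (vX (vX f)))) t
        + 800 * I (dot (vT (vX (vX v))) (vT (vX (vX v)))) t
        + 1 / 16 * (ν * (I (dis (vX v)) t + I (dis (vX (vX v))) t))
        + 1 / 32 * (ν * (I (dis (vX (vX v))) t + I (dis (vX (vX (vX v)))) t))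
        + 1 / 32 * (ν * (I (dis (vT v)) t + I (dis (vT (vX v))) t))
        + 1 / 16 * (ν * (I (dis (vT (vX v))) t + I (dis (vT (vX (vX v)))) t)) := by
  have L1 := h.vX
  have L2 := L1.vX
  have Lt := h.vT hT
  have Ltx := L1.vT hT
  have e := (L2.vT hT).energy h.div ht
  set c := vT (vX (vX v)) with hc
  have := I_dot_le (vT (vX (vX f))) c t
  have := abs_le.1 (abs_I_cross_le c t)
  have := abs_le.1 (abs_I_tri_grad_le (a := c) hs.grad)
  have q1 := abs_le.1 (L2.tri_le Lt ht hs.x2 c)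
  have q2 := abs_le.1 (Ltx.tri_le L1 ht hs.t1 c)
  have q3 := abs_le.1 (L1.tri_le Ltx ht hs.x1 c)
  have q4 := abs_le.1 (Lt.tri_le L2 ht hs.t0 c)
  have := I_dot_self_nonneg c t
  simp only [dot_sub, dot_add, I_sub, I_add, vT_sub, vT_add, vT_adv, vX_sub, vX_adv, ← hc] at e
  rw [vX_vT] at q1 q3
  rw [← hc] at q3
  linarith

theorem Lin.deriv_En_le (hT : 0 < T) (hν : 0 ≤ ν) (h : Lin ν T v v p f) (hs : Small ν v t)
    (ht : t ∈ Icc (0 : ℝ) T) :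
    2 * (I (dot v (vT v)) t + I (dot (vX v) (vT (vX v))) t
      + I (dot (vX (vX v)) (vT (vX (vX v)))) t
      + I (dot (vX (vX (vX v))) (vT (vX (vX (vX v))))) t
      + I (dot (vT v) (vT (vT v))) t + I (dot (vT (vX v)) (vT (vT (vX v)))) t
      + I (dot (vT (vX (vX v))) (vT (vT (vX (vX v))))) t) ≤ 1600 * En v t + En f t := by
  have e0 := h.energy_le₀ ht
  have e1 := h.energy_le₁ hs ht
  have e2 := h.energy_le₂ hs ht
  have e3 := h.energy_le₃ hs ht
  have e4 := h.energy_le_t₀ hT hs ht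
  have e5 := h.energy_le_t₁ hT hs ht
  have e6 := h.energy_le_t₂ hT hs ht
  have n := fun V => I_dot_self_nonneg V t
  have m := fun V => mul_nonneg hν (I_dis_nonneg V t)
  unfold En
  linarith [n v, n (vX v), n (vX (vX v)), n (vX (vX (vX v))), n (vT v), n (vT (vX v)),
    n (vT (vX (vX v))), m v, m (vX v), m (vX (vX v)), m (vX (vX (vX v))), m (vT v), m (vT (vX v)),
    m (vT (vX (vX v)))]

/-- Static control of the dissipation of the horizontal derivatives. -/
theorem Lin.dis_le (hν : 0 ≤ ν) (h : Lin ν T v v p f) (hs : Small ν v t)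
    (ht : t ∈ Icc (0 : ℝ) T) :
    ν * (I (dis v) t + I (dis (vX v)) t + I (dis (vX (vX v))) t) ≤ 400 * (En v t + En f t) := by
  have e0 := h.energy_le₀ ht
  have e1 := h.energy_le₁ hs ht
  have e2 := h.energy_le₂ hs ht
  have n := fun V => I_dot_self_nonneg V t
  have m := fun V => mul_nonneg hν (I_dis_nonneg V t)
  have key : ∀ V, -(1 / 2 * I (dot V V) t + 1 / 2 * I (dot (vT V) (vT V)) t)
      ≤ I (dot V (vT V)) t := fun V => by
    have := I_dot_le (-V) (vT V) t
    have a1 : dot (-V) (vT V) = -dot V (vT V) := by simp [dot]; ring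
    have a2 : dot (-V) (-V) = dot V V := by simp [dot]; ring
    rw [a1, a2, I_neg] at this
    linarith
  have := key v
  have := key (vX v)
  have := key (vX (vX v))
  unfold En
  linarith [n v, n (vX v), n (vX (vX v)), n (vX (vX (vX v))), n (vT v), n (vT (vX v)),
    n (vT (vX (vX v))), m v, m (vX v), m (vX (vX v)),
    n f, n (vX f), n (vX (vX f)), n (vX (vX (vX f))), n (vT f), n (vT (vX f)),
    n (vT (vX (vX f)))]

theorem Lin.dis_xxx_le (hν : 0 ≤ ν) (hν1 : ν ≤ 1) (h : Lin ν T v v p f) (hs : Small ν v t)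
    (ht : t ∈ Icc (0 : ℝ) T) :
    ν ^ 2 * I (dis (vX (vX (vX v)))) t ≤ 2000 * (En v t + En f t) := by
  have e3 := h.energy_le₃ hs ht
  have ed := h.dis_le hν hs ht
  have n := fun V => I_dot_self_nonneg V t
  have m := fun V => mul_nonneg hν (I_dis_nonneg V t)
  set W := vX (vX v) with hW
  have parts : I (dot (vX W) (vT (vX W))) t = -I (dot (vX (vX W)) (vT W)) t := by
    have : I (dX (dot (vX W) (vT W))) t = 0 := I_dX _ _
    have e : dX (dot (vX W) (vT W)) = dot (vX (vX W)) (vT W) + dot (vX W) (vT (vX W)) := by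
      simp [dot]; ring
    rw [e, I_add] at this
    linarith
  have young : ν * I (dot (vX (vX W)) (vT W)) t
      ≤ 1 / 4 * (ν ^ 2 * I (dis (vX W)) t) + I (dot (vT W) (vT W)) t := by
    rw [← I_smul, ← I_smul, ← I_smul, ← I_add]
    refine I_mono fun x y _ => ?_
    simp only [smul_app, add_app, dot, dis, mul_app, vX_fst, vX_snd, vT_fst, vT_snd]
    nlinarith [sq_nonneg (ν * (dX (dX W.1)).1 t x y - 2 * (dT W.1).1 t x y),
      sq_nonneg (ν * (dX (dX W.2)).1 t x y - 2 * (dT W.2).1 t x y),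
      sq_nonneg (ν * (dY (dX W.1)).1 t x y), sq_nonneg (ν * (dY (dX W.2)).1 t x y)]
  have e3' := mul_le_mul_of_nonneg_left e3 hν
  rw [parts] at e3'
  have k : ∀ r, 0 ≤ r → ν * r ≤ r := fun r hr => by nlinarith
  have k1 := k _ (n (vX (vX (vX f))))
  have k2 := k _ (n (vX W))
  have k3 := k _ (m (vX v))
  have k4 := k _ (m W)
  unfold En at ed ⊢
  rw [← hW] at *
  nlinarith [n v, n (vX v), n W, n (vX W), n (vT v), n (vT (vX v)),
    n (vT W), m v, m (vX v), m W, m (vX W),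
    n f, n (vX f), n (vX (vX f)), n (vX (vX (vX f))), n (vT f), n (vT (vX f)),
    n (vT (vX (vX f)))]

end Tangential

theorem le_exp_of_deriv_le {E E' : ℝ → ℝ} {K A T : ℝ} (hK : 0 ≤ K) (hA : 0 ≤ A) (hT : 0 ≤ T)
    (hd : ∀ t, HasDerivAt E (E' t) t) (hE : ∀ t ∈ Icc (0 : ℝ) T, E' t ≤ K * E t + A) :
    E T ≤ Real.exp (K * T) * (E 0 + T * A) := by
  set g : ℝ → ℝ := fun t => Real.exp (-(K * t)) * E t - A * t with hg
  have hgd : ∀ t, HasDerivAt g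
      (Real.exp (-(K * t)) * -(K * 1) * E t + Real.exp (-(K * t)) * E' t - A * 1) t := fun t =>
    ((((hasDerivAt_id t).const_mul K).neg.exp).mul (hd t)).sub ((hasDerivAt_id t).const_mul A)
  have hanti : AntitoneOn g (Icc 0 T) := by
    refine antitoneOn_of_deriv_nonpos (convex_Icc 0 T)
      (fun t _ => (hgd t).continuousAt.continuousWithinAt)
      (fun t _ => (hgd t).differentiableAt.differentiableWithinAt) fun t ht => ?_
    rw [interior_Icc] at ht
    rw [(hgd t).deriv]
    have h1 := hE t ⟨ht.1.le, ht.2.le⟩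
    have h2 : Real.exp (-(K * t)) ≤ 1 := Real.exp_le_one_iff.2 (by nlinarith [ht.1])
    have h3 := Real.exp_pos (-(K * t))
    nlinarith
  have h := hanti (left_mem_Icc.2 hT) (right_mem_Icc.2 hT) hT
  simp only [hg, mul_zero, neg_zero, Real.exp_zero, one_mul, sub_zero] at h
  have h1 : Real.exp (K * T) * (Real.exp (-(K * T)) * E T) = E T := by
    rw [← mul_assoc, ← Real.exp_add]; simp
  rw [← h1]
  exact mul_le_mul_of_nonneg_left (by linarith) (Real.exp_pos _).le

section

variable {ν T t e : ℝ} {v f : VF} {p : Fld}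

theorem Lin.En_le {A : ℝ} (hT : 0 < T) (hν : 0 ≤ ν) (h : Lin ν T v v p f) (ht : t ∈ Icc (0 : ℝ) T)
    (hs : ∀ s ∈ Icc (0 : ℝ) t, Small ν v s) (hA : 0 ≤ A) (hf : ∀ s ∈ Icc (0 : ℝ) t, En f s ≤ A) :
    En v t ≤ Real.exp (1600 * t) * (En v 0 + t * A) :=
  le_exp_of_deriv_le (by norm_num) hA ht.1 (hasDerivAt_En v) fun s hst =>
    (h.deriv_En_le hT hν (hs s hst) ⟨hst.1, hst.2.trans ht.2⟩).trans
      (by linarith [hf s hst])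

/-- A small solution at time `t` whose tangential energy, as well as that of the force,
is at most `e ^ 2`. -/
structure Ctrl (ν T : ℝ) (v : VF) (p : Fld) (f : VF) (t e : ℝ) : Prop where
  lin : Lin ν T v v p f
  mem : t ∈ Icc (0 : ℝ) T
  small : Small ν v t
  ν_pos : 0 < ν
  ν_le : ν ≤ 1
  e_nonneg : 0 ≤ e
  en : En v t ≤ e ^ 2
  enf : En f t ≤ e ^ 2

theorem I_dot_le_En (V : VF) (t : ℝ) : I (dot V V) t ≤ En V t ∧ I (dot (vX V) (vX V)) t ≤ En V t ∧
    I (dot (vX (vX V)) (vX (vX V))) t ≤ En V t ∧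
    I (dot (vX (vX (vX V))) (vX (vX (vX V)))) t ≤ En V t ∧
    I (dot (vT V) (vT V)) t ≤ En V t ∧ I (dot (vT (vX V)) (vT (vX V))) t ≤ En V t ∧
    I (dot (vT (vX (vX V))) (vT (vX (vX V)))) t ≤ En V t := by
  have n := fun V => I_dot_self_nonneg V t
  unfold En
  have := n V
  have := n (vX V)
  have := n (vX (vX V))
  have := n (vX (vX (vX V)))
  have := n (vT V)
  have := n (vT (vX V))
  have := n (vT (vX (vX V)))
  refine ⟨?_, ?_, ?_, ?_, ?_, ?_, ?_⟩ <;> linarith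

theorem I_fst_le_dot (V : VF) (t : ℝ) : I (V.1 * V.1) t ≤ I (dot V V) t := by
  rw [dot, I_add]; linarith [I_sq_nonneg V.2 t]

theorem I_snd_le_dot (V : VF) (t : ℝ) : I (V.2 * V.2) t ≤ I (dot V V) t := by
  rw [dot, I_add]; linarith [I_sq_nonneg V.1 t]

theorem I_le_dis (V : VF) (t : ℝ) : I (dX V.1 * dX V.1) t ≤ I (dis V) t ∧
    I (dY V.1 * dY V.1) t ≤ I (dis V) t ∧ I (dX V.2 * dX V.2) t ≤ I (dis V) t ∧
    I (dY V.2 * dY V.2) t ≤ I (dis V) t := by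
  have n := fun F => I_sq_nonneg F t
  have := n (dX V.1)
  have := n (dY V.1)
  have := n (dX V.2)
  have := n (dY V.2)
  rw [dis, I_add, I_add, I_add]
  refine ⟨?_, ?_, ?_, ?_⟩ <;> linarith

theorem abs_le_two_of_dY {F : Fld} {x y : ℝ} (h0 : F.1 t x (-1) = 0)
    (h1 : ∀ y ∈ Icc (-1 : ℝ) 1, |(dY F).1 t x y| ≤ 1) (hy : y ∈ Icc (-1 : ℝ) 1) :
    |F.1 t x y| ≤ 2 := by
  have h2 := integral_dY F t x (-1) y
  rw [h0, sub_zero] at h2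
  rw [← h2]
  have h3 := intervalIntegral.norm_integral_le_of_norm_le_const (C := 1) (a := -1) (b := y)
    (f := fun y => (dY F).1 t x y) fun z hz => by
      rw [uIoc_of_le hy.1] at hz
      exact h1 z ⟨hz.1.le, hz.2.trans hy.2⟩
  rw [Real.norm_eq_abs, abs_of_nonneg (a := y - -1) (by linarith [hy.1])] at h3
  linarith [hy.2]

namespace Ctrl

theorem v_le (h : Ctrl ν T v p f t e) (x : ℝ) {y : ℝ} (hy : y ∈ Icc (-1 : ℝ) 1) :
    |v.1.1 t x y| ≤ 2 ∧ |v.2.1 t x y| ≤ 2 :=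
  ⟨abs_le_two_of_dY (h.lin.bdry1 t h.mem x).1 (fun y hy => (h.small.grad x y hy).2.1) hy,
    abs_le_two_of_dY (h.lin.bdry2 t h.mem x).1 (fun y hy => (h.small.grad x y hy).2.2.2) hy⟩

theorem dis_le (h : Ctrl ν T v p f t e) : ν * I (dis v) t ≤ (30 * e) ^ 2 ∧
    ν * I (dis (vX v)) t ≤ (30 * e) ^ 2 ∧ ν * I (dis (vX (vX v))) t ≤ (30 * e) ^ 2 := by
  have h1 := h.lin.dis_le h.ν_pos.le h.small h.mem
  have := h.en
  have := h.enf
  have m := fun V => mul_nonneg h.ν_pos.le (I_dis_nonneg V t)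
  have := m v
  have := m (vX v)
  have := m (vX (vX v))
  have := sq_nonneg e
  refine ⟨?_, ?_, ?_⟩ <;> nlinarith

theorem dis_xxx_le (h : Ctrl ν T v p f t e) :
    ν ^ 2 * I (dis (vX (vX (vX v)))) t ≤ (64 * e) ^ 2 := by
  have h1 := h.lin.dis_xxx_le h.ν_pos.le h.ν_le h.small h.mem
  have := h.en
  have := h.enf
  nlinarith [sq_nonneg e]

theorem dY_w (h : Ctrl ν T v p f t e) : I (dY v.2 * dY v.2) t ≤ e ^ 2 ∧
    I (dX (dY v.2) * dX (dY v.2)) t ≤ e ^ 2 ∧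
    I (dX (dX (dY v.2)) * dX (dX (dY v.2))) t ≤ e ^ 2 := by
  obtain ⟨-, h1, h2, h3, -⟩ := I_dot_le_En v t
  have key : ∀ F G : Fld, ZeroOn T (F + G) → I (F * F) t ≤ e ^ 2 → I (G * G) t ≤ e ^ 2 := by
    intro F G hz hF
    have : I (G * G) t = I (F * F) t := I_congr fun x y hy => by
      have := hz t h.mem x y hy
      simp at this ⊢
      have e1 : G.1 t x y = -F.1 t x y := by linarith
      rw [e1]; ring
    rwa [this]
  have d := h.lin.div
  have dd := d.dX
  have ddd := dd.dX
  simp only [dX_add] at dd ddd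
  exact ⟨key _ _ d (((I_fst_le_dot (vX v) t).trans h1).trans h.en),
    key _ _ dd (((I_fst_le_dot (vX (vX v)) t).trans h2).trans h.en),
    key _ _ ddd (((I_fst_le_dot (vX (vX (vX v))) t).trans h3).trans h.en)⟩

theorem w_le (h : Ctrl ν T v p f t e) (x : ℝ) {y : ℝ} (hy : y ∈ Icc (-1 : ℝ) 1) :
    |v.2.1 t x y| ≤ 3 * e :=
  abs_le_of_dY h.e_nonneg (h.lin.bdry2 t h.mem x).1 h.dY_w.1 h.dY_w.2.1 hy

theorem w_x_le (h : Ctrl ν T v p f t e) (x : ℝ) {y : ℝ} (hy : y ∈ Icc (-1 : ℝ) 1) :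
    |(dX v.2).1 t x y| ≤ 3 * e :=
  abs_le_of_dY h.e_nonneg (h.lin.bdry2.dX t h.mem x).1 (by rw [dY_dX]; exact h.dY_w.2.1)
    (by rw [dY_dX]; exact h.dY_w.2.2) hy

theorem v_x_le (h : Ctrl ν T v p f t e) (x : ℝ) {y : ℝ} (hy : y ∈ Icc (-1 : ℝ) 1) :
    |(dX v.1).1 t x y| ≤ 90 * e / √ν := by
  have hr : 0 < √ν := Real.sqrt_pos.2 h.ν_pos
  have key : ∀ r, ν * r ≤ (30 * e) ^ 2 → r ≤ (30 * e / √ν) ^ 2 := fun r hr => by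
    rw [div_pow, Real.sq_sqrt h.ν_pos.le, le_div_iff₀ h.ν_pos]; linarith
  have := h.e_nonneg
  have h1 := abs_le_of_dY (F := dX v.1) (c := 30 * e / √ν) (by positivity)
    (h.lin.bdry1.dX t h.mem x).1
    ((I_le_dis (vX v) t).2.1.trans (key _ h.dis_le.2.1))
    (by
      have := (I_le_dis (vX (vX v)) t).2.1.trans (key _ h.dis_le.2.2)
      simpa using this) hy
  calc _ ≤ _ := h1
    _ = _ := by ring

theorem w_y_le (h : Ctrl ν T v p f t e) (x : ℝ) {y : ℝ} (hy : y ∈ Icc (-1 : ℝ) 1) :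
    |(dY v.2).1 t x y| ≤ 90 * e / √ν := by
  have h1 := h.lin.div t h.mem x y hy
  simp at h1
  have h2 := h.v_x_le x hy
  rwa [← abs_neg, show -(dY v.2).1 t x y = (dX v.1).1 t x y by linarith]

end Ctrl

end

/-! ### The pressure gradient -/

theorem integral_abs_le_sum {n : ℕ} {G : Fld} {F : Fin n → Fld} {c : Fin n → ℝ} {t x M : ℝ}
    (hc : ∀ i, 0 ≤ c i) (hF : ∀ i, ∫ y in (-1 : ℝ)..1, |(F i).1 t x y| ≤ M)
    (hG : ∀ y ∈ Icc (-1 : ℝ) 1, |G.1 t x y| ≤ ∑ i, c i * |(F i).1 t x y|) :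
    ∫ y in (-1 : ℝ)..1, |G.1 t x y| ≤ (∑ i, c i) * M := by
  have hi : ∀ i, IntervalIntegrable (fun y => c i * |(F i).1 t x y|) volume (-1) 1 := fun i =>
    (continuous_const.mul (cont_y (F i) t x).abs).intervalIntegrable _ _
  calc ∫ y in (-1 : ℝ)..1, |G.1 t x y|
      ≤ ∫ y in (-1 : ℝ)..1, ∑ i, c i * |(F i).1 t x y| :=
        integral_mono_on (by norm_num) ((cont_y G t x).abs.intervalIntegrable _ _)
          ((continuous_finsetSum _ fun i _ =>
            continuous_const.mul (cont_y (F i) t x).abs).intervalIntegrable _ _) hG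
    _ = ∑ i, c i * ∫ y in (-1 : ℝ)..1, |(F i).1 t x y| := by
        rw [intervalIntegral.integral_finsetSum fun i _ => hi i]
        simp only [intervalIntegral.integral_const_mul]
    _ ≤ ∑ i, c i * M := Finset.sum_le_sum fun i _ => mul_le_mul_of_nonneg_left (hF i) (hc i)
    _ = _ := by rw [Finset.sum_mul]

/-- The weight `(1 - y²)²`, which vanishes to second order on the walls. -/
def bump : Fld := (1 - yF * yF) * (1 - yF * yF)

theorem integral_bump (t x : ℝ) : ∫ y in (-1 : ℝ)..1, bump.1 t x y = 16 / 15 := by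
  have h : ∀ y : ℝ, HasDerivAt (fun y : ℝ => y - 2 / 3 * y ^ 3 + 1 / 5 * y ^ 5)
      (bump.1 t x y) y := fun y => by
    have := ((hasDerivAt_id y).sub ((hasDerivAt_pow 3 y).const_mul (2 / 3))).add
      ((hasDerivAt_pow 5 y).const_mul (1 / 5 : ℝ))
    refine this.congr_deriv ?_
    simp [bump]
    ring
  rw [integral_eq_sub_of_hasDerivAt (fun y _ => h y) (int_y bump t x _ _)]
  norm_num

theorem abs_le_of_bump {Q : Fld} {t x y a b : ℝ} (hy : y ∈ Icc (-1 : ℝ) 1)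
    (h1 : |∫ z in (-1 : ℝ)..1, (bump * Q).1 t x z| ≤ 16 / 15 * a)
    (h2 : ∫ z in (-1 : ℝ)..1, |(dY Q).1 t x z| ≤ b) : |Q.1 t x y| ≤ a + b := by
  have hosc : ∀ z ∈ Icc (-1 : ℝ) 1, |Q.1 t x y - Q.1 t x z| ≤ b := fun z hz => by
    rw [← integral_dY]
    exact (abs_integral_sub_le (cont_y (dY Q) t x) hz hy).trans h2
  have hφ : ∀ z, 0 ≤ bump.1 t x z := fun z => by
    simp only [bump, mul_app]
    exact mul_self_nonneg _
  have hInt : ∀ c : ℝ, ∫ z in (-1 : ℝ)..1, (bump * c • (1 : Fld)).1 t x z = 16 / 15 * c := fun c => by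
    simp only [mul_app, smul_app, one_app, mul_one]
    rw [intervalIntegral.integral_mul_const, integral_bump]
  have up := integral_mono_on (a := -1) (b := 1) (by norm_num)
    (int_y (bump * (Q.1 t x y - b) • (1 : Fld)) t x _ _) (int_y (bump * Q) t x _ _) fun z hz => by
      simp only [mul_app, smul_app, one_app, mul_one]
      have := abs_le.1 (hosc z hz)
      exact mul_le_mul_of_nonneg_left (by linarith) (hφ z)
  have lo := integral_mono_on (a := -1) (b := 1) (by norm_num)
    (int_y (bump * Q) t x _ _) (int_y (bump * (Q.1 t x y + b) • (1 : Fld)) t x _ _) fun z hz => by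
      simp only [mul_app, smul_app, one_app, mul_one]
      have := abs_le.1 (hosc z hz)
      exact mul_le_mul_of_nonneg_left (by linarith) (hφ z)
  rw [hInt] at up lo
  have := abs_le.1 h1
  rw [abs_le]
  constructor <;> linarith

section

variable {ν T t e : ℝ} {v f : VF} {p : Fld}

theorem integral_abs_le_of_dot {V : VF} {c : ℝ} (hc : 0 ≤ c) (h1 : I (dot V V) t ≤ c ^ 2)
    (h2 : I (dot (vX V) (vX V)) t ≤ c ^ 2) (x : ℝ) :
    (∫ y in (-1 : ℝ)..1, |V.1.1 t x y| ≤ 3 * c) ∧ ∫ y in (-1 : ℝ)..1, |V.2.1 t x y| ≤ 3 * c :=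
  ⟨integral_abs_y_le hc ((I_fst_le_dot V t).trans h1) ((I_fst_le_dot (vX V) t).trans h2) x,
    integral_abs_y_le hc ((I_snd_le_dot V t).trans h1) ((I_snd_le_dot (vX V) t).trans h2) x⟩

namespace Ctrl

theorem integral_dY_dX_p_le (h : Ctrl ν T v p f t e) (x : ℝ) :
    ∫ y in (-1 : ℝ)..1, |(dY (dX p)).1 t x y| ≤ 11 * (192 * e) := by
  have he := h.e_nonneg
  have hνe := h.ν_pos.le
  obtain ⟨v0, v1, v2, v3, vt0, vt1, vt2⟩ := I_dot_le_En v t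
  obtain ⟨f0, f1, f2, -⟩ := I_dot_le_En f t
  have up : ∀ r, r ≤ e ^ 2 → r ≤ (64 * e) ^ 2 := fun r hr => by nlinarith [sq_nonneg e]
  have hv := fun r (hr : r ≤ En v t) => up r (hr.trans h.en)
  have hf := fun r (hr : r ≤ En f t) => up r (hr.trans h.enf)
  have c0 : 0 ≤ 64 * e := by positivity
  have b1 := (integral_abs_le_of_dot (V := vX v) c0 (hv _ v1) (hv _ v2) x).2
  have b2 := integral_abs_le_of_dot (V := vX (vX v)) c0 (hv _ v2) (hv _ v3) x
  have bt := (integral_abs_le_of_dot (V := vT (vX v)) c0 (hv _ vt1)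
    (by rw [vX_vT]; exact hv _ vt2) x).2
  have bf := (integral_abs_le_of_dot (V := vX f) c0 (hf _ f1) (hf _ f2) x).2
  have hd2 := h.dis_le.2.2
  have hd3 := h.dis_xxx_le
  have q2 : ν ^ 2 * I (dis (vX (vX v))) t ≤ (64 * e) ^ 2 := by
    have := mul_le_mul_of_nonneg_left hd2 hνe
    nlinarith [h.ν_le, sq_nonneg e]
  have sc : ∀ F : Fld, I ((ν • F) * (ν • F)) t = ν ^ 2 * I (F * F) t := fun F => by
    rw [← I_smul]
    congr 1
    ext t x y
    simp; ring
  have mono : ∀ F : Fld, ∀ r, I (F * F) t ≤ r → ν ^ 2 * r ≤ (64 * e) ^ 2 →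
      I ((ν • F) * (ν • F)) t ≤ (64 * e) ^ 2 := fun F r h1 h2 => by
    rw [sc]
    exact (mul_le_mul_of_nonneg_left h1 (sq_nonneg ν)).trans h2
  have n1 := integral_abs_y_le (F := ν • dX (dX (dX v.2))) c0
    (mono _ _ (I_le_dis (vX (vX v)) t).2.2.1 q2)
    (by rw [dX_smul]; exact mono _ _ (I_le_dis (vX (vX (vX v))) t).2.2.1 hd3) x
  have n2 := integral_abs_y_le (F := ν • dX (dX (dY v.1))) c0
    (mono _ _ (by simpa using (I_le_dis (vX (vX v)) t).2.1) q2)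
    (by rw [dX_smul]; exact mono _ _ (by simpa using (I_le_dis (vX (vX (vX v))) t).2.1) hd3) x
  have key := integral_abs_le_sum (t := t) (x := x) (n := 8) (M := 192 * e) (G := dY (dX p))
    (F := ![dX f.2, dT (dX v.2), dX v.2, dX (dX v.2), dX (dX v.1), dX v.2,
      ν • dX (dX (dX v.2)), ν • dX (dX (dY v.1))])
    (c := ![1, 1, 1, 3, 2, 1, 1, 1])
    (by intro i; fin_cases i <;> simp)
    (by
      intro i
      have e1 : 192 * e = 3 * (64 * e) := by ring
      rw [e1]
      fin_cases i
      exacts [bf, bt, b1, b2.2, b2.1, b1, n1, n2])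
    (by
      intro y hy
      have m := h.lin.mom2.dX t h.mem x y hy
      have d0 := h.lin.div t h.mem x y hy
      have d1 := h.lin.div.dX t h.mem x y hy
      have d2 := h.lin.div.dX.dY t h.mem x y hy
      obtain ⟨g1, g2, g3, g4⟩ := h.small.grad x y hy
      obtain ⟨a1, a2⟩ := h.v_le x hy
      have a3 : |y + v.1.1 t x y| ≤ 3 :=
        (abs_add_le _ _).trans (by linarith [abs_le.2 hy])
      simp at m d0 d1 d2
      simp only [Fin.sum_univ_eight]
      simp only [Matrix.cons_val, smul_app, dY_dX]
      have e1 : (dX (dY p)).1 t x y = (dX f.2).1 t x y + (-(dT (dX v.2)).1 t x y)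
          + (-(dX v.1).1 t x y * (dX v.2).1 t x y)
          + (-(y + v.1.1 t x y) * (dX (dX v.2)).1 t x y)
          + (v.2.1 t x y * (dX (dX v.1)).1 t x y)
          + (-(dY v.2).1 t x y * (dX v.2).1 t x y)
          + ν * (dX (dX (dX v.2))).1 t x y + (-(ν * (dX (dX (dY v.1))).1 t x y)) := by
        linear_combination m - v.2.1 t x y * d1 + ν * d2
      rw [e1]
      have ml : ∀ a b c : ℝ, |a| ≤ c → |a * b| ≤ c * |b| := fun a b c hab => by
        rw [abs_mul]; exact mul_le_mul_of_nonneg_right hab (abs_nonneg _)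
      have k1 := ml _ ((dX v.2).1 t x y) _ ((abs_neg _).trans_le g1)
      have k2 := ml _ ((dX (dX v.2)).1 t x y) _ ((abs_neg _).trans_le a3)
      have k3 := ml _ ((dX (dX v.1)).1 t x y) _ a2
      have k4 := ml _ ((dX v.2).1 t x y) _ ((abs_neg _).trans_le g4)
      have k5 := abs_neg ((dT (dX v.2)).1 t x y)
      have k6 := abs_neg (ν * (dX (dX (dY v.1))).1 t x y)
      refine (abs_add_le _ _).trans ?_
      refine (add_le_add_left (abs_add_le _ _) _).trans ?_
      refine (add_le_add_left (add_le_add_left (abs_add_le _ _) _) _).trans ?_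
      refine (add_le_add_left (add_le_add_left (add_le_add_left (abs_add_le _ _) _) _) _).trans ?_
      refine (add_le_add_left (add_le_add_left (add_le_add_left (add_le_add_left
        (abs_add_le _ _) _) _) _) _).trans ?_
      refine (add_le_add_left (add_le_add_left (add_le_add_left (add_le_add_left
        (add_le_add_left (abs_add_le _ _) _) _) _) _) _).trans ?_
      refine (add_le_add_left (add_le_add_left (add_le_add_left (add_le_add_left
        (add_le_add_left (add_le_add_left (abs_add_le _ _) _) _) _) _) _) _).trans ?_
      linarith)
  have hsum : ∑ i, (![1, 1, 1, 3, 2, 1, 1, 1] : Fin 8 → ℝ) i = 11 := by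
    simp only [Fin.sum_univ_eight, Matrix.cons_val]; norm_num
  rwa [hsum] at key

theorem integral_bump_dX_p_le (h : Ctrl ν T v p f t e) (x : ℝ) :
    |∫ y in (-1 : ℝ)..1, (bump * dX p).1 t x y| ≤ 16 * (192 * e) := by
  have he := h.e_nonneg
  obtain ⟨v0, v1, v2, v3, vt0, vt1, vt2⟩ := I_dot_le_En v t
  obtain ⟨f0, f1, -⟩ := I_dot_le_En f t
  have up : ∀ r, r ≤ e ^ 2 → r ≤ (64 * e) ^ 2 := fun r hr => by nlinarith [sq_nonneg e]
  have hv := fun r (hr : r ≤ En v t) => up r (hr.trans h.en)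
  have hf := fun r (hr : r ≤ En f t) => up r (hr.trans h.enf)
  have c0 : 0 ≤ 64 * e := by positivity
  have b0 := integral_abs_le_of_dot (V := v) c0 (hv _ v0) (hv _ v1) x
  have b1 := (integral_abs_le_of_dot (V := vX v) c0 (hv _ v1) (hv _ v2) x).1
  have b2 := (integral_abs_le_of_dot (V := vX (vX v)) c0 (hv _ v2) (hv _ v3) x).1
  have bt := (integral_abs_le_of_dot (V := vT v) c0 (hv _ vt0)
    (by rw [vX_vT]; exact hv _ vt1) x).1
  have bf := (integral_abs_le_of_dot (V := f) c0 (hf _ f0) (hf _ f1) x).1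
  set W : Fld := ν • (bump * dY v.1 - dY bump * v.1) with hW
  set R : Fld := bump * (f.1 - dT v.1 - (yF + v.1) * dX v.1 - v.2 * dY v.1 - v.2
    + ν • dX (dX v.1)) + ν • (dY (dY bump) * v.1) with hR
  have split : ∫ y in (-1 : ℝ)..1, (bump * dX p).1 t x y = ∫ y in (-1 : ℝ)..1, R.1 t x y := by
    have w0 : ∫ y in (-1 : ℝ)..1, (dY W).1 t x y = 0 := by
      rw [integral_dY]
      simp [hW, bump]
    rw [← add_zero (∫ y in (-1 : ℝ)..1, R.1 t x y), ← w0,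
      ← integral_add (int_y R t x _ _) (int_y (dY W) t x _ _)]
    refine integral_congr fun y hy => ?_
    rw [uIcc_of_le (by norm_num)] at hy
    have m := h.lin.mom1 t h.mem x y hy
    simp only [hR, hW, add_app, sub_app, mul_app, smul_app, yF_app, dY_smul, dY_sub, dY_mul] at m ⊢
    linear_combination bump.1 t x y * m
  rw [split]
  refine (abs_integral_le_integral_abs (by norm_num)).trans ?_
  have key := integral_abs_le_sum (t := t) (x := x) (n := 6) (M := 192 * e) (G := R)
    (F := ![f.1, dT v.1, dX v.1, v.2, dX (dX v.1), v.1]) (c := ![1, 1, 3, 2, 1, 8])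
    (by intro i; fin_cases i <;> simp)
    (by
      intro i
      have e1 : 192 * e = 3 * (64 * e) := by ring
      rw [e1]
      fin_cases i
      exacts [bf, bt, b1, b0.2, b2, b0.1])
    (by
      intro y hy
      obtain ⟨g1, g2, g3, g4⟩ := h.small.grad x y hy
      obtain ⟨a1, a2⟩ := h.v_le x hy
      have a3 : |y + v.1.1 t x y| ≤ 3 :=
        (abs_add_le _ _).trans (by linarith [abs_le.2 hy])
      have hy2 : y * y ≤ 1 := by nlinarith [hy.1, hy.2]
      have p0 : |bump.1 t x y| ≤ 1 := by
        simp only [bump, mul_app, sub_app, one_app, yF_app]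
        rw [abs_mul_self]
        nlinarith [mul_self_nonneg y]
      have p2 : |(dY (dY bump)).1 t x y| ≤ 8 := by
        have : (dY (dY bump)).1 t x y = 12 * (y * y) - 4 := by simp [bump]; ring
        rw [this, abs_le]
        constructor <;> nlinarith [mul_self_nonneg y]
      simp only [Fin.sum_univ_six, Matrix.cons_val]
      have ml : ∀ a b c : ℝ, |a| ≤ c → |a * b| ≤ c * |b| := fun a b c hab => by
        rw [abs_mul]; exact mul_le_mul_of_nonneg_right hab (abs_nonneg _)
      have hν : |ν| ≤ 1 := by rw [abs_of_pos h.ν_pos]; exact h.ν_le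
      simp only [hR, add_app, sub_app, mul_app, smul_app, yF_app]
      have k1 := ml _ ((dX v.1).1 t x y) _ a3
      have k2 := ml _ (v.2.1 t x y) _ g2
      have k3 := ml _ ((dX (dX v.1)).1 t x y) _ hν
      have k4 := ml _ (v.1.1 t x y) _ p2
      have k5 := ml _ ((dY (dY bump)).1 t x y * v.1.1 t x y) _ hν
      rw [mul_comm] at k2
      set q := f.1.1 t x y - (dT v.1).1 t x y - (y + v.1.1 t x y) * (dX v.1).1 t x y
        - v.2.1 t x y * (dY v.1).1 t x y - v.2.1 t x y + ν * (dX (dX v.1)).1 t x y with hq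
      have k6 := ml _ q _ p0
      have k7 : |q| ≤ |f.1.1 t x y| + |(dT v.1).1 t x y|
          + |(y + v.1.1 t x y) * (dX v.1).1 t x y| + |v.2.1 t x y * (dY v.1).1 t x y|
          + |v.2.1 t x y| + |ν * (dX (dX v.1)).1 t x y| := by
        refine (abs_add_le _ _).trans (add_le_add_left ?_ _)
        refine (abs_sub _ _).trans (add_le_add_left ?_ _)
        refine (abs_sub _ _).trans (add_le_add_left ?_ _)
        refine (abs_sub _ _).trans (add_le_add_left ?_ _)
        exact abs_sub _ _
      refine (abs_add_le _ _).trans ?_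
      linarith)
  have hsum : ∑ i, (![1, 1, 3, 2, 1, 8] : Fin 6 → ℝ) i = 16 := by
    simp only [Fin.sum_univ_six, Matrix.cons_val]; norm_num
  rwa [hsum] at key

theorem dX_p_le (h : Ctrl ν T v p f t e) (x : ℝ) {y : ℝ} (hy : y ∈ Icc (-1 : ℝ) 1) :
    |(dX p).1 t x y| ≤ 5000 * e := by
  have := abs_le_of_bump (a := 15 * (192 * e)) hy
    ((h.integral_bump_dX_p_le x).trans_eq (by ring)) (h.integral_dY_dX_p_le x)
  linarith [h.e_nonneg]

end Ctrl

end

/-! ### The maximum principle -/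

theorem second_deriv_nonpos_of_isLocalMax {g g' : ℝ → ℝ} {c z : ℝ} (hm : IsLocalMax g z)
    (hd : ∀ s, HasDerivAt g (g' s) s) (hd' : HasDerivAt g' c z) : g' z = 0 ∧ c ≤ 0 := by
  have h1 : deriv g = g' := funext fun s => (hd s).deriv
  have h0 : g' z = 0 := hm.hasDerivAt_eq_zero (hd z)
  refine ⟨h0, not_lt.1 fun hc => ?_⟩
  have hmin : IsLocalMin g z := isLocalMin_of_deriv_deriv_pos
    (by rw [h1, hd'.deriv]; exact hc) (by rw [h1, h0]) (hd z).continuousAt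
  have hconst : g =ᶠ[𝓝 z] fun _ => g z := by
    filter_upwards [hm, hmin] with s h2 h3 using le_antisymm h2 h3
  have h4 : g' =ᶠ[𝓝 z] fun _ => 0 := by
    filter_upwards [hconst.eventually_nhds] with s hs
    have hs' : g =ᶠ[𝓝 s] fun _ => g z := hs
    exact ((hd s).congr_of_eventuallyEq hs'.symm).unique (hasDerivAt_const s (g z))
  have h5 := (hd'.congr_of_eventuallyEq h4.symm).unique (hasDerivAt_const z (0 : ℝ))
  exact hc.ne' h5

theorem deriv_nonneg_of_le_left {g : ℝ → ℝ} {c a z : ℝ} (haz : a < z) (hd : HasDerivAt g c z)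
    (h : ∀ s ∈ Icc a z, g s ≤ g z) : 0 ≤ c := by
  have h1 := hasDerivAt_iff_tendsto_slope_left_right.1 hd |>.1
  refine ge_of_tendsto h1 ?_
  filter_upwards [Ioo_mem_nhdsLT haz] with s hs
  rw [slope_def_field]
  exact div_nonneg_of_nonpos (by linarith [h s ⟨hs.1.le, hs.2.le⟩]) (by linarith [hs.2])

theorem deriv_nonpos_of_le_right {g : ℝ → ℝ} {c a z : ℝ} (haz : z < a) (hd : HasDerivAt g c z)
    (h : ∀ s ∈ Icc z a, g s ≤ g z) : c ≤ 0 := by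
  have h1 := hasDerivAt_iff_tendsto_slope_left_right.1 hd |>.2
  refine le_of_tendsto h1 ?_
  filter_upwards [Ioo_mem_nhdsGT haz] with s hs
  rw [slope_def_field]
  exact div_nonpos_of_nonpos_of_nonneg (by linarith [h s ⟨hs.1.le, hs.2.le⟩]) (by linarith [hs.1])

theorem max_principle {ν T a b : ℝ} {h u₁ u₂ : Fld} (hν : 0 ≤ ν)
    (h0 : ∀ x, ∀ y ∈ Icc a b, h.1 0 x y ≤ 0)
    (ha : ∀ t ∈ Icc 0 T, ∀ x, h.1 t x a ≤ 0) (hb : ∀ t ∈ Icc 0 T, ∀ x, h.1 t x b ≤ 0)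
    (hL : ∀ t ∈ Icc 0 T, ∀ x, ∀ y ∈ Icc a b,
      (dT h + u₁ * dX h + u₂ * dY h - ν • (dX (dX h) + dY (dY h))).1 t x y < 0) :
    ∀ t ∈ Icc 0 T, ∀ x, ∀ y ∈ Icc a b, h.1 t x y ≤ 0 := by
  intro t ht x y hy
  by_contra! hpos
  have hK : IsCompact (Icc (0 : ℝ) T ×ˢ Icc (0 : ℝ) (2 * Real.pi) ×ˢ Icc a b) :=
    isCompact_Icc.prod (isCompact_Icc.prod isCompact_Icc)
  have hmem : ∀ s ∈ Icc (0 : ℝ) T, ∀ z, ∀ w ∈ Icc a b, ∃ z' ∈ Icc (0 : ℝ) (2 * Real.pi),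
      h.1 s z w = h.1 s z' w := fun s _ z w _ => by
    have hper : Function.Periodic (fun z => h.1 s z w) (2 * Real.pi) := fun z => periodic h s z w
    obtain ⟨z', hz', he⟩ := hper.exists_mem_Ico₀ (by positivity) z
    exact ⟨z', ⟨hz'.1, hz'.2.le⟩, he⟩
  obtain ⟨x', hx', hxx⟩ := hmem t ht x y hy
  obtain ⟨⟨t0, x0, y0⟩, ⟨ht0, -, hy0⟩, hmax⟩ := hK.exists_isMaxOn ⟨(t, x', y), ht, hx', hy⟩
    (continuous_unc h).continuousOn
  have hmax' : ∀ s ∈ Icc (0 : ℝ) T, ∀ z, ∀ w ∈ Icc a b, h.1 s z w ≤ h.1 t0 x0 y0 :=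
    fun s hs z w hw => by
      obtain ⟨z', hz', he⟩ := hmem s hs z w hw
      rw [he]
      exact hmax (a := (s, z', w)) ⟨hs, hz', hw⟩
  have hp0 : 0 < h.1 t0 x0 y0 := hpos.trans_le (hmax' t ht x y hy)
  simp only at ht0 hy0
  have htpos : 0 < t0 := by
    rcases ht0.1.eq_or_lt with h1 | h1
    · rw [← h1] at hp0
      exact absurd (h0 x0 y0 hy0) hp0.not_ge
    · exact h1
  have hya : a < y0 := lt_of_le_of_ne hy0.1 fun h1 => by
    rw [← h1] at hp0
    exact absurd (ha t0 ht0 x0) hp0.not_ge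
  have hyb : y0 < b := lt_of_le_of_ne hy0.2 fun h1 => by
    rw [h1] at hp0
    exact absurd (hb t0 ht0 x0) hp0.not_ge
  have d1 : 0 ≤ (dT h).1 t0 x0 y0 := deriv_nonneg_of_le_left htpos (hasDerivAt_t h t0 x0 y0)
    fun s hs => hmax' s ⟨hs.1, hs.2.trans ht0.2⟩ x0 y0 hy0
  have d2 := second_deriv_nonpos_of_isLocalMax (g := fun z => h.1 t0 z y0)
    (Eventually.of_forall fun z => hmax' t0 ht0 z y0 hy0)
    (fun s => hasDerivAt_x h t0 s y0) (hasDerivAt_x (dX h) t0 x0 y0)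
  have d3 := second_deriv_nonpos_of_isLocalMax (g := fun z => h.1 t0 x0 z) (z := y0)
    (by filter_upwards [Ioo_mem_nhds hya hyb] with z hz using hmax' t0 ht0 x0 z ⟨hz.1.le, hz.2.le⟩)
    (fun s => hasDerivAt_y h t0 x0 s) (hasDerivAt_y (dY h) t0 x0 y0)
  have hneg := hL t0 ht0 x0 y0 hy0
  simp only [add_app, sub_app, mul_app, smul_app, d2.1, d3.1] at hneg
  nlinarith [d2.2, d3.2]

/-- A small solution on `[0,τ]` with tangential energies at most `e ^ 2`, with force and
initial data bounded by `e` in `C¹`. -/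
structure Run (ν T : ℝ) (v : VF) (p : Fld) (f : VF) (τ e : ℝ) : Prop where
  ctrl : ∀ t ∈ Icc (0 : ℝ) τ, Ctrl ν T v p f t e
  τ_nonneg : 0 ≤ τ
  e_pos : 0 < e
  e_le : 6 * e ≤ √ν
  force : ∀ t ∈ Icc (0 : ℝ) τ, ∀ x, ∀ y ∈ Icc (-1 : ℝ) 1,
    |f.1.1 t x y| ≤ e ∧ |(dX f.2).1 t x y| ≤ e ∧ |(dY f.1).1 t x y| ≤ e
  init : ∀ x, ∀ y ∈ Icc (-1 : ℝ) 1, |(dX v.2).1 0 x y| ≤ e ∧ |(dY v.1).1 0 x y| ≤ e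

namespace Run

variable {ν T τ e : ℝ} {v f : VF} {p : Fld}

theorem ctrl_zero (h : Run ν T v p f τ e) : Ctrl ν T v p f 0 e :=
  h.ctrl 0 (left_mem_Icc.2 h.τ_nonneg)

theorem sqrt_pos (h : Run ν T v p f τ e) : 0 < √ν := Real.sqrt_pos.2 h.ctrl_zero.ν_pos

theorem sqrt_le (h : Run ν T v p f τ e) : √ν ≤ 1 := Real.sqrt_le_one.2 h.ctrl_zero.ν_le

theorem init_left (h : Run ν T v p f τ e) (x : ℝ) {y : ℝ} (hy : y ∈ Icc (-1 : ℝ) 1) :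
    |v.1.1 0 x y| ≤ e * (1 + y) := by
  have h0 := h.ctrl_zero
  have h2 := integral_dY v.1 0 x (-1) y
  rw [(h0.lin.bdry1 0 h0.mem x).1, sub_zero] at h2
  rw [← h2]
  have h3 := intervalIntegral.norm_integral_le_of_norm_le_const (C := e) (a := -1) (b := y)
    (f := fun y => (dY v.1).1 0 x y) fun z hz => by
      rw [uIoc_of_le hy.1] at hz
      exact (h.init x z ⟨hz.1.le, hz.2.trans hy.2⟩).2
  rw [Real.norm_eq_abs, abs_of_nonneg (a := y - -1) (by linarith [hy.1])] at h3
  linarith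

theorem init_right (h : Run ν T v p f τ e) (x : ℝ) {y : ℝ} (hy : y ∈ Icc (-1 : ℝ) 1) :
    |v.1.1 0 x y| ≤ e * (1 - y) := by
  have h0 := h.ctrl_zero
  have h2 := integral_dY v.1 0 x y 1
  rw [(h0.lin.bdry1 0 h0.mem x).2, zero_sub] at h2
  rw [← abs_neg, ← h2]
  have h3 := intervalIntegral.norm_integral_le_of_norm_le_const (C := e) (a := y) (b := 1)
    (f := fun y => (dY v.1).1 0 x y) fun z hz => by
      rw [uIoc_of_le hy.2] at hz
      exact (h.init x z ⟨hy.1.trans hz.1.le, hz.2⟩).2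
  rwa [Real.norm_eq_abs, abs_of_nonneg (a := 1 - y) (by linarith [hy.2])] at h3

theorem transport_le (h : Run ν T v p f τ e) {t x y : ℝ} (ht : t ∈ Icc (0 : ℝ) τ)
    (hy : y ∈ Icc (-1 : ℝ) 1) :
    |(dT v.1 + (yF + v.1) * dX v.1 + v.2 * dY v.1 - ν • (dX (dX v.1) + dY (dY v.1))).1 t x y|
      ≤ 5004 * e := by
  have hc := h.ctrl t ht
  have m := hc.lin.mom1 t hc.mem x y hy
  have e1 : (dT v.1 + (yF + v.1) * dX v.1 + v.2 * dY v.1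
      - ν • (dX (dX v.1) + dY (dY v.1))).1 t x y
      = f.1.1 t x y - v.2.1 t x y - (dX p).1 t x y := by
    simp only [add_app, sub_app] at m ⊢
    linarith
  rw [e1]
  have h1 := hc.w_le x hy
  have h2 := hc.dX_p_le x hy
  have h3 := (h.force t ht x y hy).1
  rw [abs_le] at *
  constructor <;> linarith

theorem sign_mul_le {σ a b : ℝ} (hσ : σ = 1 ∨ σ = -1) (h : |a| ≤ b) : σ * a ≤ b := by
  rw [abs_le] at h
  rcases hσ with rfl | rfl <;> linarith

theorem abs_le_of_sign {a b : ℝ} (h : ∀ σ : ℝ, σ = 1 ∨ σ = -1 → σ * a ≤ b) : |a| ≤ b := by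
  rw [abs_le]
  constructor <;> linarith [h 1 (Or.inl rfl), h (-1) (Or.inr rfl)]

theorem v_le (h : Run ν T v p f τ e) {t x y : ℝ} (ht : t ∈ Icc (0 : ℝ) τ)
    (hy : y ∈ Icc (-1 : ℝ) 1) : |v.1.1 t x y| ≤ 6000 * (1 + τ) * e := by
  have he := h.e_pos
  refine abs_le_of_sign fun σ hσ => ?_
  set g : Fld := σ • v.1 - (2 * e) • (1 : Fld) - (6000 * e) • tF with hg
  have key := max_principle (h := g) (u₁ := yF + v.1) (u₂ := v.2) (a := -1) (b := 1) (T := τ)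
    h.ctrl_zero.ν_pos.le
    (fun x y hy => by
      have h1 := sign_mul_le hσ (h.init_left x hy)
      simp [hg]
      nlinarith [hy.2])
    (fun s hs x => by
      have h1 := ((h.ctrl s hs).lin.bdry1 s (h.ctrl s hs).mem x).1
      simp [hg, h1]
      nlinarith [hs.1])
    (fun s hs x => by
      have h1 := ((h.ctrl s hs).lin.bdry1 s (h.ctrl s hs).mem x).2
      simp [hg, h1]
      nlinarith [hs.1])
    (fun s hs x y hy => by
      have h1 := sign_mul_le hσ (h.transport_le (x := x) hs hy)
      simp [hg] at h1 ⊢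
      linarith)
    t ht x y hy
  simp [hg] at key
  nlinarith [ht.1, ht.2]

/-- The boundary layer barrier `M (2 η - η ^ 2)` with `η = (1 ± y) / r`. -/
def barrier (M r ς : ℝ) : Fld :=
  (M / r ^ 2) • ((2 * r) • (1 + ς • yF) - (1 + ς • yF) * (1 + ς • yF))

theorem barrier_le (h : Run ν T v p f τ e) {ς a b : ℝ} (hς : ς = 1 ∨ ς = -1)
    (hab : ∀ y ∈ Icc a b, y ∈ Icc (-1 : ℝ) 1 ∧ 0 ≤ 1 + ς * y ∧ 1 + ς * y ≤ √ν)
    (ha : (1 + ς * a = 0 ∧ a = -1) ∨ 1 + ς * a = √ν) (hb : (1 + ς * b = 0 ∧ b = 1) ∨ 1 + ς * b = √ν)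
    (hle : a ≤ b) {σ : ℝ} (hσ : σ = 1 ∨ σ = -1) :
    ∀ t ∈ Icc 0 τ, ∀ x, ∀ y ∈ Icc a b,
      (σ • v.1 - barrier (6000 * (1 + τ) * e) (√ν) ς).1 t x y ≤ 0 := by
  have he := h.e_pos
  have hτ := h.τ_nonneg
  have hr := h.sqrt_pos
  have hr1 := h.sqrt_le
  have hν : ν = √ν ^ 2 := (Real.sq_sqrt h.ctrl_zero.ν_pos.le).symm
  set r := √ν with hrdef
  set M := 6000 * (1 + τ) * e with hM
  have hMe : 6000 * e ≤ M := by nlinarith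
  have hMpos : 0 < M := by linarith
  have hq : ∀ t x y, (barrier M r ς).1 t x y
      = M / r ^ 2 * ((2 * r) * (1 + ς * y) - (1 + ς * y) * (1 + ς * y)) := fun t x y => by
    simp only [barrier, smul_app, sub_app, mul_app, add_app, one_app, yF_app]
  have top : M / r ^ 2 * ((2 * r) * r - r * r) = M := by field_simp; ring
  have side : ∀ s ∈ Icc 0 τ, ∀ x c, c ∈ Icc a b →
      (1 + ς * c = 0 ∧ v.1.1 s x c = 0 ∨ 1 + ς * c = r) →
      (σ • v.1 - barrier M r ς).1 s x c ≤ 0 := fun s hs x c hc hd => by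
    rw [sub_app, smul_app, hq]
    rcases hd with ⟨h1, h2⟩ | h1
    · rw [h1, h2]; simp
    · rw [h1, top]
      linarith [sign_mul_le hσ (h.v_le (x := x) hs (hab c hc).1)]
  refine max_principle (u₁ := yF + v.1) (u₂ := v.2) h.ctrl_zero.ν_pos.le ?_ ?_ ?_ ?_
  · intro x y hy
    obtain ⟨hy1, hη0, hη1⟩ := hab y hy
    have h1 : |v.1.1 0 x y| ≤ e * (1 + ς * y) := by
      rcases hς with rfl | rfl
      · simpa using h.init_left x hy1
      · simpa [sub_eq_add_neg] using h.init_right x hy1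
    have h2 := sign_mul_le hσ h1
    rw [sub_app, smul_app, hq]
    set η := 1 + ς * y
    have h3 : M * η ≤ M / r ^ 2 * ((2 * r) * η - η * η) := by
      rw [div_mul_eq_mul_div, le_div_iff₀ (by positivity)]
      have : η * r ^ 2 ≤ 2 * r * η - η * η := by nlinarith [mul_nonneg hη0 hr.le]
      nlinarith
    nlinarith
  · intro s hs x
    refine side s hs x a (left_mem_Icc.2 hle) ?_
    rcases ha with ⟨h1, h2⟩ | h1
    · exact Or.inl ⟨h1, by rw [h2]; exact ((h.ctrl s hs).lin.bdry1 s (h.ctrl s hs).mem x).1⟩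
    · exact Or.inr h1
  · intro s hs x
    refine side s hs x b (right_mem_Icc.2 hle) ?_
    rcases hb with ⟨h1, h2⟩ | h1
    · exact Or.inl ⟨h1, by rw [h2]; exact ((h.ctrl s hs).lin.bdry1 s (h.ctrl s hs).mem x).2⟩
    · exact Or.inr h1
  · intro s hs x y hy
    obtain ⟨hy1, hη0, hη1⟩ := hab y hy
    have h1 := sign_mul_le hσ (h.transport_le (x := x) hs hy1)
    have hw := (h.ctrl s hs).w_le x hy1
    have hw2 : |v.2.1 s x y| ≤ r / 2 := hw.trans (by linarith [h.e_le])
    have hς2 : ς * ς = 1 := by rcases hς with rfl | rfl <;> norm_num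
    set η := 1 + ς * y with hη
    have b1 : (dY (barrier M r ς)).1 s x y = ς * (2 * M / r ^ 2 * (r - η)) := by
      simp [barrier, hη]; ring
    have b2 : (dY (dY (barrier M r ς))).1 s x y = -(2 * M / r ^ 2) := by
      simp [barrier]
      linear_combination (-(2 * M / r ^ 2)) * hς2
    have b3 : dX (barrier M r ς) = 0 := by simp [barrier]
    have b4 : dT (barrier M r ς) = 0 := by simp [barrier]
    have k1 : |v.2.1 s x y * (dY (barrier M r ς)).1 s x y| ≤ M := by
      rw [b1, abs_mul, abs_mul]
      have a1 : |ς| = 1 := by rcases hς with rfl | rfl <;> simp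
      rw [a1, one_mul, abs_of_nonneg (a := 2 * M / r ^ 2 * (r - η))
        (mul_nonneg (by positivity) (by linarith))]
      calc |v.2.1 s x y| * (2 * M / r ^ 2 * (r - η)) ≤ r / 2 * (2 * M / r ^ 2 * r) := by
            refine mul_le_mul hw2 (mul_le_mul_of_nonneg_left (by linarith) (by positivity))
              (mul_nonneg (by positivity) (by linarith)) (by positivity)
        _ = M := by field_simp
    have k2 : ν * (dY (dY (barrier M r ς))).1 s x y = -(2 * M) := by
      rw [b2, hν]; field_simp
    have k3 := (abs_le.1 k1).1
    simp only [dT_sub, dX_sub, dY_sub, dT_smul, dX_smul, dY_smul, b3, b4, dX_zero, add_app, sub_app,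
      mul_app, smul_app, zero_app] at h1 ⊢
    linarith

theorem wall_left_le (h : Run ν T v p f τ e) {t x : ℝ} (ht : t ∈ Icc (0 : ℝ) τ) :
    |(dY v.1).1 t x (-1)| ≤ 2 * (6000 * (1 + τ) * e) / √ν := by
  have hr := h.sqrt_pos
  have hr1 := h.sqrt_le
  refine abs_le_of_sign fun σ hσ => ?_
  set M := 6000 * (1 + τ) * e
  have key := h.barrier_le (ς := 1) (a := -1) (b := -1 + √ν) (Or.inl rfl)
    (fun y hy => ⟨⟨hy.1, by linarith [hy.2]⟩, by linarith [hy.1], by linarith [hy.2]⟩)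
    (Or.inl ⟨by norm_num, rfl⟩) (Or.inr (by ring)) (by linarith) hσ t ht x
  have b0 : (σ • v.1 - barrier M (√ν) 1).1 t x (-1) = 0 := by
    have := ((h.ctrl t ht).lin.bdry1 t (h.ctrl t ht).mem x).1
    simp [barrier, this]
  have d := deriv_nonpos_of_le_right (z := -1) (a := -1 + √ν) (by linarith)
    (hasDerivAt_y (σ • v.1 - barrier M (√ν) 1) t x (-1))
    (fun s hs => by rw [b0]; exact key s hs)
  have b1 : (dY (barrier M (√ν) 1)).1 t x (-1) = 2 * M / √ν := by
    simp [barrier]; field_simp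
  rw [dY_sub, sub_app, b1, dY_smul, smul_app] at d
  linarith

theorem wall_right_le (h : Run ν T v p f τ e) {t x : ℝ} (ht : t ∈ Icc (0 : ℝ) τ) :
    |(dY v.1).1 t x 1| ≤ 2 * (6000 * (1 + τ) * e) / √ν := by
  have hr := h.sqrt_pos
  have hr1 := h.sqrt_le
  refine abs_le_of_sign fun σ hσ => ?_
  set M := 6000 * (1 + τ) * e
  have hσ' : -σ = 1 ∨ -σ = -1 := by rcases hσ with rfl | rfl <;> simp
  have key := h.barrier_le (ς := -1) (a := 1 - √ν) (b := 1) (Or.inr rfl)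
    (fun y hy => ⟨⟨by linarith [hy.1], hy.2⟩, by linarith [hy.2], by linarith [hy.1]⟩)
    (Or.inr (by ring)) (Or.inl ⟨by norm_num, rfl⟩) (by linarith) hσ' t ht x
  have b0 : ((-σ) • v.1 - barrier M (√ν) (-1)).1 t x 1 = 0 := by
    have := ((h.ctrl t ht).lin.bdry1 t (h.ctrl t ht).mem x).2
    simp [barrier, this]
  have d := deriv_nonneg_of_le_left (z := 1) (a := 1 - √ν) (by linarith)
    (hasDerivAt_y ((-σ) • v.1 - barrier M (√ν) (-1)) t x 1)
    (fun s hs => by rw [b0]; exact key s hs)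
  have b1 : (dY (barrier M (√ν) (-1))).1 t x 1 = -(2 * M / √ν) := by
    simp [barrier]; field_simp
  rw [dY_sub, sub_app, b1, dY_smul, smul_app] at d
  linarith

theorem vorticity_le (h : Run ν T v p f τ e) {t x y : ℝ} (ht : t ∈ Icc (0 : ℝ) τ)
    (hy : y ∈ Icc (-1 : ℝ) 1) :
    |(dX v.2 - dY v.1).1 t x y| ≤ 3 * (6000 * (1 + τ) * e) / √ν := by
  have he := h.e_pos
  have hτ := h.τ_nonneg
  have hr := h.sqrt_pos
  have hr1 := h.sqrt_le
  have wl := fun s hs x => h.wall_left_le (t := s) (x := x) hs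
  have wr := fun s hs x => h.wall_right_le (t := s) (x := x) hs
  set M := 6000 * (1 + τ) * e with hM
  set K := M / √ν with hK
  have hMe : 6000 * e ≤ M := by nlinarith
  have hKM : M ≤ K := by rw [hK, le_div_iff₀ hr]; nlinarith
  have hMτ : 3 * e * τ ≤ M := by nlinarith [mul_nonneg he.le hτ]
  have e2 : ∀ c : ℝ, c * M / √ν = c * K := fun c => by rw [hK]; ring
  rw [e2] at wl wr ⊢
  refine abs_le_of_sign fun σ hσ => ?_
  set ω := dX v.2 - dY v.1 with hω
  set g : Fld := σ • ω - (2 * K) • (1 : Fld) - (3 * e) • tF with hg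
  have key := max_principle (h := g) (u₁ := yF + v.1) (u₂ := v.2) (a := -1) (b := 1) (T := τ)
    h.ctrl_zero.ν_pos.le
    (fun x y hy => by
      obtain ⟨i1, i2⟩ := h.init x y hy
      have h1 : |ω.1 0 x y| ≤ 2 * e := by
        rw [hω, sub_app]
        exact (abs_sub _ _).trans (by linarith)
      have h2 := sign_mul_le hσ h1
      simp only [hg, sub_app, smul_app, one_app, tF_app]
      linarith)
    (fun s hs x => by
      have h1 := ((h.ctrl s hs).lin.bdry2.dX s (h.ctrl s hs).mem x).1
      have h2 : |ω.1 s x (-1)| ≤ 2 * K := by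
        rw [hω, sub_app, h1, zero_sub, abs_neg]; exact wl s hs x
      have h2 := sign_mul_le hσ h2
      simp only [hg, sub_app, smul_app, one_app, tF_app]
      nlinarith [hs.1])
    (fun s hs x => by
      have h1 := ((h.ctrl s hs).lin.bdry2.dX s (h.ctrl s hs).mem x).2
      have h2 : |ω.1 s x 1| ≤ 2 * K := by
        rw [hω, sub_app, h1, zero_sub, abs_neg]; exact wr s hs x
      have h2 := sign_mul_le hσ h2
      simp only [hg, sub_app, smul_app, one_app, tF_app]
      nlinarith [hs.1])
    (fun s hs x y hy => by
      have hc := h.ctrl s hs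
      have m1 := hc.lin.mom1.dY s hc.mem x y hy
      have m2 := hc.lin.mom2.dX s hc.mem x y hy
      have d := hc.lin.div s hc.mem x y hy
      obtain ⟨-, f1, f2⟩ := h.force s hs x y hy
      have h1 : |(dX f.2).1 s x y - (dY f.1).1 s x y| ≤ 2 * e :=
        (abs_sub _ _).trans (by linarith)
      have h2 := sign_mul_le hσ h1
      simp at m1 m2 d
      have e1 : (dT g + (yF + v.1) * dX g + v.2 * dY g - ν • (dX (dX g) + dY (dY g))).1 s x y
          = σ * ((dX f.2).1 s x y - (dY f.1).1 s x y) - 3 * e := by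
        simp [hg, hω]
        linear_combination σ * m2 - σ * m1
          - σ * ((dX v.2).1 s x y - (dY v.1).1 s x y - 1) * d
      rw [e1]
      linarith)
    t ht x y hy
  simp only [hg, sub_app, smul_app, one_app, tF_app] at key
  nlinarith [ht.1, ht.2]

end Run

/-! ### The continuity argument -/

namespace Run

variable {ν T τ e : ℝ} {v f : VF} {p : Fld}

theorem grad_le (h : Run ν T v p f τ e) {t x y : ℝ} (ht : t ∈ Icc (0 : ℝ) τ)
    (hy : y ∈ Icc (-1 : ℝ) 1) :
    |(dX v.1).1 t x y| ≤ 24000 * (1 + τ) * e / √ν ∧ |(dY v.1).1 t x y| ≤ 24000 * (1 + τ) * e / √ν ∧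
    |(dX v.2).1 t x y| ≤ 24000 * (1 + τ) * e / √ν ∧
    |(dY v.2).1 t x y| ≤ 24000 * (1 + τ) * e / √ν := by
  have he := h.e_pos
  have hτ := h.τ_nonneg
  have hr := h.sqrt_pos
  have hr1 := h.sqrt_le
  have hc := h.ctrl t ht
  have h1 := hc.v_x_le x hy
  have h2 := hc.w_y_le x hy
  have h3 := hc.w_x_le x hy
  have h4 := h.vorticity_le (x := x) ht hy
  have hK : e ≤ e / √ν := by rw [le_div_iff₀ hr]; nlinarith
  have e1 : 24000 * (1 + τ) * e / √ν = 24000 * (1 + τ) * (e / √ν) := by ring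
  have e2 : 3 * (6000 * (1 + τ) * e) / √ν = 18000 * (1 + τ) * (e / √ν) := by ring
  have e3 : 90 * e / √ν = 90 * (e / √ν) := by ring
  rw [e1]
  rw [e2] at h4
  rw [e3] at h1 h2
  set K := e / √ν
  have hK0 : 0 < K := he.trans_le hK
  have hτK : 0 ≤ τ * K := by positivity
  rw [sub_app] at h4
  have h5 : |(dY v.1).1 t x y| ≤ |(dX v.2).1 t x y| + |(dX v.2).1 t x y - (dY v.1).1 t x y| := by
    have := abs_sub ((dX v.2).1 t x y) ((dX v.2).1 t x y - (dY v.1).1 t x y)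
    rwa [sub_sub_cancel] at this
  refine ⟨?_, ?_, ?_, ?_⟩ <;> nlinarith

end Run

/-- Data for the continuity argument. -/
structure Start (ν T : ℝ) (v : VF) (p : Fld) (f : VF) (A e : ℝ) : Prop where
  lin : Lin ν T v v p f
  T_pos : 0 < T
  ν_pos : 0 < ν
  ν_le : ν ≤ 1
  A_nonneg : 0 ≤ A
  e_pos : 0 < e
  e_le : 48000 * (1 + T) * e ≤ √ν
  growth : Real.exp (1600 * T) * (En v 0 + T * A) ≤ e ^ 2
  enf : ∀ t ∈ Icc (0 : ℝ) T, En f t ≤ A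
  A_le : A ≤ e ^ 2
  force : ∀ t ∈ Icc (0 : ℝ) T, ∀ x, ∀ y ∈ Icc (-1 : ℝ) 1,
    |f.1.1 t x y| ≤ e ∧ |(dX f.2).1 t x y| ≤ e ∧ |(dY f.1).1 t x y| ≤ e
  init : ∀ x, ∀ y ∈ Icc (-1 : ℝ) 1, |(dX v.1).1 0 x y| ≤ e ∧ |(dY v.1).1 0 x y| ≤ e ∧
    |(dX v.2).1 0 x y| ≤ e ∧ |(dY v.2).1 0 x y| ≤ e

theorem eventually_abs_lt {F : Fld} {t c : ℝ} (h : ∀ x, ∀ y ∈ Icc (-1 : ℝ) 1, |F.1 t x y| < c) :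
    ∀ᶠ s in 𝓝 t, ∀ x, ∀ y ∈ Icc (-1 : ℝ) 1, |F.1 s x y| ≤ c := by
  have hK : IsCompact (Icc (0 : ℝ) (2 * Real.pi) ×ˢ Icc (-1 : ℝ) 1) :=
    isCompact_Icc.prod isCompact_Icc
  have hc : Continuous fun q : ℝ × ℝ × ℝ => |F.1 q.1 q.2.1 q.2.2| := (continuous_unc F).abs
  have key := hK.eventually_forall_of_forall_eventually (x₀ := t)
    (P := fun s q => |F.1 s q.1 q.2| < c) fun q hq => by
      exact hc.continuousAt.eventually_lt continuousAt_const (h q.1 q.2 hq.2)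
  filter_upwards [key] with s hs x y hy
  have hper : Function.Periodic (fun z => F.1 s z y) (2 * Real.pi) := fun z => periodic F s z y
  obtain ⟨z, hz, he⟩ := hper.exists_mem_Ico₀ (by positivity) x
  exact (congrArg abs he).trans_le (hs (z, y) ⟨⟨hz.1, hz.2.le⟩, hy⟩).le

theorem Small.eventually {ν t : ℝ} {v : VF} (hE : En v t < ν)
    (h : ∀ x, ∀ y ∈ Icc (-1 : ℝ) 1, |(dX v.1).1 t x y| < 1 ∧ |(dY v.1).1 t x y| < 1 ∧
      |(dX v.2).1 t x y| < 1 ∧ |(dY v.2).1 t x y| < 1) : ∀ᶠ s in 𝓝 t, Small ν v s := by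
  filter_upwards [(continuous_En v).continuousAt.eventually_lt continuousAt_const hE,
    eventually_abs_lt fun x y hy => (h x y hy).1, eventually_abs_lt fun x y hy => (h x y hy).2.1,
    eventually_abs_lt fun x y hy => (h x y hy).2.2.1,
    eventually_abs_lt fun x y hy => (h x y hy).2.2.2] with s h0 h1 h2 h3 h4
  exact ⟨h0.le, fun x y hy => ⟨h1 x y hy, h2 x y hy, h3 x y hy, h4 x y hy⟩⟩

theorem isClosed_small (ν : ℝ) (v : VF) : IsClosed {t | Small ν v t} := by
  have hc : ∀ (F : Fld) (x y : ℝ), Continuous fun t => |F.1 t x y| := fun F x y =>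
    (F.cont continuous_id continuous_const continuous_const).abs
  have e : {t | Small ν v t} = {t | En v t ≤ ν} ∩ {t | ∀ x, ∀ y ∈ Icc (-1 : ℝ) 1,
      |(dX v.1).1 t x y| ≤ 1 ∧ |(dY v.1).1 t x y| ≤ 1 ∧
      |(dX v.2).1 t x y| ≤ 1 ∧ |(dY v.2).1 t x y| ≤ 1} :=
    ext fun t => ⟨fun h => ⟨h.energy, h.grad⟩, fun h => ⟨h.1, h.2⟩⟩
  rw [e]
  refine (isClosed_le (continuous_En v) continuous_const).inter ?_
  simp only [Set.ofPred_forall]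
  refine isClosed_iInter fun x => isClosed_iInter fun y => isClosed_iInter fun _ => ?_
  exact (isClosed_le (hc _ x y) continuous_const).inter
    ((isClosed_le (hc _ x y) continuous_const).inter
    ((isClosed_le (hc _ x y) continuous_const).inter (isClosed_le (hc _ x y) continuous_const)))

namespace Start

variable {ν T A e : ℝ} {v f : VF} {p : Fld}

theorem e_sq_lt (h : Start ν T v p f A e) : e ^ 2 < ν := by
  have he := h.e_pos
  have hT := h.T_pos
  have h1 := h.e_le
  have h2 : e < √ν := by nlinarith [mul_pos hT he]
  nlinarith [Real.sq_sqrt h.ν_pos.le]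

theorem En_le_sq (h : Start ν T v p f A e) {t : ℝ} (ht : t ∈ Icc (0 : ℝ) T)
    (hs : ∀ s ∈ Icc (0 : ℝ) t, Small ν v s) : En v t ≤ e ^ 2 := by
  have h0 : 0 ≤ En v 0 := (I_dot_self_nonneg v 0).trans (I_dot_le_En v 0).1
  have h1 := h.lin.En_le h.T_pos h.ν_pos.le ht hs h.A_nonneg
    fun s hs => h.enf s ⟨hs.1, hs.2.trans ht.2⟩
  refine h1.trans (le_trans ?_ h.growth)
  have hA := h.A_nonneg
  have := ht.1
  have := ht.2
  gcongr

theorem run (h : Start ν T v p f A e) {τ : ℝ} (hτ : τ ∈ Icc (0 : ℝ) T)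
    (hs : ∀ s ∈ Icc (0 : ℝ) τ, Small ν v s) : Run ν T v p f τ e where
  ctrl t ht := by
    have hm : t ∈ Icc (0 : ℝ) T := ⟨ht.1, ht.2.trans hτ.2⟩
    exact ⟨h.lin, hm, hs t ht, h.ν_pos, h.ν_le, h.e_pos.le,
      h.En_le_sq hm fun s hs' => hs s ⟨hs'.1, hs'.2.trans ht.2⟩, (h.enf t hm).trans h.A_le⟩
  τ_nonneg := hτ.1
  e_pos := h.e_pos
  e_le := by nlinarith [h.e_le, mul_pos h.T_pos h.e_pos, h.e_pos]
  force t ht := h.force t ⟨ht.1, ht.2.trans hτ.2⟩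
  init x y hy := ⟨(h.init x y hy).2.2.1, (h.init x y hy).2.1⟩

theorem eventually_small (h : Start ν T v p f A e) {τ : ℝ} (hτ : τ ∈ Icc (0 : ℝ) T)
    (hs : ∀ s ∈ Icc (0 : ℝ) τ, Small ν v s) : ∀ᶠ s in 𝓝 τ, Small ν v s := by
  refine Small.eventually ((h.En_le_sq hτ hs).trans_lt h.e_sq_lt) fun x y hy => ?_
  have hr := Real.sqrt_pos.2 h.ν_pos
  have hlt : 24000 * (1 + τ) * e / √ν < 1 := by
    rw [div_lt_one hr]
    nlinarith [h.e_le, mul_pos h.T_pos h.e_pos, h.e_pos, mul_le_mul_of_nonneg_right hτ.2 h.e_pos.le]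
  obtain ⟨h1, h2, h3, h4⟩ := (h.run hτ hs).grad_le (x := x) (right_mem_Icc.2 hτ.1) hy
  exact ⟨h1.trans_lt hlt, h2.trans_lt hlt, h3.trans_lt hlt, h4.trans_lt hlt⟩

theorem small_zero (h : Start ν T v p f A e) : Small ν v 0 := by
  have he := h.e_pos
  have hT := h.T_pos
  have hle : e ≤ 1 := by
    have : √ν ≤ 1 := Real.sqrt_le_one.2 h.ν_le
    nlinarith [h.e_le, mul_pos hT he]
  refine ⟨le_trans ?_ (h.growth.trans h.e_sq_lt.le), fun x y hy => ?_⟩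
  · have h0 : 0 ≤ En v 0 := (I_dot_self_nonneg v 0).trans (I_dot_le_En v 0).1
    have h1 : 1 ≤ Real.exp (1600 * T) := Real.one_le_exp (by positivity)
    have h2 := mul_nonneg hT.le h.A_nonneg
    nlinarith
  · obtain ⟨h1, h2, h3, h4⟩ := h.init x y hy
    exact ⟨h1.trans hle, h2.trans hle, h3.trans hle, h4.trans hle⟩

theorem small (h : Start ν T v p f A e) : ∀ t ∈ Icc (0 : ℝ) T, Small ν v t := by
  set S : Set ℝ := {t | ∀ s ∈ Icc (0 : ℝ) t, Small ν v s} with hS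
  have hcl : IsClosed (S ∩ Icc 0 T) := by
    refine isClosed_of_closure_subset fun t ht => ?_
    have htT : t ∈ Icc 0 T := isClosed_Icc.closure_subset_iff.2 inter_subset_right ht
    refine ⟨fun s hs => ?_, htT⟩
    rcases hs.2.eq_or_lt with rfl | hlt
    · refine (isClosed_small ν v).closure_subset_iff.2 ?_ ht
      exact fun z hz => hz.1 z (right_mem_Icc.2 hz.2.1)
    · obtain ⟨z, hz, hz'⟩ := mem_closure_iff.1 ht (Ioi s) isOpen_Ioi hlt
      exact hz'.1 s ⟨hs.1, hz.le⟩
  have key : Icc 0 T ⊆ S := by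
    refine hcl.Icc_subset_of_forall_exists_gt ?_ fun t ht z hz => ?_
    · intro s hs
      rw [le_antisymm hs.2 hs.1]
      exact h.small_zero
    · obtain ⟨δ, hδ, hball⟩ := Metric.eventually_nhds_iff.1
        (h.eventually_small ⟨ht.2.1, ht.2.2.le⟩ ht.1)
      have hz' : t < z := hz
      refine ⟨min z (t + δ / 2), fun s hs => ?_, lt_min hz' (by linarith), min_le_left _ _⟩
      rcases le_or_gt s t with h1 | h1
      · exact ht.1 s ⟨hs.1, h1⟩
      · refine hball ?_
        have := hs.2.trans (min_le_right _ _)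
        rw [Real.dist_eq, abs_of_pos (by linarith)]
        linarith
  exact fun t ht => key ht t (right_mem_Icc.2 ht.1)

theorem run_top (h : Start ν T v p f A e) : Run ν T v p f T e :=
  h.run (right_mem_Icc.2 h.T_pos.le) h.small

end Start

/-! ### Pointwise bounds on derivatives -/

/-- All space derivatives of `F` of order at most `k` are bounded by `c` at time `t`. -/
def Reg (t : ℝ) : ℕ → ℝ → Fld → Prop
  | 0, c, F => ∀ x, ∀ y ∈ Icc (-1 : ℝ) 1, |F.1 t x y| ≤ c
  | k + 1, c, F => (∀ x, ∀ y ∈ Icc (-1 : ℝ) 1, |F.1 t x y| ≤ c) ∧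
      Reg t k c (dX F) ∧ Reg t k c (dY F)

namespace Reg

variable {t c d : ℝ} {k : ℕ} {F G : Fld}

theorem bound (h : Reg t k c F) (x : ℝ) {y : ℝ} (hy : y ∈ Icc (-1 : ℝ) 1) : |F.1 t x y| ≤ c := by
  cases k with
  | zero => exact h x y hy
  | succ k => exact h.1 x y hy

theorem nonneg (h : Reg t k c F) : 0 ≤ c :=
  (abs_nonneg _).trans (h.bound 0 (y := 0) (by norm_num))

protected theorem dX (h : Reg t (k + 1) c F) : Reg t k c (dX F) := h.2.1

protected theorem dY (h : Reg t (k + 1) c F) : Reg t k c (dY F) := h.2.2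

theorem mono (h : Reg t k c F) (hcd : c ≤ d) : Reg t k d F := by
  induction k generalizing F with
  | zero => exact fun x y hy => (h x y hy).trans hcd
  | succ k ih => exact ⟨fun x y hy => (h.1 x y hy).trans hcd, ih h.2.1, ih h.2.2⟩

theorem pred (h : Reg t (k + 1) c F) : Reg t k c F := by
  induction k generalizing F with
  | zero => exact h.1
  | succ k ih => exact ⟨h.1, ih h.2.1, ih h.2.2⟩

theorem add (hF : Reg t k c F) (hG : Reg t k d G) : Reg t k (c + d) (F + G) := by
  have hb : ∀ x, ∀ y ∈ Icc (-1 : ℝ) 1, |(F + G).1 t x y| ≤ c + d := fun x y hy =>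
    (abs_add_le _ _).trans (add_le_add (hF.bound x hy) (hG.bound x hy))
  induction k generalizing F G with
  | zero => exact hb
  | succ k ih =>
    refine ⟨hb, ?_, ?_⟩
    · rw [dX_add]
      exact ih hF.dX hG.dX fun x y hy =>
        (abs_add_le _ _).trans (add_le_add (hF.dX.bound x hy) (hG.dX.bound x hy))
    · rw [dY_add]
      exact ih hF.dY hG.dY fun x y hy =>
        (abs_add_le _ _).trans (add_le_add (hF.dY.bound x hy) (hG.dY.bound x hy))

theorem neg (hF : Reg t k c F) : Reg t k c (-F) := by
  induction k generalizing F with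
  | zero => exact fun x y hy => (abs_neg _).trans_le (hF x y hy)
  | succ k ih =>
    refine ⟨fun x y hy => (abs_neg _).trans_le (hF.1 x y hy), ?_, ?_⟩
    · rw [dX_neg]; exact ih hF.dX
    · rw [dY_neg]; exact ih hF.dY

theorem sub (hF : Reg t k c F) (hG : Reg t k d G) : Reg t k (c + d) (F - G) := by
  rw [sub_eq_add_neg]; exact hF.add hG.neg

theorem mul (hF : Reg t k c F) (hG : Reg t k d G) : Reg t k (2 ^ k * (c * d)) (F * G) := by
  have hc := hF.nonneg
  have hd := hG.nonneg
  induction k generalizing F G with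
  | zero =>
    intro x y hy
    rw [pow_zero, one_mul, mul_app, abs_mul]
    exact mul_le_mul (hF x y hy) (hG x y hy) (abs_nonneg _) hc
  | succ k ih =>
    have e : (2 : ℝ) ^ (k + 1) * (c * d) = 2 ^ k * (c * d) + 2 ^ k * (c * d) := by ring
    refine ⟨fun x y hy => ?_, ?_, ?_⟩
    · rw [mul_app, abs_mul]
      refine (mul_le_mul (hF.1 x y hy) (hG.1 x y hy) (abs_nonneg _) hc).trans ?_
      exact le_mul_of_one_le_left (mul_nonneg hc hd) (one_le_pow₀ (by norm_num))
    · rw [dX_mul, e]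
      exact (ih hF.dX hG.pred).add (ih hF.pred hG.dX)
    · rw [dY_mul, e]
      exact (ih hF.dY hG.pred).add (ih hF.pred hG.dY)

/-- Sobolev embedding. -/
theorem of_sobolev (hc : 0 ≤ c)
    (h : ∀ a b, a + b ≤ k + 2 → I (dX^[a] (dY^[b] F) * dX^[a] (dY^[b] F)) t ≤ c ^ 2) :
    Reg t k (4 * c) F := by
  have hb : ∀ x, ∀ y ∈ Icc (-1 : ℝ) 1, |F.1 t x y| ≤ 4 * c := fun x y hy =>
    abs_le_of_sobolev hc (h 0 0 (by omega)) (h 1 0 (by omega)) (h 0 1 (by omega))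
      (h 1 1 (by omega)) hy
  induction k generalizing F with
  | zero => exact hb
  | succ k ih =>
    have hX : ∀ a b, a + b ≤ k + 2 →
        I (dX^[a] (dY^[b] (dX F)) * dX^[a] (dY^[b] (dX F))) t ≤ c ^ 2 := fun a b hab => by
      have hcomm : Function.Commute dY dX := dY_dX
      rw [(hcomm.iterate_left b).eq F, ← Function.iterate_succ_apply dX a]
      exact h (a + 1) b (by omega)
    have hY : ∀ a b, a + b ≤ k + 2 →
        I (dX^[a] (dY^[b] (dY F)) * dX^[a] (dY^[b] (dY F))) t ≤ c ^ 2 := fun a b hab => by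
      rw [← Function.iterate_succ_apply dY b]
      exact h a (b + 1) (by omega)
    exact ⟨hb, ih hX fun x y hy => abs_le_of_sobolev hc (hX 0 0 (by omega)) (hX 1 0 (by omega))
      (hX 0 1 (by omega)) (hX 1 1 (by omega)) hy, ih hY fun x y hy =>
      abs_le_of_sobolev hc (hY 0 0 (by omega)) (hY 1 0 (by omega)) (hY 0 1 (by omega))
      (hY 1 1 (by omega)) hy⟩

end Reg

/-- All space derivatives of `V` of order at most `k` are bounded by `c` at time `t`. -/
def RegV (t : ℝ) (k : ℕ) (c : ℝ) (V : VF) : Prop := Reg t k c V.1 ∧ Reg t k c V.2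

namespace RegV

variable {t c d g ν : ℝ} {k : ℕ} {V W G v : VF}

theorem mono (h : RegV t k c V) (hcd : c ≤ d) : RegV t k d V := ⟨h.1.mono hcd, h.2.mono hcd⟩

theorem pred (h : RegV t (k + 1) c V) : RegV t k c V := ⟨h.1.pred, h.2.pred⟩

theorem zero (h : RegV t k c V) : RegV t 0 c V :=
  ⟨fun x _ hy => h.1.bound x hy, fun x _ hy => h.2.bound x hy⟩

protected theorem vX (h : RegV t (k + 1) c V) : RegV t k c (vX V) := ⟨h.1.dX, h.2.dX⟩

theorem sub (h : RegV t k c V) (h' : RegV t k d W) : RegV t k (c + d) (V - W) :=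
  ⟨h.1.sub h'.1, h.2.sub h'.2⟩

protected theorem adv (h : RegV t k c V) (h' : RegV t (k + 1) d W) :
    RegV t k (2 ^ k * (c * d) + 2 ^ k * (c * d)) (adv V W) :=
  ⟨(h.1.mul h'.1.dX).add (h.2.mul h'.1.dY), (h.1.mul h'.2.dX).add (h.2.mul h'.2.dY)⟩

protected theorem rhs (hν : ν ∈ Icc (0 : ℝ) 1) (hv : RegV t 0 1 v) (hV : RegV t 2 c V)
    (hG : RegV t 0 g G) : RegV t 0 (g + 6 * c) (rhs ν v V G) := by
  have hc := hV.1.nonneg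
  have key : ∀ {a₁ a₂ b b' X Y L y}, |a₁| ≤ 1 → |a₂| ≤ 1 → |X| ≤ c → |Y| ≤ c → |b| ≤ g → |b'| ≤ c →
      |L| ≤ 2 * c → |y| ≤ 1 → |b - (y + a₁) * X - a₂ * Y - b' + ν * L| ≤ g + 6 * c := by
    intro a₁ a₂ b b' X Y L y h1 h2 h3 h4 h5 h6 h7 h8
    have e1 : |(y + a₁) * X| ≤ 2 * c := by
      rw [abs_mul]
      exact mul_le_mul ((abs_add_le _ _).trans (by linarith)) h3 (abs_nonneg _) (by norm_num)
    have e2 : |a₂ * Y| ≤ c := by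
      rw [abs_mul]
      exact (mul_le_mul h2 h4 (abs_nonneg _) (by norm_num)).trans_eq (one_mul _)
    have e3 : |ν * L| ≤ 2 * c := by
      rw [abs_mul, abs_of_nonneg hν.1]
      exact (mul_le_mul hν.2 h7 (abs_nonneg _) (by norm_num)).trans_eq (one_mul _)
    rw [abs_le] at *
    constructor <;> linarith
  refine ⟨fun x y hy => ?_, fun x y hy => ?_⟩
  · refine key (hv.1.bound x hy) (hv.2.bound x hy) (hV.1.dX.bound x hy) (hV.1.dY.bound x hy)
      (hG.1.bound x hy) (hV.2.bound x hy) ?_ (abs_le.2 hy)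
    exact ((hV.1.dX.dX).add (hV.1.dY.dY)).bound x hy |>.trans_eq (by ring)
  · have := key (b' := 0) (hv.1.bound x hy) (hv.2.bound x hy) (hV.2.dX.bound x hy)
      (hV.2.dY.bound x hy) (hG.2.bound x hy) (by simpa using hc)
      (((hV.2.dX.dX).add (hV.2.dY.dY)).bound x hy |>.trans_eq (by ring)) (abs_le.2 hy)
    rwa [sub_zero] at this

theorem I_dot_le (h : RegV t k c V) : I (dot V V) t ≤ 26 * c ^ 2 := by
  have hc := h.1.nonneg
  have h1 : I (dot V V) t ≤ I ((2 * c ^ 2) • (1 : Fld)) t := I_mono fun x y hy => by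
    have e1 := abs_le.1 (h.1.bound x hy)
    have e2 := abs_le.1 (h.2.bound x hy)
    simp only [dot, add_app, mul_app, smul_app, one_app]
    nlinarith
  rw [I_smul, I_one] at h1
  nlinarith [Real.pi_lt_d2, sq_nonneg c]

end RegV

/-- The energy of a field whose derivatives are bounded by `c`. -/
theorem En_le_of_regV {t c : ℝ} {f : VF} (h : RegV t 3 c f) (hT : RegV t 2 c (vT f)) :
    En f t ≤ 182 * c ^ 2 := by
  have e1 : vT (vX f) = vX (vT f) := (vX_vT f).symm
  have e2 : vT (vX (vX f)) = vX (vX (vT f)) := by rw [← vX_vT, e1]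
  rw [En, e2, e1]
  linarith [h.I_dot_le, h.vX.I_dot_le, h.vX.vX.I_dot_le, h.vX.vX.vX.I_dot_le, hT.I_dot_le,
    hT.vX.I_dot_le, hT.vX.vX.I_dot_le]

/-- The initial energy, with time derivatives recovered from the equation. -/
theorem Lin.En_zero_le {ν T c : ℝ} {v f : VF} {p : Fld} (hT : 0 < T) (hν : ν ∈ Icc (0 : ℝ) 1)
    (h : Lin ν T v v p f) (hc : c ≤ 1) (hv : RegV 0 4 c v) (hf : RegV 0 3 c f) :
    En v 0 ≤ 80000 * c ^ 2 := by
  have hc0 := hv.1.nonneg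
  have hcc : c * c ≤ c := mul_le_of_le_one_left hc0 hc
  have h0 : (0 : ℝ) ∈ Icc 0 T := left_mem_Icc.2 hT.le
  have hv1 : RegV 0 0 1 v := hv.zero.mono hc
  have r1 := RegV.rhs hν hv1 hv.pred.pred hf.zero
  have a1 : RegV 0 2 (17 * c) (vX f - adv (vX v) v) :=
    (hf.vX.sub (hv.vX.adv hv).pred).mono (by linarith)
  have r2 := RegV.rhs hν hv1 hv.vX.pred a1.zero
  have a2 : RegV 0 1 (25 * c) (vX (vX f - adv (vX v) v) - adv (vX v) (vX v)) :=
    (a1.vX.sub (hv.vX.pred.adv hv.vX).pred).mono (by linarith)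
  have r3 := RegV.rhs hν hv1 hv.vX.vX a2.zero
  have t1 := (h.vT_le hT h0).trans r1.I_dot_le
  have t2 := (h.vX.vT_le hT h0).trans r2.I_dot_le
  have t3 := (h.vX.vX.vT_le hT h0).trans r3.I_dot_le
  rw [En]
  nlinarith [hv.I_dot_le, hv.vX.I_dot_le, hv.vX.vX.I_dot_le, hv.vX.vX.vX.I_dot_le]

section

/-! ### Passage to the differential algebra -/

theorem pdx_eq (F : Fld) (t : ℝ) : pdx (F.1 t) = (dX F).1 t :=
  funext fun x => funext fun y => (hasDerivAt_x F t x y).deriv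

theorem pdy_eq (F : Fld) (t : ℝ) : pdy (F.1 t) = (dY F).1 t :=
  funext fun x => funext fun y => (hasDerivAt_y F t x y).deriv

theorem iterate_pdx_pdy_eq (F : Fld) (t : ℝ) (a b : ℕ) :
    pdx^[a] (pdy^[b] (F.1 t)) = (dX^[a] (dY^[b] F)).1 t := by
  have hX : Function.Semiconj (fun G : Fld => G.1 t) dX pdx := fun G => (pdx_eq G t).symm
  have hY : Function.Semiconj (fun G : Fld => G.1 t) dY pdy := fun G => (pdy_eq G t).symm
  exact ((congrArg pdx^[a] ((hY.iterate_right b).eq F).symm).trans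
    ((hX.iterate_right a).eq _).symm)

theorem sqL2_eq (F : Fld) (t : ℝ) : sqL2 (F.1 t) = I (F * F) t := by
  simp only [sqL2, I, mul_app, sq]

theorem sqL2_nonneg (g : ℝ → ℝ → ℝ) : 0 ≤ sqL2 g :=
  integral_nonneg (by positivity) fun _ _ => integral_nonneg (by norm_num) fun _ _ => sq_nonneg _

theorem sobSq_nonneg (s : ℕ) (g : ℝ → ℝ → ℝ) : 0 ≤ sobSq s g :=
  Finset.sum_nonneg fun _ _ => Finset.sum_nonneg fun _ _ => sqL2_nonneg _

theorem sqL2_le_sobSq (g : ℝ → ℝ → ℝ) {s a b : ℕ} (hab : a + b ≤ s) :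
    sqL2 (pdx^[a] (pdy^[b] g)) ≤ sobSq s g := by
  refine le_trans ?_ (Finset.single_le_sum (f := fun a => ∑ b ∈ Finset.range (s + 1 - a),
    sqL2 (pdx^[a] (pdy^[b] g))) (fun _ _ => Finset.sum_nonneg fun _ _ => sqL2_nonneg _)
    (Finset.mem_range.2 (by omega : a < s + 1)))
  exact Finset.single_le_sum (f := fun b => sqL2 (pdx^[a] (pdy^[b] g)))
    (fun _ _ => sqL2_nonneg _) (Finset.mem_range.2 (by omega : b < s + 1 - a))

theorem RegV.of_HsNorm {V : VF} {t c : ℝ} {s k : ℕ} {w : ℝ → ℝ → ℝ × ℝ} (hks : k + 2 ≤ s)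
    (hw : ∀ x y, w x y = (V.1.1 t x y, V.2.1 t x y)) (h : HsNorm s w ≤ c) :
    RegV t k (4 * c) V := by
  have h1 : c1 w = V.1.1 t := funext fun x => funext fun y => congrArg Prod.fst (hw x y)
  have h2 : c2 w = V.2.1 t := funext fun x => funext fun y => congrArg Prod.snd (hw x y)
  have hc : 0 ≤ c := (Real.sqrt_nonneg _).trans h
  rw [HsNorm, Real.sqrt_le_left hc, h1, h2] at h
  have n1 := sobSq_nonneg s (V.1.1 t)
  have n2 := sobSq_nonneg s (V.2.1 t)
  constructor
  · refine Reg.of_sobolev hc fun a b hab => ?_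
    rw [← sqL2_eq, ← iterate_pdx_pdy_eq]
    linarith [sqL2_le_sobSq (V.1.1 t) (hab.trans hks)]
  · refine Reg.of_sobolev hc fun a b hab => ?_
    rw [← sqL2_eq, ← iterate_pdx_pdy_eq]
    linarith [sqL2_le_sobSq (V.2.1 t) (hab.trans hks)]

/-- A smooth periodic vector field as a pair of fields. -/
def toVF (u : ℝ → ℝ → ℝ → ℝ × ℝ) (hu : SmoothVF u) (hp : PeriodicVF u) : VF :=
  (⟨fun t x y => (u t x y).1, contDiff_fst.comp hu, fun t x y => congrArg Prod.fst (hp t x y)⟩,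
   ⟨fun t x y => (u t x y).2, contDiff_snd.comp hu, fun t x y => congrArg Prod.snd (hp t x y)⟩)

/-- The perturbation of the Couette flow as a pair of fields. -/
def pert (u : ℝ → ℝ → ℝ → ℝ × ℝ) (hu : SmoothVF u) (hp : PeriodicVF u) : VF :=
  ((toVF u hu hp).1 - yF, (toVF u hu hp).2)

variable {u f : ℝ → ℝ → ℝ → ℝ × ℝ} {p : ℝ → ℝ → ℝ → ℝ}

theorem sub_couette_eq (hu : SmoothVF u) (hp : PeriodicVF u) (t x y : ℝ) :
    u t x y - Couette x y = ((pert u hu hp).1.1 t x y, (pert u hu hp).2.1 t x y) :=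
  Prod.ext rfl (sub_zero _)

theorem c1_sub_couette (hu : SmoothVF u) (hp : PeriodicVF u) (t : ℝ) :
    c1 (fun x y => u t x y - Couette x y) = (pert u hu hp).1.1 t := rfl

theorem c2_sub_couette (hu : SmoothVF u) (hp : PeriodicVF u) (t : ℝ) :
    c2 (fun x y => u t x y - Couette x y) = (pert u hu hp).2.1 t :=
  funext fun _ => funext fun _ => sub_zero _

theorem deriv_toVF (hf : SmoothVF f) (hp : PeriodicVF f) (t x y : ℝ) :
    deriv (fun t' => f t' x y) t
      = ((vT (toVF f hf hp)).1.1 t x y, (vT (toVF f hf hp)).2.1 t x y) :=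
  ((hasDerivAt_t (toVF f hf hp).1 t x y).prodMk (hasDerivAt_t (toVF f hf hp).2 t x y)).deriv

theorem lin_of_isNSSol {ν T : ℝ} (hu : SmoothVF u) (hup : PeriodicVF u) (hp : SmoothFn p)
    (hpp : PeriodicFn p) (hf : SmoothVF f) (hfp : PeriodicVF f) (h : IsNSSol ν T u p f)
    (hb : CouetteBC T u) :
    Lin ν T (pert u hu hup) (pert u hu hup) ⟨p, hp, hpp⟩ (toVF f hf hfp) := by
  have key : ∀ t ∈ Icc (0 : ℝ) T, ∀ x : ℝ, ∀ y ∈ Icc (-1 : ℝ) 1, _ := h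
  set U := toVF u hu hup with hU
  set P : Fld := ⟨p, hp, hpp⟩
  have e1 : ∀ t, c1 (u t) = U.1.1 t := fun _ => rfl
  have e2 : ∀ t, c2 (u t) = U.2.1 t := fun _ => rfl
  have e3 : ∀ t, p t = P.1 t := fun _ => rfl
  have e4 : ∀ t x y, deriv (fun t' => (u t' x y).1) t = (dT U.1).1 t x y :=
    fun t x y => (hasDerivAt_t U.1 t x y).deriv
  have e5 : ∀ t x y, deriv (fun t' => (u t' x y).2) t = (dT U.2).1 t x y :=
    fun t x y => (hasDerivAt_t U.2 t x y).deriv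
  have e6 : ∀ t x y, (f t x y).1 = (toVF f hf hfp).1.1 t x y := fun _ _ _ => rfl
  have e7 : ∀ t x y, (f t x y).2 = (toVF f hf hfp).2.1 t x y := fun _ _ _ => rfl
  simp only [e1, e2, e3, e4, e5, e6, e7, pdx_eq, pdy_eq] at key
  refine ⟨fun t ht x y hy => ?_, fun t ht x y hy => ?_, fun t ht x y hy => ?_, fun t ht x => ?_,
    fun t ht x => ?_⟩
  · have := (key t ht x y hy).1
    simp [pert, ← hU]
    linarith
  · have := (key t ht x y hy).2.1
    simp [pert, ← hU]
    linarith
  · have := (key t ht x y hy).2.2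
    simp [pert, ← hU]
    linarith
  · obtain ⟨h1, h2⟩ := hb t ht x
    constructor
    · change (u t x (-1)).1 - -1 = 0
      rw [h1]; norm_num
    · change (u t x 1).1 - 1 = 0
      rw [h2]; norm_num
  · obtain ⟨h1, h2⟩ := hb t ht x
    exact ⟨congrArg Prod.snd h1, congrArg Prod.snd h2⟩

theorem LinfS_le {g : ℝ → ℝ → ℝ} {c : ℝ} (hc : 0 ≤ c)
    (h : ∀ x, ∀ y ∈ Icc (-1 : ℝ) 1, |g x y| ≤ c) : LinfS g ≤ c :=
  Real.iSup_le (fun x => Real.iSup_le (fun y => h x y y.2) hc) hc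

theorem LinfV_le {w : ℝ → ℝ → ℝ × ℝ} {c : ℝ} (hc : 0 ≤ c)
    (h : ∀ x, ∀ y ∈ Icc (-1 : ℝ) 1, |c1 w x y| + |c2 w x y| ≤ c) : LinfV w ≤ c := by
  refine Real.iSup_le (fun x => Real.iSup_le (fun y => ?_) hc) hc
  refine (Real.sqrt_le_left hc).2 ?_
  have := h x y y.2
  have h1 := abs_nonneg (c1 w x y)
  have h2 := abs_nonneg (c2 w x y)
  rw [← sq_abs (c1 w x y), ← sq_abs (c2 w x y)]
  nlinarith

/-- The amplification factor of the perturbation over `[0,T]`. -/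
def amp (T : ℝ) : ℝ := 300 * (1 + T) * Real.exp (800 * T)

theorem le_amp {T : ℝ} (hT : 0 < T) : 300 ≤ amp T := by
  have h1 : 1 ≤ Real.exp (800 * T) := Real.one_le_exp (by positivity)
  unfold amp
  nlinarith

theorem growth_le {T κ E : ℝ} (hT : 0 < T) (hE : E ≤ 80000 * κ ^ 2) :
    Real.exp (1600 * T) * (E + T * (182 * κ ^ 2)) ≤ (amp T * κ) ^ 2 := by
  have e1 : Real.exp (1600 * T) = Real.exp (800 * T) ^ 2 := by
    rw [← Real.exp_nat_mul]; congr 1; push_cast; ring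
  have e2 : (amp T * κ) ^ 2 = Real.exp (800 * T) ^ 2 * (90000 * (1 + T) ^ 2 * κ ^ 2) := by
    unfold amp; ring
  rw [e1, e2]
  refine mul_le_mul_of_nonneg_left ?_ (sq_nonneg _)
  have h1 : 0 ≤ T * κ ^ 2 := by positivity
  have h2 : 0 ≤ T ^ 2 * κ ^ 2 := by positivity
  nlinarith [sq_nonneg κ]

theorem start {ν T κ : ℝ} {v f : VF} {p : Fld} (hT : 0 < T) (hν : 0 < ν) (hν1 : ν ≤ 1)
    (h : Lin ν T v v p f) (hκ : 0 < κ) (hκν : 48000 * (1 + T) * (amp T * κ) ≤ √ν)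
    (hv : RegV 0 4 κ v) (hf : ∀ t ∈ Icc (0 : ℝ) T, RegV t 4 κ f ∧ RegV t 4 κ (vT f)) :
    Start ν T v p f (182 * κ ^ 2) (amp T * κ) := by
  have hL := le_amp hT
  have hκe : κ ≤ amp T * κ := by nlinarith
  have hsq : √ν ≤ 1 := Real.sqrt_le_one.2 hν1
  have hκ1 : κ ≤ 1 := by nlinarith [mul_pos hT (hκ.trans_le hκe)]
  refine ⟨h, hT, hν, hν1, by positivity, hκ.trans_le hκe, hκν, growth_le hT
    (h.En_zero_le hT ⟨hν.le, hν1⟩ hκ1 hv (hf 0 (left_mem_Icc.2 hT.le)).1.pred),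
    fun t ht => En_le_of_regV (hf t ht).1.pred (hf t ht).2.pred.pred, ?_, fun t ht x y hy => ?_,
    fun x y hy => ?_⟩
  · rw [mul_pow]
    refine mul_le_mul_of_nonneg_right ?_ (sq_nonneg _)
    nlinarith
  · have := (hf t ht).1
    exact ⟨(this.1.bound x hy).trans hκe, (this.2.dX.bound x hy).trans hκe,
      (this.1.dY.bound x hy).trans hκe⟩
  · exact ⟨(hv.1.dX.bound x hy).trans hκe, (hv.1.dY.bound x hy).trans hκe,
      (hv.2.dX.bound x hy).trans hκe, (hv.2.dY.bound x hy).trans hκe⟩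

end

end CouetteStability

open CouetteStability

/-!
Statement 2 (Theorem 3 of the paper): stability of the Couette flow above the
threshold `ν^{1/2}` on the periodic strip `Ω_𝕋`.
-/

theorem couette_stability_above_threshold (β : ℝ) (hβ : 1 / 2 < β) :
    ∃ (s₀ : ℕ) (N₀ : ℝ), ∀ s : ℕ, s₀ ≤ s → ∀ N : ℝ, N₀ ≤ N → ∀ T : ℝ, 0 < T →
      ∃ C : ℝ, 0 < C ∧ ∃ ν₀ : ℝ, 0 < ν₀ ∧
        ∀ ν ∈ Ioo (0 : ℝ) ν₀,
        ∀ (u : ℝ → ℝ → ℝ → ℝ × ℝ) (p : ℝ → ℝ → ℝ → ℝ) (f : ℝ → ℝ → ℝ → ℝ × ℝ),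
          -- `u` is a smooth solution of Navier–Stokes with viscosity `ν`, force `f`
          SmoothVF u → SmoothFn p → SmoothVF f →
          PeriodicVF u → PeriodicFn p → PeriodicVF f →
          IsNSSol ν T u p f →
          -- no-slip boundary conditions
          CouetteBC T u →
          -- initial data `ν^β`-close to Couette in `Hˢ`
          HsNorm s (fun x y => u 0 x y - Couette x y) ≤ ν ^ β →
          -- force of size `ν^N` in `C¹([0,T],Hˢ)`
          (∀ t ∈ Icc (0 : ℝ) T,
            HsNorm s (f t) ≤ ν ^ N ∧
            HsNorm s (fun x y => deriv (fun t' => f t' x y) t) ≤ ν ^ N) →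
          -- conclusions: stability estimates, uniformly on `[0,T]`
          (∀ t ∈ Icc (0 : ℝ) T,
            -- `‖u^ν − U_s‖_{L^∞([0,T],L²)} ≤ C ν^β`
            Real.sqrt (sqL2 (fun x y => c1 (u t) x y - c1 Couette x y)
                + sqL2 (fun x y => c2 (u t) x y - c2 Couette x y)) ≤ C * ν ^ β ∧
            -- `‖u^ν − U_s‖_{L^∞([0,T],L^∞)} ≤ C ν^β`
            LinfV (fun x y => u t x y - Couette x y) ≤ C * ν ^ β ∧
            -- `‖∇(u^ν − U_s)‖_{L^∞([0,T],L^∞)} ≤ C ν^{β−1/2}`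
            LinfS (gradPtNorm (fun x y => u t x y - Couette x y)) ≤ C * ν ^ (β - 1 / 2) ∧
            -- in particular `ν^{1/2−β} ‖∇×(u^ν − U_s)‖_{L^∞}` stays bounded
            ν ^ (1 / 2 - β) * LinfS (vort (fun x y => u t x y - Couette x y)) ≤ C) := by
  refine ⟨6, β, fun s hs N hN T hT => ?_⟩
  have hL := le_amp hT
  set L := amp T with hLdef
  set C := 192000 * (1 + T) * L with hC
  have hCpos : 0 < C := by positivity
  have hγ : 0 < β - 1 / 2 := by linarith
  refine ⟨C, hCpos, min 1 (C⁻¹ ^ (β - 1 / 2)⁻¹), by positivity, ?_⟩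
  intro ν hν u p f hu hp hf hup hpp hfp hsol hbc hinit hforce t ht
  have hν0 : 0 < ν := hν.1
  have hν1 : ν ≤ 1 := (hν.2.trans_le (min_le_left _ _)).le
  have hr : 0 < √ν := Real.sqrt_pos.2 hν0
  have hγle : C * ν ^ (β - 1 / 2) ≤ 1 := by
    have h1 := Real.rpow_le_rpow hν0.le (hν.2.trans_le (min_le_right _ _)).le hγ.le
    rw [Real.rpow_inv_rpow (by positivity) hγ.ne'] at h1
    calc C * ν ^ (β - 1 / 2) ≤ C * C⁻¹ := by gcongr
      _ = 1 := mul_inv_cancel₀ hCpos.ne'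
  have hsplit : ν ^ β = ν ^ (β - 1 / 2) * √ν := by
    rw [Real.sqrt_eq_rpow, ← Real.rpow_add hν0]; congr 1; ring
  have hγpos : 0 < ν ^ (β - 1 / 2) := Real.rpow_pos_of_pos hν0 _
  have hβpos : 0 < ν ^ β := Real.rpow_pos_of_pos hν0 _
  have hNβ : ν ^ N ≤ ν ^ β := Real.rpow_le_rpow_of_exponent_ge hν0 hν1 hN
  have hstart := start (κ := 4 * ν ^ β) hT hν0 hν1
    (lin_of_isNSSol hu hup hp hpp hf hfp hsol hbc) (by positivity)
    (by
      rw [← hLdef, hsplit]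
      calc 48000 * (1 + T) * (L * (4 * (ν ^ (β - 1 / 2) * √ν)))
          = C * ν ^ (β - 1 / 2) * √ν := by rw [hC]; ring
        _ ≤ 1 * √ν := by gcongr
        _ = √ν := one_mul _)
    (RegV.of_HsNorm hs (sub_couette_eq hu hup 0) hinit)
    fun t ht => ⟨RegV.of_HsNorm hs (fun _ _ => rfl) ((hforce t ht).1.trans hNβ),
      RegV.of_HsNorm hs (deriv_toVF hf hfp t) ((hforce t ht).2.trans hNβ)⟩
  have hrun := hstart.run_top
  have hctrl := hrun.ctrl t ht
  rw [← hLdef] at hrun hctrl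
  set v := pert u hu hup with hv
  have hdiv : L * (4 * ν ^ β) / √ν = 4 * L * ν ^ (β - 1 / 2) := by
    rw [hsplit]; field_simp
  have hc1 : c1 (fun x y => u t x y - Couette x y) = v.1.1 t := c1_sub_couette hu hup t
  have hc2 : c2 (fun x y => u t x y - Couette x y) = v.2.1 t := c2_sub_couette hu hup t
  refine ⟨?_, LinfV_le (by positivity) fun x y hy => ?_,
    LinfS_le (by positivity) fun x y hy => ?_, ?_⟩
  · have e1 : (fun x y => c1 (u t) x y - c1 Couette x y) = v.1.1 t := hc1
    have e2 : (fun x y => c2 (u t) x y - c2 Couette x y) = v.2.1 t := hc2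
    rw [e1, e2, sqL2_eq, sqL2_eq, ← I_add]
    have h1 := (I_dot_le_En v t).1.trans hctrl.en
    refine ((Real.sqrt_le_left hctrl.e_nonneg).2 h1).trans ?_
    have : 0 ≤ L * ν ^ β := by positivity
    have : 0 ≤ T * (L * ν ^ β) := by positivity
    rw [hC]
    nlinarith
  · rw [hc1, hc2]
    have h1 := hrun.v_le (x := x) ht hy
    have h2 := hctrl.w_le x hy
    have : 0 ≤ L * ν ^ β := by positivity
    have : 0 ≤ T * (L * ν ^ β) := by positivity
    rw [hC]
    nlinarith
  · obtain ⟨h1, h2, h3, h4⟩ := hrun.grad_le (x := x) ht hy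
    rw [mul_div_assoc, hdiv] at h1 h2 h3 h4
    rw [gradPtNorm, abs_of_nonneg (Real.sqrt_nonneg _), hc1, hc2, pdx_eq, pdx_eq, pdy_eq, pdy_eq,
      Real.sqrt_le_left (by positivity)]
    have e : C * ν ^ (β - 1 / 2) = 2 * (24000 * (1 + T) * (4 * L * ν ^ (β - 1 / 2))) := by
      rw [hC]; ring
    rw [e]
    have q1 := sq_le_sq' (neg_le_of_abs_le h1) (le_of_abs_le h1)
    have q2 := sq_le_sq' (neg_le_of_abs_le h2) (le_of_abs_le h2)
    have q3 := sq_le_sq' (neg_le_of_abs_le h3) (le_of_abs_le h3)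
    have q4 := sq_le_sq' (neg_le_of_abs_le h4) (le_of_abs_le h4)
    linarith
  · have h1 : LinfS (vort (fun x y => u t x y - Couette x y)) ≤ C * ν ^ (β - 1 / 2) := by
      refine LinfS_le (by positivity) fun x y hy => ?_
      have h2 := hrun.vorticity_le (x := x) ht hy
      rw [vort, hc1, hc2, pdx_eq, pdy_eq]
      refine h2.trans ?_
      have e : 3 * (6000 * (1 + T) * (L * (4 * ν ^ β))) / √ν
          = 18000 * (1 + T) * (L * (4 * ν ^ β) / √ν) := by ring
      rw [e, hdiv, hC]
      have : 0 ≤ (1 + T) * L * ν ^ (β - 1 / 2) := by positivity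
      nlinarith
    calc _ ≤ ν ^ (1 / 2 - β) * (C * ν ^ (β - 1 / 2)) := by gcongr
      _ = C * ν ^ ((1 / 2 - β) + (β - 1 / 2)) := by rw [Real.rpow_add hν0]; ring
      _ = C := by rw [sub_add_sub_cancel, sub_self, Real.rpow_zero, mul_one]
end
end

section
/- Let α be a nonzero real number and let ω₀ : [−1,1] → ℂ be continuous. Suppose ψ : [0,∞) × [−1,1] → ℂ is C¹ in t and C² in y, with ∂_tψ also C² in y, and satisfies for all t ≥ 0 and y ∈ [−1,1]: ∂_y²ψ(t,y) − α²ψ(t,y) = ω₀(y) e^{−iαyt} and ψ(t,−1) = ψ(t,1) = 0. Define the velocity field u₁(t,x,y) = (∂_y Φ(t,x,y), −∂_x Φ(t,x,y)) on ℝ × ℝ × [−1,1], where Φ(t,x,y) = 2 Re(e^{iαx} ψ(t,y)). Then: (i) ∇·u₁ = 0; (ii) the vertical component of u₁ vanishes at y = ±1; (iii) the vorticity ω̃ = ∂_x u₁,₂ − ∂_y u₁,₁ equals −2 Re(e^{iα(x−yt)} ω₀(y)) and satisfies the transport equation ∂_t ω̃ + y ∂_x ω̃ = 0; (iv) there exists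 a pressure function p₁(t,x,y) such that ∂_t u₁ + (U_s·∇)u₁ + (u₁·∇)U_s + ∇p₁ = 0, i.e. u₁ solves the Euler equations linearized around the Couette flow U_s(y) = (y,0). -/
/-!
Statement 3: the velocity field `u₁ = ∇^⊥ Φ` with `Φ(t,x,y) = 2 Re(e^{iαx} ψ(t,y))`
is an explicit solution of the Euler equations linearized around the Couette flow.
-/

noncomputable section

open Set

/-- The stream function `Φ(t,x,y) = 2 Re(e^{iαx} ψ(t,y))`. -/
def streamPhi (α : ℝ) (ψ : ℝ → ℝ → ℂ) (t x y : ℝ) : ℝ :=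
  2 * (Complex.exp (Complex.I * α * x) * ψ t y).re

/-- The velocity field `u₁ = ∇^⊥ Φ = (∂_y Φ, −∂_x Φ)`. -/
def uLin (α : ℝ) (ψ : ℝ → ℝ → ℂ) (t x y : ℝ) : ℝ × ℝ :=
  (deriv (fun y' => streamPhi α ψ t x y') y, -deriv (fun x' => streamPhi α ψ t x' y) x)

/-- The scalar vorticity `∂_x u₂ − ∂_y u₁` of `u₁`. -/
def vortLin (α : ℝ) (ψ : ℝ → ℝ → ℂ) (t x y : ℝ) : ℝ :=
  deriv (fun x' => (uLin α ψ t x' y).2) x - deriv (fun y' => (uLin α ψ t x y').1) y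

/-- The real plane wave `2 Re(e^{iαx} z)`, as a real-linear map of its amplitude `z`. -/
def planeWave (α x : ℝ) : ℂ →L[ℝ] ℝ :=
  (2 : ℝ) • Complex.reCLM.comp (ContinuousLinearMap.mul ℝ ℂ (Complex.exp (Complex.I * α * x)))

theorem planeWave_apply (α x : ℝ) (z : ℂ) :
    planeWave α x z = 2 * (Complex.exp (Complex.I * α * x) * z).re := by
  simp [planeWave]

theorem mul_planeWave (α x y : ℝ) (z : ℂ) : y * planeWave α x z = planeWave α x (y * z) := by
  rw [← smul_eq_mul, ← map_smul, Complex.real_smul]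

theorem hasDerivAt_planeWave (α x : ℝ) (z : ℂ) :
    HasDerivAt (fun x' => planeWave α x' z) (planeWave α x (Complex.I * α * z)) x := by
  have hphase : HasDerivAt (fun x' : ℝ => Complex.I * α * (x' : ℂ)) (Complex.I * α) x := by
    simpa using (Complex.ofRealCLM.hasDerivAt (x := x)).const_mul (Complex.I * (α : ℂ))
  have hwave := Complex.reCLM.hasFDerivAt.comp_hasDerivAt x (hphase.cexp.mul_const z)
  have h := hwave.const_mul (2 : ℝ)
  simp only [planeWave_apply]
  refine h.congr_deriv ?_
  rw [Complex.reCLM_apply, mul_assoc _ (Complex.I * (α : ℂ)) z]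

/-- Differentiation under the integral sign for a continuous integrand with continuous
parameter derivative. -/
theorem hasDerivAt_intervalIntegral_of_continuous {E : Type*} [NormedAddCommGroup E]
    [NormedSpace ℝ E] {f f' : ℝ → ℝ → E} (hf : Continuous f.uncurry)
    (hf' : Continuous f'.uncurry) (hff' : ∀ t s, HasDerivAt (fun t' => f t' s) (f' t s) t)
    (a b t : ℝ) :
    HasDerivAt (fun t' => ∫ s in a..b, f t' s) (∫ s in a..b, f' t s) t := by
  obtain ⟨C, hC⟩ := ((isCompact_closedBall t 1).prod (isCompact_uIcc (a := a) (b := b))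
    ).exists_bound_of_continuousOn hf'.continuousOn
  have hslice (t' : ℝ) : Continuous (f t') := hf.comp (Continuous.prodMk_right t')
  have hslice' : Continuous (f' t) := hf'.comp (Continuous.prodMk_right t)
  refine (intervalIntegral.hasDerivAt_integral_of_dominated_loc_of_deriv_le
    (bound := fun _ => C) (Metric.closedBall_mem_nhds t one_pos)
    (.of_forall fun t' => (hslice t').aestronglyMeasurable) ((hslice t).intervalIntegrable a b)
    hslice'.aestronglyMeasurable (.of_forall fun s hs t' ht' => ?_)
    intervalIntegrable_const (.of_forall fun s _ t' _ => hff' t' s)).2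
  exact hC (t', s) ⟨ht', uIoc_subset_uIcc hs⟩

/-- The solution of the Dirichlet problem `∂_y²ψ = R` on `[-1, 1]`, expressed through iterated
primitives of `R`. -/
theorem dirichlet_representation {ψ R : ℝ → ℂ} (hψ : ContDiff ℝ 2 ψ) (hR : Continuous R)
    (heq : ∀ y ∈ Icc (-1 : ℝ) 1, deriv (deriv ψ) y = R y) (hleft : ψ (-1) = 0)
    (hright : ψ 1 = 0) {y : ℝ} (hy : y ∈ Icc (-1 : ℝ) 1) :
    deriv ψ y = (∫ s in (-1)..y, R s) - (∫ r in (-1)..1, ∫ s in (-1)..r, R s) / 2 ∧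
    ψ y = (∫ r in (-1)..y, ∫ s in (-1)..r, R s)
      - (y + 1) * ((∫ r in (-1)..1, ∫ s in (-1)..r, R s) / 2) := by
  have hψ' : ContDiff ℝ 1 (deriv ψ) := hψ.deriv'
  have hprim : Continuous fun r => ∫ s in (-1)..r, R s :=
    intervalIntegral.continuous_primitive (fun _ _ => hR.intervalIntegrable _ _) _
  have hsub {z : ℝ} (hz : z ∈ Icc (-1 : ℝ) 1) : uIcc (-1) z ⊆ Icc (-1 : ℝ) 1 := by
    rw [uIcc_of_le hz.1]
    exact Icc_subset_Icc_right hz.2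
  have hfirst {z : ℝ} (hz : z ∈ Icc (-1 : ℝ) 1) :
      deriv ψ z = deriv ψ (-1) + ∫ s in (-1)..z, R s := by
    rw [intervalIntegral.integral_eq_sub_of_hasDerivAt (f := deriv ψ) (fun s hs => ?_)
      (hR.intervalIntegrable _ _)]
    · ring
    · rw [← heq s (hsub hz hs)]
      exact (hψ'.differentiable one_ne_zero s).hasDerivAt
  have hsecond {z : ℝ} (hz : z ∈ Icc (-1 : ℝ) 1) :
      ψ z = (z + 1) * deriv ψ (-1) + ∫ r in (-1)..z, ∫ s in (-1)..r, R s := by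
    have h := intervalIntegral.integral_eq_sub_of_hasDerivAt (f := ψ)
      (a := -1) (b := z) (fun s _ => (hψ.differentiable two_ne_zero s).hasDerivAt)
      (hψ'.continuous.intervalIntegrable _ _)
    rw [intervalIntegral.integral_congr fun s hs => hfirst (hsub hz hs),
      intervalIntegral.integral_add intervalIntegrable_const (hprim.intervalIntegrable _ _),
      intervalIntegral.integral_const, hleft, sub_zero] at h
    rw [← h, Complex.real_smul]
    push_cast
    ring
  have hslope := hsecond (right_mem_Icc.2 (by norm_num : (-1 : ℝ) ≤ 1))
  rw [hright] at hslope
  push_cast at hslope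
  have hc : deriv ψ (-1) = -((∫ r in (-1)..1, ∫ s in (-1)..r, R s) / 2) := by
    linear_combination -hslope / 2
  constructor
  · rw [hfirst hy, hc]
    ring
  · rw [hsecond hy, hc]
    ring

/-- A family of solutions of the Dirichlet problem `∂_y²ψ = R` on `[-1, 1]`, differentiable in the
parameter `t`, satisfies `∂_t ∂_y ψ = ∂_y ∂_t ψ` and `∂_y² ∂_t ψ = ∂_t R`. -/
theorem dirichlet_parameter_deriv {ψ φ R S : ℝ → ℝ → ℂ} (hR : Continuous R.uncurry)
    (hS : Continuous S.uncurry) (hRS : ∀ t y, HasDerivAt (fun t' => R t' y) (S t y) t)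
    (hψφ : ∀ t y, HasDerivAt (fun t' => ψ t' y) (φ t y) t) (hψ : ∀ t, ContDiff ℝ 2 (ψ t))
    (hφ : ∀ t, ContDiff ℝ 2 (φ t))
    (heq : ∀ t ≥ (0 : ℝ), ∀ y ∈ Icc (-1 : ℝ) 1, deriv (deriv (ψ t)) y = R t y)
    (hbc : ∀ t ≥ (0 : ℝ), ψ t (-1) = 0 ∧ ψ t 1 = 0) {t : ℝ} (ht : 0 ≤ t) {y : ℝ}
    (hy : y ∈ Icc (-1 : ℝ) 1) :
    HasDerivWithinAt (fun t' => deriv (ψ t') y) (deriv (φ t) y) (Ici 0) t ∧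
      deriv (deriv (φ t)) y = S t y := by
  have hslice {f : ℝ → ℝ → ℂ} (hf : Continuous f.uncurry) (t' : ℝ) : Continuous (f t') :=
    hf.comp (Continuous.prodMk_right t')
  have hprim {f : ℝ → ℝ → ℂ} (hf : Continuous f.uncurry) :
      Continuous (Function.uncurry fun t' r => ∫ s in (-1)..r, f t' s) :=
    intervalIntegral.continuous_parametric_primitive_of_continuous hf
  have hrep {t' : ℝ} (ht' : 0 ≤ t') {z : ℝ} (hz : z ∈ Icc (-1 : ℝ) 1) :=
    dirichlet_representation (hψ t') (hslice hR t') (heq t' ht') (hbc t' ht').1 (hbc t' ht').2 hz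
  have honce (z : ℝ) := hasDerivAt_intervalIntegral_of_continuous hR hS hRS (-1) z t
  have htwice (z : ℝ) := hasDerivAt_intervalIntegral_of_continuous (hprim hR) (hprim hS)
    (fun t' r => hasDerivAt_intervalIntegral_of_continuous hR hS hRS (-1) r t') (-1) z t
  set c : ℂ := (∫ r in (-1)..1, ∫ s in (-1)..r, S t s) / 2
  have hIci := uniqueDiffOn_Ici (0 : ℝ) t ht
  have hIcc {z : ℝ} (hz : z ∈ Icc (-1 : ℝ) 1) := uniqueDiffOn_Icc (by norm_num) z hz
  have hφ_eq {z : ℝ} (hz : z ∈ Icc (-1 : ℝ) 1) :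
      φ t z = (∫ r in (-1)..z, ∫ s in (-1)..r, S t s) - (z + 1) * c :=
    hIci.eq_deriv _ (hψφ t z).hasDerivWithinAt
      ((((htwice z).sub (((htwice 1).div_const 2).const_mul ((z : ℂ) + 1))).hasDerivWithinAt).congr
        (fun t' ht' => (hrep ht' hz).2) (hrep ht hz).2)
  have hφ' {z : ℝ} (hz : z ∈ Icc (-1 : ℝ) 1) :
      deriv (φ t) z = (∫ s in (-1)..z, S t s) - c := by
    have hlin : HasDerivAt (fun r : ℝ => ((r : ℂ) + 1) * c) c z := by
      simpa using ((Complex.ofRealCLM.hasDerivAt (x := z)).add_const 1).mul_const c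
    exact (hIcc hz).eq_deriv _
      ((hφ t).differentiable two_ne_zero z).hasDerivAt.hasDerivWithinAt
      (((((hslice (hprim hS) t).integral_hasStrictDerivAt (-1) z).hasDerivAt.sub
        hlin).hasDerivWithinAt).congr (fun r hr => hφ_eq hr) (hφ_eq hz))
  constructor
  · rw [hφ' hy]
    exact (((honce y).sub ((htwice 1).div_const 2)).hasDerivWithinAt).congr
      (fun t' ht' => (hrep ht' hy).1) (hrep ht hy).1
  · exact (hIcc hy).eq_deriv _
      ((hφ t).deriv'.differentiable one_ne_zero y).hasDerivAt.hasDerivWithinAt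
      (((((hslice hS t).integral_hasStrictDerivAt (-1) y).hasDerivAt.sub_const
        c).hasDerivWithinAt).congr (fun r hr => hφ' hr) (hφ' hy))

theorem hasDerivAt_cexp_phase (α y t : ℝ) :
    HasDerivAt (fun t' : ℝ => Complex.exp (-Complex.I * α * y * t'))
      (-Complex.I * α * y * Complex.exp (-Complex.I * α * y * t)) t := by
  have h : HasDerivAt (fun t' : ℝ => -Complex.I * α * y * (t' : ℂ)) (-Complex.I * α * y) t := by
    simpa using (Complex.ofRealCLM.hasDerivAt (x := t)).const_mul (-Complex.I * (α : ℂ) * y)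
  exact h.cexp.congr_deriv (mul_comm _ _)

/-- A solution of `∂_y²ψ − α²ψ = ω₀ e^{−iαyt}` with zero boundary values satisfies
`∂_t ∂_y ψ = ∂_y ∂_t ψ` and the time-differentiated equation. -/
theorem couette_stream_time_deriv {α : ℝ} {ω₀ : ℝ → ℂ}
    (hω₀ : ContinuousOn ω₀ (Icc (-1 : ℝ) 1)) {ψ : ℝ → ℝ → ℂ}
    (hψt : ContDiff ℝ 1 (fun q : ℝ × ℝ => ψ q.1 q.2))
    (hψy : ∀ t : ℝ, ContDiff ℝ 2 (fun y => ψ t y))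
    (hψty : ∀ t : ℝ, ContDiff ℝ 2 (fun y => deriv (fun t' => ψ t' y) t))
    (heq : ∀ t ≥ (0 : ℝ), ∀ y ∈ Icc (-1 : ℝ) 1,
      deriv (deriv (fun y' => ψ t y')) y - (α : ℂ) ^ 2 * ψ t y
        = ω₀ y * Complex.exp (-Complex.I * α * y * t))
    (hbc : ∀ t ≥ (0 : ℝ), ψ t (-1) = 0 ∧ ψ t 1 = 0) {t : ℝ} (ht : 0 ≤ t) {y : ℝ}
    (hy : y ∈ Icc (-1 : ℝ) 1) :
    HasDerivWithinAt (fun t' => deriv (ψ t') y)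
      (deriv (fun y' => deriv (fun t' => ψ t' y') t) y) (Ici 0) t ∧
    deriv (deriv (fun y' => deriv (fun t' => ψ t' y') t)) y
        - (α : ℂ) ^ 2 * deriv (fun t' => ψ t' y) t
      = ω₀ y * (-Complex.I * α * y * Complex.exp (-Complex.I * α * y * t)) := by
  have hψ_time (t y : ℝ) :
      HasDerivAt (fun t' => ψ t' y) (fderiv ℝ (fun q : ℝ × ℝ => ψ q.1 q.2) (t, y) (1, 0)) t :=
    (hψt.differentiable one_ne_zero (t, y)).hasFDerivAt.comp_hasDerivAt (f := fun t' => (t', y)) t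
      ((hasDerivAt_id t).prodMk (hasDerivAt_const t y))
  have hφ_cont : Continuous fun q : ℝ × ℝ => deriv (fun t' => ψ t' q.2) q.1 := by
    simp only [fun t y => (hψ_time t y).deriv]
    exact (hψt.continuous_fderiv one_ne_zero).clm_apply continuous_const
  have hψφ (t y : ℝ) := (hψ_time t y).differentiableAt.hasDerivAt
  have hψ_cont := hψt.continuous
  -- a continuous extension of `ω₀` to the line
  obtain ⟨w, hw, hwω₀⟩ : ∃ w : ℝ → ℂ, Continuous w ∧ ∀ y ∈ Icc (-1 : ℝ) 1, w y = ω₀ y :=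
    ⟨IccExtend (by norm_num) ((Icc (-1 : ℝ) 1).domRestrict ω₀),
      (continuousOn_iff_continuous_domRestrict.1 hω₀).Icc_extend', fun y hy => by
        rw [IccExtend_of_mem _ _ hy, domRestrict_apply]⟩
  obtain ⟨hmixed, hsecond⟩ := dirichlet_parameter_deriv
    (R := fun t y => (α : ℂ) ^ 2 * ψ t y + w y * Complex.exp (-Complex.I * α * y * t))
    (S := fun t y => (α : ℂ) ^ 2 * deriv (fun t' => ψ t' y) t
      + w y * (-Complex.I * α * y * Complex.exp (-Complex.I * α * y * t)))
    (by simp only [Function.uncurry_def]; fun_prop)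
    (by simp only [Function.uncurry_def]; fun_prop)
    (fun t y => ((hψφ t y).const_mul _).add ((hasDerivAt_cexp_phase α y t).const_mul _))
    hψφ hψy hψty (fun t ht y hy => by rw [hwω₀ y hy, ← heq t ht y hy, add_sub_cancel]) hbc ht hy
  refine ⟨hmixed, ?_⟩
  rw [hsecond, hwω₀ y hy]
  ring

theorem uLin_fst {ψ : ℝ → ℝ → ℂ} (hψy : ∀ t : ℝ, ContDiff ℝ 2 (fun y => ψ t y))
    (α t x y : ℝ) : (uLin α ψ t x y).1 = planeWave α x (deriv (ψ t) y) := by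
  have h := (planeWave α x).hasFDerivAt.comp_hasDerivAt y
    ((hψy t).differentiable two_ne_zero y).hasDerivAt
  rw [← h.deriv]
  simp only [uLin, streamPhi, ← planeWave_apply]
  rfl

theorem uLin_snd (α : ℝ) (ψ : ℝ → ℝ → ℂ) (t x y : ℝ) :
    (uLin α ψ t x y).2 = -planeWave α x (Complex.I * α * ψ t y) := by
  rw [← (hasDerivAt_planeWave α x (ψ t y)).deriv]
  simp only [uLin, streamPhi, ← planeWave_apply]

theorem hasDerivAt_uLin_fst_horizontal {ψ : ℝ → ℝ → ℂ}
    (hψy : ∀ t : ℝ, ContDiff ℝ 2 (fun y => ψ t y)) (α t x y : ℝ) :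
    HasDerivAt (fun x' => (uLin α ψ t x' y).1)
      (planeWave α x (Complex.I * α * deriv (ψ t) y)) x := by
  simp only [uLin_fst hψy]
  exact hasDerivAt_planeWave α x _

theorem hasDerivAt_uLin_fst_vertical {ψ : ℝ → ℝ → ℂ}
    (hψy : ∀ t : ℝ, ContDiff ℝ 2 (fun y => ψ t y)) (α t x y : ℝ) :
    HasDerivAt (fun y' => (uLin α ψ t x y').1) (planeWave α x (deriv (deriv (ψ t)) y)) y := by
  simp only [uLin_fst hψy]
  exact (planeWave α x).hasFDerivAt.comp_hasDerivAt y
    ((hψy t).deriv'.differentiable one_ne_zero y).hasDerivAt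

theorem hasDerivAt_uLin_snd_horizontal (α : ℝ) (ψ : ℝ → ℝ → ℂ) (t x y : ℝ) :
    HasDerivAt (fun x' => (uLin α ψ t x' y).2)
      (-planeWave α x (Complex.I * α * (Complex.I * α * ψ t y))) x := by
  simp only [uLin_snd]
  exact (hasDerivAt_planeWave α x _).neg

theorem hasDerivAt_uLin_snd_vertical {ψ : ℝ → ℝ → ℂ}
    (hψy : ∀ t : ℝ, ContDiff ℝ 2 (fun y => ψ t y)) (α t x y : ℝ) :
    HasDerivAt (fun y' => (uLin α ψ t x y').2)
      (-planeWave α x (Complex.I * α * deriv (ψ t) y)) y := by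
  simp only [uLin_snd]
  exact ((planeWave α x).hasFDerivAt.comp_hasDerivAt y
    (((hψy t).differentiable two_ne_zero y).hasDerivAt.const_mul _)).neg

theorem vortLin_eq {ψ : ℝ → ℝ → ℂ} (hψy : ∀ t : ℝ, ContDiff ℝ 2 (fun y => ψ t y))
    (α t x y : ℝ) :
    vortLin α ψ t x y = -planeWave α x (deriv (deriv (ψ t)) y - (α : ℂ) ^ 2 * ψ t y) := by
  rw [vortLin, (hasDerivAt_uLin_snd_horizontal α ψ t x y).deriv,
    (hasDerivAt_uLin_fst_vertical hψy α t x y).deriv, ← neg_add', ← map_add]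
  congr 2
  linear_combination (α : ℂ) ^ 2 * ψ t y * Complex.I_sq

theorem linearized_euler_explicit_solution
    (α : ℝ) (hα : α ≠ 0)
    (ω₀ : ℝ → ℂ) (hω₀ : ContinuousOn ω₀ (Icc (-1 : ℝ) 1))
    (ψ : ℝ → ℝ → ℂ)
    -- `ψ` is C¹ in `t`
    (hψt : ContDiff ℝ 1 (fun q : ℝ × ℝ => ψ q.1 q.2))
    -- `ψ` is C² in `y`
    (hψy : ∀ t : ℝ, ContDiff ℝ 2 (fun y => ψ t y))
    -- `∂_t ψ` is C² in `y`
    (hψty : ∀ t : ℝ, ContDiff ℝ 2 (fun y => deriv (fun t' => ψ t' y) t))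
    -- `∂_y²ψ − α²ψ = ω₀(y) e^{−iαyt}`
    (heq : ∀ t ≥ (0 : ℝ), ∀ y ∈ Icc (-1 : ℝ) 1,
      deriv (deriv (fun y' => ψ t y')) y - (α : ℂ) ^ 2 * ψ t y
        = ω₀ y * Complex.exp (-Complex.I * α * y * t))
    -- boundary conditions `ψ(t,±1) = 0`
    (hbc : ∀ t ≥ (0 : ℝ), ψ t (-1) = 0 ∧ ψ t 1 = 0) :
    -- (i) `u₁` is divergence free
    (∀ t ≥ (0 : ℝ), ∀ x : ℝ, ∀ y ∈ Icc (-1 : ℝ) 1,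
      deriv (fun x' => (uLin α ψ t x' y).1) x
        + deriv (fun y' => (uLin α ψ t x y').2) y = 0) ∧
    -- (ii) the vertical component of `u₁` vanishes at `y = ±1`
    (∀ t ≥ (0 : ℝ), ∀ x : ℝ,
      (uLin α ψ t x (-1)).2 = 0 ∧ (uLin α ψ t x 1).2 = 0) ∧
    -- (iii) the vorticity equals `−2 Re(e^{iα(x−yt)} ω₀(y))` and is transported
    (∀ t ≥ (0 : ℝ), ∀ x : ℝ, ∀ y ∈ Icc (-1 : ℝ) 1,
      vortLin α ψ t x y
        = -2 * (Complex.exp (Complex.I * α * (x - y * t)) * ω₀ y).re ∧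
      derivWithin (fun t' => vortLin α ψ t' x y) (Ici (0 : ℝ)) t
        + y * deriv (fun x' => vortLin α ψ t x' y) x = 0) ∧
    -- (iv) there is a pressure `p₁` such that `u₁` solves the linearized Euler equations
    (∃ p₁ : ℝ → ℝ → ℝ → ℝ,
      ∀ t ≥ (0 : ℝ), ∀ x : ℝ, ∀ y ∈ Icc (-1 : ℝ) 1,
        (derivWithin (fun t' => (uLin α ψ t' x y).1) (Ici (0 : ℝ)) t
            + y * deriv (fun x' => (uLin α ψ t x' y).1) x
            + (uLin α ψ t x y).2
            + deriv (fun x' => p₁ t x' y) x = 0) ∧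
        (derivWithin (fun t' => (uLin α ψ t' x y).2) (Ici (0 : ℝ)) t
            + y * deriv (fun x' => (uLin α ψ t x' y).2) x
            + deriv (fun y' => p₁ t x y') y = 0)) := by
  refine ⟨fun t _ x y _ => ?_, fun t ht x => ?_, fun t ht x y hy => ?_, ?_⟩
  · rw [(hasDerivAt_uLin_fst_horizontal hψy α t x y).deriv,
      (hasDerivAt_uLin_snd_vertical hψy α t x y).deriv, add_neg_cancel]
  · simp [uLin_snd, hbc t ht]
  · have hvort (x' : ℝ) {t' : ℝ} (ht' : 0 ≤ t') : vortLin α ψ t' x' y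
        = -planeWave α x' (ω₀ y * Complex.exp (-Complex.I * α * y * t')) := by
      rw [vortLin_eq hψy, heq t' ht' y hy]
    constructor
    · rw [hvort x ht, planeWave_apply, ← neg_mul, mul_left_comm, ← Complex.exp_add, mul_comm (ω₀ y)]
      congr 5
      ring
    · have htime := ((planeWave α x).hasFDerivAt.comp_hasDerivAt t
        ((hasDerivAt_cexp_phase α y t).const_mul (ω₀ y))).neg.hasDerivWithinAt.congr
        (s := Ici 0) (fun t' ht' => hvort x ht') (hvort x ht)
      rw [htime.derivWithin (uniqueDiffOn_Ici 0 t ht)]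
      simp only [fun x' => hvort x' ht]
      rw [deriv.fun_neg, (hasDerivAt_planeWave α x _).deriv, ← map_neg, ← map_neg, mul_planeWave,
        ← map_add]
      refine (congrArg _ ?_).trans (map_zero (planeWave α x))
      ring
  · let φ : ℝ → ℝ → ℂ := fun t y => deriv (fun t' => ψ t' y) t
    refine ⟨fun t x y => planeWave α x
      (Complex.I / α * deriv (φ t) y - y * deriv (ψ t) y + ψ t y), fun t ht x y hy => ?_⟩
    obtain ⟨hmixed, hφ_eq⟩ := couette_stream_time_deriv hω₀ hψt hψy hψty heq hbc ht hy
    have hα' : (α : ℂ) ≠ 0 := Complex.ofReal_ne_zero.2 hα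
    have hunique := uniqueDiffOn_Ici (0 : ℝ) t ht
    constructor
    · have htime := (planeWave α x).hasFDerivAt.comp_hasDerivWithinAt t hmixed
      have htime' : derivWithin (fun t' => (uLin α ψ t' x y).1) (Ici (0 : ℝ)) t
          = planeWave α x (deriv (φ t) y) := by
        simp only [uLin_fst hψy]
        exact htime.derivWithin hunique
      rw [htime', (hasDerivAt_uLin_fst_horizontal hψy α t x y).deriv, uLin_snd,
        (hasDerivAt_planeWave α x _).deriv, mul_planeWave, ← map_neg, ← map_add, ← map_add,
        ← map_add]
      refine (congrArg _ ?_).trans (map_zero (planeWave α x))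
      field_simp
      linear_combination deriv (φ t) y * Complex.I_sq
    · have hψ_time : HasDerivAt (fun t' => ψ t' y) (φ t y) t :=
        ((hψt.differentiable one_ne_zero (t, y)).comp t
          (f := fun t' : ℝ => (t', y)) (by fun_prop)).hasDerivAt
      have htime : derivWithin (fun t' => (uLin α ψ t' x y).2) (Ici (0 : ℝ)) t
          = -planeWave α x (Complex.I * α * φ t y) := by
        simp only [uLin_snd]
        exact ((planeWave α x).hasFDerivAt.comp_hasDerivAt t
          (hψ_time.const_mul _)).neg.hasDerivWithinAt.derivWithin hunique
      have hφ'' := ((hψty t).deriv'.differentiable one_ne_zero y).hasDerivAt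
      have hψ'' := ((hψy t).deriv'.differentiable one_ne_zero y).hasDerivAt
      have hψ' := ((hψy t).differentiable two_ne_zero y).hasDerivAt
      have hpressure : deriv (fun y' => planeWave α x
          (Complex.I / α * deriv (φ t) y' - y' * deriv (ψ t) y' + ψ t y')) y
          = planeWave α x (Complex.I / α * deriv (deriv (φ t)) y
            - (1 * deriv (ψ t) y + y * deriv (deriv (ψ t)) y) + deriv (ψ t) y) :=
        ((planeWave α x).hasFDerivAt.comp_hasDerivAt y (((hφ''.const_mul (Complex.I / α)).sub
          ((Complex.ofRealCLM.hasDerivAt (x := y)).mul hψ'')).add hψ')).deriv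
      rw [htime, (hasDerivAt_uLin_snd_horizontal α ψ t x y).deriv, hpressure, ← map_neg,
        ← map_neg, mul_planeWave, ← map_add, ← map_add]
      refine (congrArg _ ?_).trans (map_zero (planeWave α x))
      linear_combination Complex.I / α * hφ_eq - y * heq t ht y hy
        + (Complex.I * α * φ t y - y * ω₀ y * Complex.exp (-Complex.I * α * y * t) * Complex.I ^ 2)
          * inv_mul_cancel₀ hα'
        - (y * α ^ 2 * ψ t y + y * ω₀ y * Complex.exp (-Complex.I * α * y * t)) * Complex.I_sq
end
end

section
/- Let α > 0, let G_α be the kernel G_α(y′,y) = −(α sinh α)^{−1} sinh(α(y−1)) sinh(α(y′+1)) for y′ ≤ y and −(α sinh α)^{−1} sinh(α(y′−1)) sinh(α(y+1)) for y ≤ y′, and set a₁ = a₃ = −(sinh(α/2) + sinh(3α/2))^{−1}, a₂ = (sinh α)^{−1}, b₁ = −1/2, b₂ = 0, b₃ = 1/2. Define ψ₁(t,y) = Σ_{k=1}^{3} a_k G_α(b_k, y) e^{−iα b_k t}. Then: (i) sinh(α)·∂_yψ₁(t,−1) = a₁ sinh(3α/2) e^{iαt/2} + 1 + a₃ sinh(α/2)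 e^{−iαt/2} for all t; (ii) ∂_yψ₁(0,−1) = 0 and ∂_yψ₁(0,1) = 0; (iii) the functions t ↦ ∂_yψ₁(t,−1) and t ↦ ∂_yψ₁(t,1) are periodic of period 4π/α. -/
/-!
Statement 6: properties of the stream function `ψ₁(t,y) = Σ_k a_k G_α(b_k,y) e^{−iαb_k t}`
of the three-Dirac-mass solution of the linearized Euler equations.
-/

noncomputable section

open Set

/-- The Dirichlet kernel for `∂_y² − α²` on `[−1,1]`. -/
def greenG (α y' y : ℝ) : ℝ :=
  if y' ≤ y then
    -(Real.sinh (α * (y - 1)) * Real.sinh (α * (y' + 1))) / (α * Real.sinh α)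
  else
    -(Real.sinh (α * (y' - 1)) * Real.sinh (α * (y + 1))) / (α * Real.sinh α)

/-- The coefficient `a₁ = a₃ = −(sinh(α/2)+sinh(3α/2))⁻¹`. -/
def coefA (α : ℝ) : ℝ := -(Real.sinh (α / 2) + Real.sinh (3 * α / 2))⁻¹

/-- The stream function `ψ₁(t,y) = Σ_{k=1}^3 a_k G_α(b_k,y) e^{−iαb_k t}` with
`a₂ = (sinh α)⁻¹` and `b₁ = −1/2`, `b₂ = 0`, `b₃ = 1/2`. -/
def psione (α t y : ℝ) : ℂ :=
  (coefA α * greenG α (-(1 / 2)) y : ℝ)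
      * Complex.exp (-Complex.I * α * (-(1 / 2) : ℝ) * t)
    + ((Real.sinh α)⁻¹ * greenG α 0 y : ℝ)
      * Complex.exp (-Complex.I * α * (0 : ℝ) * t)
    + (coefA α * greenG α (1 / 2) y : ℝ)
      * Complex.exp (-Complex.I * α * ((1 / 2) : ℝ) * t)

theorem hasDerivAt_greenG_neg_one {α y' : ℝ} (hα : 0 < α) (hy : -1 < y') :
    HasDerivAt (greenG α y') (Real.sinh (α * (1 - y')) / Real.sinh α) (-1) := by
  have hs : Real.sinh α ≠ 0 := (Real.sinh_pos_iff.2 hα).ne'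
  have hlin : HasDerivAt (fun y : ℝ => α * (y + 1)) α (-1) := by
    simpa using ((hasDerivAt_id (-1 : ℝ)).add_const 1).const_mul α
  have hbranch := ((hlin.sinh.const_mul (Real.sinh (α * (y' - 1)))).neg).div_const
    (α * Real.sinh α)
  have heq : greenG α y' =ᶠ[nhds (-1)] fun y =>
      -(Real.sinh (α * (y' - 1)) * Real.sinh (α * (y + 1))) / (α * Real.sinh α) := by
    filter_upwards [Iio_mem_nhds hy] with y hy
    exact if_neg (not_le.2 hy)
  refine (hbranch.congr_of_eventuallyEq heq).congr_deriv ?_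
  rw [show α * (1 - y') = -(α * (y' - 1)) by ring, Real.sinh_neg]
  simp only [neg_add_cancel, mul_zero, Real.cosh_zero, one_mul]
  field_simp

theorem hasDerivAt_greenG_one {α y' : ℝ} (hα : 0 < α) (hy : y' < 1) :
    HasDerivAt (greenG α y') (-(Real.sinh (α * (y' + 1)) / Real.sinh α)) 1 := by
  have hs : Real.sinh α ≠ 0 := (Real.sinh_pos_iff.2 hα).ne'
  have hlin : HasDerivAt (fun y : ℝ => α * (y - 1)) α 1 := by
    simpa using ((hasDerivAt_id (1 : ℝ)).sub_const 1).const_mul α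
  have hbranch := ((hlin.sinh.mul_const (Real.sinh (α * (y' + 1)))).neg).div_const
    (α * Real.sinh α)
  have heq : greenG α y' =ᶠ[nhds 1] fun y =>
      -(Real.sinh (α * (y - 1)) * Real.sinh (α * (y' + 1))) / (α * Real.sinh α) := by
    filter_upwards [Ioi_mem_nhds hy] with y hy
    exact if_pos (le_of_lt hy)
  refine (hbranch.congr_of_eventuallyEq heq).congr_deriv ?_
  simp only [sub_self, mul_zero, Real.cosh_zero, one_mul]
  field_simp

/-- The `y`-derivative of the stream function in terms of those of the three kernels. -/
theorem hasDerivAt_psione {α t y d₁ d₂ d₃ : ℝ}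
    (h₁ : HasDerivAt (greenG α (-(1 / 2))) d₁ y) (h₂ : HasDerivAt (greenG α 0) d₂ y)
    (h₃ : HasDerivAt (greenG α (1 / 2)) d₃ y) :
    HasDerivAt (fun y => psione α t y)
      ((coefA α * d₁ : ℝ) * Complex.exp (Complex.I * α * t / 2)
        + ((Real.sinh α)⁻¹ * d₂ : ℝ)
        + (coefA α * d₃ : ℝ) * Complex.exp (-Complex.I * α * t / 2)) y := by
  have h := (((h₁.const_mul (coefA α)).ofReal_comp.mul_const
      (Complex.exp (-Complex.I * α * (-(1 / 2) : ℝ) * t))).add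
    ((h₂.const_mul (Real.sinh α)⁻¹).ofReal_comp.mul_const
      (Complex.exp (-Complex.I * α * (0 : ℝ) * t)))).add
    ((h₃.const_mul (coefA α)).ofReal_comp.mul_const
      (Complex.exp (-Complex.I * α * ((1 / 2) : ℝ) * t)))
  refine HasDerivAt.congr_deriv h ?_
  have e₁ : -Complex.I * α * ((-(1 / 2) : ℝ) : ℂ) * t = Complex.I * α * t / 2 := by
    push_cast; ring
  have e₂ : -Complex.I * α * ((0 : ℝ) : ℂ) * t = 0 := by simp
  have e₃ : -Complex.I * α * ((1 / 2 : ℝ) : ℂ) * t = -Complex.I * α * t / 2 := by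
    push_cast; ring
  rw [e₁, e₂, e₃, Complex.exp_zero, mul_one]

theorem deriv_psione_neg_one {α : ℝ} (hα : 0 < α) (t : ℝ) :
    deriv (fun y => psione α t y) (-1)
      = ((coefA α * Real.sinh (3 * α / 2) : ℝ) * Complex.exp (Complex.I * α * t / 2)
          + 1
          + (coefA α * Real.sinh (α / 2) : ℝ) * Complex.exp (-Complex.I * α * t / 2))
        / (Real.sinh α : ℂ) := by
  have hs : (Real.sinh α : ℂ) ≠ 0 := Complex.ofReal_ne_zero.2 (Real.sinh_pos_iff.2 hα).ne'
  rw [(hasDerivAt_psione (t := t) (hasDerivAt_greenG_neg_one hα (by norm_num))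
    (hasDerivAt_greenG_neg_one hα (by norm_num))
    (hasDerivAt_greenG_neg_one hα (by norm_num))).deriv,
    show α * (1 - -(1 / 2)) = 3 * α / 2 by ring, show α * (1 - 0) = α by ring,
    show α * (1 - 1 / 2) = α / 2 by ring]
  simp only [Complex.ofReal_mul, Complex.ofReal_div, Complex.ofReal_inv]
  field_simp

theorem deriv_psione_one {α : ℝ} (hα : 0 < α) (t : ℝ) :
    deriv (fun y => psione α t y) 1
      = -((coefA α * Real.sinh (α / 2) : ℝ) * Complex.exp (Complex.I * α * t / 2)
          + 1
          + (coefA α * Real.sinh (3 * α / 2) : ℝ) * Complex.exp (-Complex.I * α * t / 2))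
        / (Real.sinh α : ℂ) := by
  have hs : (Real.sinh α : ℂ) ≠ 0 := Complex.ofReal_ne_zero.2 (Real.sinh_pos_iff.2 hα).ne'
  rw [(hasDerivAt_psione (t := t) (hasDerivAt_greenG_one hα (by norm_num))
    (hasDerivAt_greenG_one hα (by norm_num))
    (hasDerivAt_greenG_one hα (by norm_num))).deriv,
    show α * (-(1 / 2) + 1) = α / 2 by ring, show α * (0 + 1) = α by ring,
    show α * (1 / 2 + 1) = 3 * α / 2 by ring]
  simp only [Complex.ofReal_mul, Complex.ofReal_div, Complex.ofReal_inv, Complex.ofReal_neg]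
  field_simp
  ring

theorem coefA_mul_sinh_add {α : ℝ} (hα : 0 < α) :
    coefA α * Real.sinh (α / 2) + coefA α * Real.sinh (3 * α / 2) = -1 := by
  have h₁ : 0 < Real.sinh (α / 2) := Real.sinh_pos_iff.2 (by positivity)
  have h₂ : 0 < Real.sinh (3 * α / 2) := Real.sinh_pos_iff.2 (by positivity)
  rw [← mul_add, coefA, neg_mul, inv_mul_cancel₀ (add_pos h₁ h₂).ne']

theorem periodic_exp_I_mul_half {α : ℝ} (hα : α ≠ 0) :
    Function.Periodic (fun t : ℝ => Complex.exp (Complex.I * α * t / 2)) (4 * Real.pi / α) := by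
  intro t
  have hα' : (α : ℂ) ≠ 0 := Complex.ofReal_ne_zero.2 hα
  have h : Complex.I * α * ((t + 4 * Real.pi / α : ℝ) : ℂ) / 2
      = Complex.I * α * t / 2 + 2 * Real.pi * Complex.I := by
    push_cast; field_simp; ring
  simp only [h, Complex.exp_periodic _]

theorem periodic_exp_neg_I_mul_half {α : ℝ} (hα : α ≠ 0) :
    Function.Periodic (fun t : ℝ => Complex.exp (-Complex.I * α * t / 2))
      (4 * Real.pi / α) := by
  intro t
  have h := congrArg (·⁻¹) (periodic_exp_I_mul_half hα t)
  simpa only [← Complex.exp_neg, neg_mul, neg_div] using h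

theorem stream_function_boundary_derivative (α : ℝ) (hα : 0 < α) :
    -- (i) explicit formula for `sinh α · ∂_y ψ₁(t,−1)`
    (∀ t : ℝ,
      (Real.sinh α : ℂ) * deriv (fun y => psione α t y) (-1)
        = (coefA α * Real.sinh (3 * α / 2) : ℝ) * Complex.exp (Complex.I * α * t / 2)
          + 1
          + (coefA α * Real.sinh (α / 2) : ℝ) * Complex.exp (-Complex.I * α * t / 2)) ∧
    -- (ii) vanishing of the normal derivative at `t = 0`
    (deriv (fun y => psione α 0 y) (-1) = 0 ∧ deriv (fun y => psione α 0 y) 1 = 0) ∧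
    -- (iii) periodicity in time with period `4π/α`
    (Function.Periodic (fun t => deriv (fun y => psione α t y) (-1)) (4 * Real.pi / α) ∧
     Function.Periodic (fun t => deriv (fun y => psione α t y) 1) (4 * Real.pi / α)) := by
  have hs : (Real.sinh α : ℂ) ≠ 0 := Complex.ofReal_ne_zero.2 (Real.sinh_pos_iff.2 hα).ne'
  have hsum : ((coefA α * Real.sinh (α / 2) : ℝ) : ℂ)
      + (coefA α * Real.sinh (3 * α / 2) : ℝ) = -1 := by
    exact_mod_cast congrArg Complex.ofReal (coefA_mul_sinh_add hα)
  refine ⟨fun t => ?_, ⟨?_, ?_⟩, fun t => ?_, fun t => ?_⟩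
  · rw [deriv_psione_neg_one hα, mul_div_cancel₀ _ hs]
  · rw [deriv_psione_neg_one hα, div_eq_zero_iff]
    left
    simp only [Complex.ofReal_zero, mul_zero, zero_div, Complex.exp_zero, mul_one]
    linear_combination hsum
  · rw [deriv_psione_one hα, div_eq_zero_iff]
    left
    simp only [Complex.ofReal_zero, mul_zero, zero_div, Complex.exp_zero, mul_one]
    linear_combination -hsum
  · have h₁ := periodic_exp_I_mul_half hα.ne' t
    have h₂ := periodic_exp_neg_I_mul_half hα.ne' t
    simp only [deriv_psione_neg_one hα] at h₁ h₂ ⊢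
    rw [h₁, h₂]
  · have h₁ := periodic_exp_I_mul_half hα.ne' t
    have h₂ := periodic_exp_neg_I_mul_half hα.ne' t
    simp only [deriv_psione_one hα] at h₁ h₂ ⊢
    rw [h₁, h₂]
end
end
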